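/- arXiv:2411.07017 — 7 statements merged into one kernel-verified Lean document; each statement's English description precedes it below -/
import Mathlib

section
/- Let q be a prime power, M ≥ 1 an integer, and let A ∈ GL(n, F_q) be a matrix whose characteristic polynomial f is irreducible of degree n over F_q. Then the equation α^M = A has a solution α ∈ GL(n, F_q) if and only if the polynomial f(t^M) has a monic irreducible factor of degree n over F_q. -/
open Polynomial

/-- For `f` monic and irreducible, the `M`-th power of a root of an irreducible divisor of
`f(t ^ M)` has minimal polynomial `f`. -/
theorem minpoly_root_pow_eq {F : Type*} [Field F] {M : ℕ} {f g : F[X]} [Fact (Irreducible g)]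
    (hf : Irreducible f) (hfm : f.Monic) (hgf : g ∣ f.comp (X ^ M)) :
    minpoly F (AdjoinRoot.root g ^ M) = f := by
  refine (minpoly.eq_of_irreducible_of_monic hf ?_ hfm).symm
  have h : aeval (AdjoinRoot.root g) (f.comp (X ^ M)) = 0 := by
    rw [AdjoinRoot.aeval_eq]
    exact AdjoinRoot.mk_eq_zero.2 hgf
  simpa [aeval_comp] using h

/-- Let `F` be a finite field (with `q` elements), `M ≥ 1`, and
`A ∈ GL(n, F)` a matrix whose characteristic polynomial `f` is irreducible (of degree `n`).
Then `α ^ M = A` has a solution `α ∈ GL(n, F)` iff `f(t^M)` has a monic irreducible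
factor of degree `n`. -/
theorem power_root_in_GL_iff {F : Type*} [Field F] [Fintype F] {n M : ℕ} (hM : 1 ≤ M)
    (A : GL (Fin n) F)
    (hf : Irreducible (Matrix.charpoly (A : Matrix (Fin n) (Fin n) F))) :
    (∃ α : GL (Fin n) F, α ^ M = A) ↔
      ∃ g : F[X], g.Monic ∧ Irreducible g ∧
        g ∣ (Matrix.charpoly (A : Matrix (Fin n) (Fin n) F)).comp (X ^ M) ∧
        g.natDegree = n := by
  have hfm := Matrix.charpoly_monic (A : Matrix (Fin n) (Fin n) F)
  have hfd : (Matrix.charpoly (A : Matrix (Fin n) (Fin n) F)).natDegree = n := by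
    simp
  have hfA := Matrix.aeval_self_charpoly (A : Matrix (Fin n) (Fin n) F)
  generalize Matrix.charpoly (A : Matrix (Fin n) (Fin n) F) = f at hf hfm hfd hfA ⊢
  have hn : 0 < n := hfd ▸ hf.natDegree_pos
  have : Nonempty (Fin n) := ⟨⟨0, hn⟩⟩
  constructor
  · rintro ⟨α, hα⟩
    have hαA : (α : Matrix (Fin n) (Fin n) F) ^ M = A := by rw [← hα, Units.val_pow_eq_pow_val]
    have hint : IsIntegral F (α : Matrix (Fin n) (Fin n) F) := Matrix.isIntegral _
    obtain ⟨g, hgm, hgi, hgd⟩ := exists_monic_irreducible_factor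
      (minpoly F (α : Matrix (Fin n) (Fin n) F)) (minpoly.not_isUnit F _)
    have hgf : g ∣ f.comp (X ^ M) := by
      refine hgd.trans (minpoly.dvd F _ ?_)
      simpa [aeval_comp, hαA] using hfA
    refine ⟨g, hgm, hgi, hgf, le_antisymm ?_ ?_⟩
    · refine (natDegree_le_of_dvd
        (hgd.trans (Matrix.minpoly_dvd_charpoly (α : Matrix (Fin n) (Fin n) F)))
        (Matrix.charpoly_monic _).ne_zero).trans_eq ?_
      simp
    · have : Fact (Irreducible g) := ⟨hgi⟩
      have hfin : Module.Finite F (AdjoinRoot g) := (AdjoinRoot.powerBasis hgi.ne_zero).finite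
      rw [← hfd, ← minpoly_root_pow_eq hf hfm hgf, ← AdjoinRoot.powerBasis_dim hgi.ne_zero,
        ← PowerBasis.finrank]
      exact minpoly.natDegree_le _
  · rintro ⟨g, -, hgi, hgf, hgn⟩
    have : Fact (Irreducible g) := ⟨hgi⟩
    have hfin : Module.Finite F (AdjoinRoot g) := (AdjoinRoot.powerBasis hgi.ne_zero).finite
    have hmin := minpoly_root_pow_eq hf hfm hgf
    have htop : IntermediateField.adjoin F {AdjoinRoot.root g ^ M} = ⊤ := by
      rw [Field.primitive_element_iff_minpoly_natDegree_eq, hmin, hfd,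
        (AdjoinRoot.powerBasis hgi.ne_zero).finrank, AdjoinRoot.powerBasis_dim, hgn]
    obtain ⟨p, hp⟩ : ∃ p : F[X], aeval (AdjoinRoot.root g ^ M) p = AdjoinRoot.root g := by
      have hmem : AdjoinRoot.root g ∈ Algebra.adjoin F {AdjoinRoot.root g ^ M} := by
        rw [← IntermediateField.adjoin_simple_toSubalgebra_of_isAlgebraic
          (Algebra.IsAlgebraic.isAlgebraic _), htop]
        trivial
      rwa [Algebra.adjoin_singleton_eq_range_aeval] at hmem
    have hpow : aeval (A : Matrix (Fin n) (Fin n) F) p ^ M = A := by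
      obtain ⟨r, hr⟩ : f ∣ p ^ M - X := by
        rw [← hmin]
        exact minpoly.dvd F _ (by simp [hp])
      have h := congrArg (aeval (A : Matrix (Fin n) (Fin n) F)) hr
      rw [map_mul, hfA, zero_mul] at h
      simpa [sub_eq_zero] using h
    have hunit : IsUnit (aeval (A : Matrix (Fin n) (Fin n) F) p) :=
      by
      rw [← isUnit_pow_iff (by omega : M ≠ 0), hpow]
      exact A.isUnit
    exact ⟨hunit.unit, Units.ext (by simpa using hpow)⟩
end

section
/- Let q be a prime power, M ≥ 1 an integer, and let A ∈ Sp(2n, F_q) be a matrix in the symplectic group whose characteristic polynomial f is a self-reciprocal irreducible monic (SRIM) polynomial of degree 2n. Then the equation α^M = A has a solution α ∈ Sp(2n, F_q) if and only if f(t^M) has a SRIM factor of degree 2n over F_q. -/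
open Polynomial

/-- The dual of a monic polynomial `f` of degree `r` with `f 0 ≠ 0`:
`f*(t) = f(0)⁻¹ ⬝ t^r ⬝ f(t⁻¹)`, realized via `Polynomial.reverse`. -/
noncomputable def Polynomial.dual {F : Type*} [Field F] (f : F[X]) : F[X] :=
  C (f.eval 0)⁻¹ * f.reverse

/-- A self-reciprocal irreducible monic (SRIM) polynomial: a monic irreducible
polynomial `f` with `f = f*`. -/
def Polynomial.IsSRIM {F : Type*} [Field F] (f : F[X]) : Prop :=
  f.Monic ∧ Irreducible f ∧ f = f.dual

open Matrix in
/-- The characteristic polynomial of a symplectic matrix is self-reciprocal. -/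
theorem SymplecticGroup.charpoly_eq_dual {l F : Type*} [DecidableEq l] [Fintype l] [Field F]
    (A : symplecticGroup l F) :
    (A : Matrix (l ⊕ l) (l ⊕ l) F).charpoly = (A : Matrix (l ⊕ l) (l ⊕ l) F).charpoly.dual := by
  obtain ⟨A, hA⟩ := A
  change A.charpoly = A.charpoly.dual
  have hinv := SymplecticGroup.inv_eq_symplectic_inv A hA
  have hdet := SymplecticGroup.symplectic_det hA
  have hsim : (A⁻¹).charpoly = A.charpoly := by
    rw [hinv, charpoly_mul_comm, ← Matrix.mul_assoc, Matrix.mul_neg, J_squared, neg_neg,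
      Matrix.one_mul, charpoly_transpose]
  have h0 : A.charpoly.eval 0 = A.det := by
    simp [det_eq_sign_charpoly_coeff, ← coeff_zero_eq_eval_zero, ← two_mul]
  rw [Polynomial.dual, h0, reverse_charpoly]
  conv_lhs => rw [← hsim, charpoly_inv _ ((isUnit_iff_isUnit_det A).2 hdet)]
  simp [← two_mul]

open Matrix in
/-- If `B` is a left inverse of a symplectic matrix `A`, then the symplectic adjoint of `p(A)`
is `p(B)`. -/
theorem SymplecticGroup.J_mul_transpose_aeval {l R : Type*} [DecidableEq l] [Fintype l]
    [CommRing R] {A B : Matrix (l ⊕ l) (l ⊕ l) R} (hA : A ∈ symplecticGroup l R)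
    (hBA : B * A = 1) (p : R[X]) : J l R * (aeval A p)ᵀ = aeval B p * J l R := by
  have h : J l R * Aᵀ = B * J l R := by
    rw [← SymplecticGroup.mem_iff.1 hA, ← Matrix.mul_assoc, ← Matrix.mul_assoc, hBA,
      Matrix.one_mul, SymplecticGroup.mem_iff.1 hA]
  have hpow (k : ℕ) : J l R * (Aᵀ) ^ k = B ^ k * J l R := by
    have hs : SemiconjBy (J l R) Aᵀ B := h
    exact hs.pow_right k
  induction p using Polynomial.induction_on' with
  | add p q hp hq => simp [Matrix.mul_add, Matrix.add_mul, hp, hq]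
  | monomial k a =>
    simp [aeval_monomial, Algebra.algebraMap_eq_smul_one, transpose_pow, hpow]

theorem Polynomial.IsSRIM.aeval_inv_eq_zero {F K : Type*} [Field F] [Field K] [Algebra F K]
    {g : F[X]} (hg : g.IsSRIM) {x : K} (hx : aeval x g = 0) : aeval x⁻¹ g = 0 := by
  obtain ⟨-, -, hdual⟩ := hg
  rcases eq_or_ne x 0 with rfl | hx0
  · simpa using hx
  let _ := invertibleOfNonzero hx0
  have h := (eval₂_reverse_eq_zero_iff (algebraMap F K) x g).2 hx
  rw [hdual, Polynomial.dual, map_mul, aeval_def x⁻¹ g.reverse, ← invOf_eq_inv, h, mul_zero]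

theorem Polynomial.IsSRIM.ne_zero_of_aeval_eq_zero {F K : Type*} [Field F] [Field K]
    [Algebra F K] {g : F[X]} (hg : g.IsSRIM) {x : K} (hx : aeval x g = 0) : x ≠ 0 := by
  rintro rfl
  obtain ⟨-, hirr, hdual⟩ := hg
  have h0 : g.eval 0 = 0 := by
    simpa [aeval_def, eval₂_at_zero, coeff_zero_eq_eval_zero] using hx
  exact hirr.ne_zero (by rw [hdual, Polynomial.dual, h0]; simp)

/-- An irreducible divisor of `f(t^M)`, with `f` irreducible, has degree at least that of `f`. -/
theorem Polynomial.natDegree_le_of_dvd_comp_X_pow {F : Type*} [Field F] {f p : F[X]} {M : ℕ}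
    (hf : Irreducible f) (hfm : f.Monic) (hp : Irreducible p) (hdvd : p ∣ f.comp (X ^ M)) :
    f.natDegree ≤ p.natDegree := by
  have := Fact.mk hp
  have := (AdjoinRoot.powerBasis hp.ne_zero).finite
  have hroot : aeval (AdjoinRoot.root p ^ M) f = 0 := by
    have h := aeval_eq_zero_of_dvd_aeval_eq_zero hdvd ((AdjoinRoot.aeval_eq p).trans
      AdjoinRoot.mk_self)
    simpa [aeval_comp] using h
  rw [minpoly.eq_of_irreducible_of_monic hf hroot hfm]
  exact (minpoly.natDegree_le _).trans_eq
    ((AdjoinRoot.powerBasis hp.ne_zero).finrank.trans (AdjoinRoot.powerBasis_dim hp.ne_zero))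

/-- If an irreducible `g` of the same degree as `f` divides `f(t^M)`, then the root of `f` in
`F[t]/(f)` has an `M`-th root that is a root of `g`. -/
theorem AdjoinRoot.exists_pow_eq_root {F : Type*} [Field F] {f g : F[X]} {M : ℕ}
    (hf : Irreducible f) (hg : Irreducible g) (hdvd : g ∣ f.comp (X ^ M))
    (hdeg : g.natDegree = f.natDegree) :
    ∃ γ : AdjoinRoot f, γ ^ M = AdjoinRoot.root f ∧ aeval γ g = 0 := by
  have := Fact.mk hf
  have := Fact.mk hg
  have := (AdjoinRoot.powerBasis hf.ne_zero).finite
  have := (AdjoinRoot.powerBasis hg.ne_zero).finite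
  have hgroot : aeval (AdjoinRoot.root g) g = 0 := (AdjoinRoot.aeval_eq g).trans
    AdjoinRoot.mk_self
  have hroot : aeval (AdjoinRoot.root g ^ M) f = 0 := by
    simpa [aeval_comp] using aeval_eq_zero_of_dvd_aeval_eq_zero hdvd hgroot
  let φ : AdjoinRoot f →ₐ[F] AdjoinRoot g :=
    AdjoinRoot.liftAlgHom f (Algebra.ofId F _) (AdjoinRoot.root g ^ M) hroot
  have hφ : φ (AdjoinRoot.root f) = AdjoinRoot.root g ^ M := AdjoinRoot.liftAlgHom_root ..
  have hinj : Function.Injective φ := φ.toRingHom.injective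
  have hsurj : Function.Surjective φ :=
    (LinearMap.injective_iff_surjective_of_finrank_eq_finrank (f := φ.toLinearMap) (by
      rw [(AdjoinRoot.powerBasis hf.ne_zero).finrank, (AdjoinRoot.powerBasis hg.ne_zero).finrank,
        AdjoinRoot.powerBasis_dim, AdjoinRoot.powerBasis_dim, hdeg])).1 hinj
  obtain ⟨γ, hγ⟩ := hsurj (AdjoinRoot.root g)
  refine ⟨γ, hinj (by rw [map_pow, hγ, hφ]), hinj ?_⟩
  rw [← aeval_algHom_apply, hγ, hgroot, map_zero]


/-- Let `F` be a finite field, `M ≥ 1`, and `A ∈ Sp(2n, F)` a symplectic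
matrix whose characteristic polynomial `f` is SRIM (of degree `2n`). Then `α ^ M = A` has a
solution `α ∈ Sp(2n, F)` iff `f(t^M)` has a SRIM factor of degree `2n`. -/
theorem power_root_in_Sp_iff {F : Type*} [Field F] [Fintype F] {n M : ℕ} (hM : 1 ≤ M)
    (A : Matrix.symplecticGroup (Fin n) F)
    (hf : Polynomial.IsSRIM
        (Matrix.charpoly (A : Matrix (Fin n ⊕ Fin n) (Fin n ⊕ Fin n) F)))
    (hdeg : (Matrix.charpoly (A : Matrix (Fin n ⊕ Fin n) (Fin n ⊕ Fin n) F)).natDegree = 2 * n) :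
    (∃ α : Matrix.symplecticGroup (Fin n) F, α ^ M = A) ↔
      ∃ g : F[X], g.IsSRIM ∧
        g ∣ (Matrix.charpoly (A : Matrix (Fin n ⊕ Fin n) (Fin n ⊕ Fin n) F)).comp (X ^ M) ∧
        g.natDegree = 2 * n := by
  set f := Matrix.charpoly (A : Matrix (Fin n ⊕ Fin n) (Fin n ⊕ Fin n) F) with hfdef
  obtain ⟨hfm, hfirr, -⟩ := id hf
  have hfA : aeval (A : Matrix (Fin n ⊕ Fin n) (Fin n ⊕ Fin n) F) f = 0 :=
    Matrix.aeval_self_charpoly _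
  constructor
  · rintro ⟨α, hα⟩
    have hαA : (α : Matrix (Fin n ⊕ Fin n) (Fin n ⊕ Fin n) F) ^ M = A := by
      rw [← hα, SubmonoidClass.coe_pow]
    have hn : Nonempty (Fin n ⊕ Fin n) := by
      by_contra h
      rw [not_nonempty_iff] at h
      exact hfirr.not_isUnit (by rw [hfdef, Matrix.charpoly_isEmpty]; exact isUnit_one)
    have hmin : minpoly F (α : Matrix (Fin n ⊕ Fin n) (Fin n ⊕ Fin n) F) ∣ f.comp (X ^ M) :=
      minpoly.dvd _ _ (by simpa [aeval_comp, hαA] using hfA)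
    obtain ⟨p, hpm, hpirr, hpdvd⟩ :=
      exists_monic_irreducible_factor _ (minpoly.not_isUnit F
        (α : Matrix (Fin n ⊕ Fin n) (Fin n ⊕ Fin n) F))
    have hαdeg : (Matrix.charpoly
        (α : Matrix (Fin n ⊕ Fin n) (Fin n ⊕ Fin n) F)).natDegree = 2 * n := by
      simp [two_mul]
    have hp : p = Matrix.charpoly (α : Matrix (Fin n ⊕ Fin n) (Fin n ⊕ Fin n) F) :=
      (eq_of_monic_of_dvd_of_natDegree_le hpm (Matrix.charpoly_monic _)
        (hpdvd.trans (Matrix.minpoly_dvd_charpoly _))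
        ((hαdeg.trans hdeg.symm).trans_le
          (natDegree_le_of_dvd_comp_X_pow hfirr hfm hpirr (hpdvd.trans hmin)))).symm
    refine ⟨p, ⟨hpm, hpirr, ?_⟩, hpdvd.trans hmin, hp ▸ hαdeg⟩
    rw [hp]
    exact SymplecticGroup.charpoly_eq_dual α
  · rintro ⟨g, hg, hdvd, hgdeg⟩
    obtain ⟨γ, hγM, hγg⟩ :=
      AdjoinRoot.exists_pow_eq_root hfirr hg.2.1 hdvd (hgdeg.trans hdeg.symm)
    have := Fact.mk hfirr
    have := (AdjoinRoot.powerBasis hfirr.ne_zero).finite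
    have : Finite (AdjoinRoot f) := Module.finite_of_finite F
    have hγ0 : γ ≠ 0 := hg.ne_zero_of_aeval_eq_zero hγg
    have hconj : IsConjRoot F γ⁻¹ γ := by
      rw [isConjRoot_def, ← minpoly.eq_of_irreducible_of_monic hg.2.1 hγg hg.1,
        ← minpoly.eq_of_irreducible_of_monic hg.2.1 (hg.aeval_inv_eq_zero hγg) hg.1]
    obtain ⟨τ, hτ⟩ := isConjRoot_iff_exists_algEquiv.1 hconj
    have hτroot : τ (AdjoinRoot.root f) = (AdjoinRoot.root f)⁻¹ := by
      rw [← hγM, map_pow, hτ, inv_pow]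
    have hroot0 : AdjoinRoot.root f ≠ 0 := by
      rw [← hγM]
      exact pow_ne_zero M hγ0
    let ρ : AdjoinRoot f →ₐ[F] Matrix (Fin n ⊕ Fin n) (Fin n ⊕ Fin n) F :=
      Ideal.Quotient.liftₐ (Ideal.span {f}) (aeval (A : Matrix (Fin n ⊕ Fin n) (Fin n ⊕ Fin n) F))
        fun a ha => aeval_eq_zero_of_dvd_aeval_eq_zero (Ideal.mem_span_singleton.1 ha) hfA
    have hρ : ρ (AdjoinRoot.root f) = A := aeval_X _
    obtain ⟨p, hp⟩ := AdjoinRoot.mk_surjective γ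
    rw [← AdjoinRoot.aeval_eq] at hp
    have hργ : ρ γ = aeval (A : Matrix (Fin n ⊕ Fin n) (Fin n ⊕ Fin n) F) p := by
      rw [← hp, ← aeval_algHom_apply, hρ]
    have hργinv : ρ γ⁻¹ = aeval (ρ (AdjoinRoot.root f)⁻¹) p := by
      rw [← hτ, ← hτroot, ← hp, aeval_algHom_apply ρ, aeval_algHom_apply τ]
    have hBA : ρ (AdjoinRoot.root f)⁻¹ * A = 1 := by
      rw [← hρ, ← map_mul, inv_mul_cancel₀ hroot0, map_one]
    refine ⟨⟨ρ γ, ?_⟩, Subtype.ext ?_⟩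
    · rw [SymplecticGroup.mem_iff, Matrix.mul_assoc]
      conv_lhs => rw [hργ, SymplecticGroup.J_mul_transpose_aeval A.2 hBA, ← hργ, ← hργinv]
      rw [← Matrix.mul_assoc, ← map_mul, mul_inv_cancel₀ hγ0, map_one, Matrix.one_mul]
    · rw [SubmonoidClass.coe_pow, ← map_pow, hγM, hρ]
end

section
/- Let q be a prime power, M ≥ 1 an integer, and let A ∈ U(n, q²) be a matrix in the unitary group whose characteristic polynomial f is a self-conjugate irreducible monic (SCIM) polynomial of degree n over F_{q²}. Then the equation α^M = A has a solution α ∈ U(n, q²) if and only if f(t^M) has a SCIM factor of degree n over F_{q²}. -/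
open Polynomial Matrix

variable {E : Type*} [Field E]

/-- `f̃(t) = conj(f(0))⁻¹ ⬝ t^d ⬝ f̄(t⁻¹)` where `conj` is a ring endomorphism applied to
the coefficients (realized via `Polynomial.reverse`). -/
noncomputable def Polynomial.conjDual (conj : E →+* E) (f : E[X]) : E[X] :=
  C (conj (f.eval 0))⁻¹ * (f.map conj).reverse

/-- A self-conjugate irreducible monic (SCIM) polynomial: a monic irreducible polynomial
`f` with `f̃ = f`. -/
def Polynomial.IsSCIM (conj : E →+* E) (f : E[X]) : Prop :=
  f.Monic ∧ Irreducible f ∧ f.conjDual conj = f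

/-- `A` is a member of the unitary group `U(n, q²)`: `Āᵀ A = 1`, where `Ā` applies the
conjugation `x ↦ x^q` entrywise. -/
def Matrix.IsUnitaryWrt {n : ℕ} (conj : E →+* E) (A : Matrix (Fin n) (Fin n) E) : Prop :=
  (A.map conj)ᵀ * A = 1

/-- Polynomial expressions in a matrix are compatible with conjugate transposition. -/
theorem Matrix.transpose_map_aeval {n : ℕ} (conj : E →+* E) (A : Matrix (Fin n) (Fin n) E)
    (P : E[X]) : ((aeval A P).map conj)ᵀ = aeval ((A.map conj)ᵀ) (P.map conj) := by
  induction P using Polynomial.induction_on' with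
  | add P Q hP hQ =>
    rw [map_add, Polynomial.map_add, map_add, ← hP, ← hQ, ← Matrix.transpose_add,
      Matrix.map_add _ (map_add conj)]
  | monomial m a =>
    have hpow : (A ^ m).map conj = (A.map conj) ^ m := map_pow conj.mapMatrix A m
    rw [aeval_monomial, Polynomial.map_monomial, aeval_monomial, ← Matrix.transpose_pow, ← hpow,
      ← Algebra.smul_def, ← Algebra.smul_def]
    ext i j
    simp

section Evaluation

variable {L R : Type*} [Field L] [Algebra E L] [Ring R] [Algebra E R]

/-- If every polynomial relation of `x` holds for `a`, and `x` generates a field `L`, then an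
inverse of `a` is the same polynomial in `a` as `x⁻¹` is in `x`. -/
theorem Polynomial.exists_aeval_eq_inv {x : L} {a b : R}
    (hrel : ∀ P : E[X], aeval x P = 0 → aeval a P = 0)
    (hsurj : ∀ y : L, ∃ P : E[X], aeval x P = y) (hx : x ≠ 0) (hab : b * a = 1) :
    ∃ r : E[X], aeval x r = x⁻¹ ∧ aeval a r = b := by
  obtain ⟨r, hr⟩ := hsurj x⁻¹
  refine ⟨r, hr, ?_⟩
  have h : a * aeval a r = 1 := by
    have := hrel (X * r - 1) (by simp [hr, hx])
    simpa [sub_eq_zero] using this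
  exact (left_inv_eq_right_inv hab h).symm

theorem AdjoinRoot.aeval_eq_zero_of_aeval_root {g : E[X]} {a : R} (ha : aeval a g = 0) (P : E[X])
    (hP : aeval (AdjoinRoot.root g) P = 0) : aeval a P = 0 := by
  rw [AdjoinRoot.aeval_eq, AdjoinRoot.mk_eq_zero] at hP
  obtain ⟨Q, rfl⟩ := hP
  rw [map_mul, ha, zero_mul]

theorem AdjoinRoot.exists_aeval_root_eq (g : E[X]) (y : AdjoinRoot g) :
    ∃ P : E[X], aeval (AdjoinRoot.root g) P = y := by
  obtain ⟨P, rfl⟩ := AdjoinRoot.mk_surjective y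
  exact ⟨P, AdjoinRoot.aeval_eq P⟩

/-- A root of an irreducible polynomial `f` satisfies exactly the relations given by `f`. -/
theorem Irreducible.dvd_of_aeval_eq_zero {f : E[X]} (hf : Irreducible f) {x : L}
    (hx : aeval x f = 0) {P : E[X]} (hP : aeval x P = 0) : f ∣ P := by
  by_contra h
  obtain ⟨a, b, hab⟩ := hf.coprime_iff_not_dvd.2 h
  simpa [hx, hP] using congrArg (aeval x) hab

/-- Evaluation at a root of an irreducible `f`, as an embedding of fields. -/
theorem Irreducible.exists_algHom_adjoinRoot {f : E[X]} (hf : Irreducible f) {x : L}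
    (hx : aeval x f = 0) : ∃ φ : AdjoinRoot f →ₐ[E] L,
      Function.Injective φ ∧ ∀ P, φ (AdjoinRoot.mk f P) = aeval x P := by
  have := Fact.mk hf
  exact ⟨AdjoinRoot.liftAlgHom f (Algebra.ofId E L) x hx, RingHom.injective _,
    AdjoinRoot.liftAlgHom_mk f (Algebra.ofId E L) x hx⟩

theorem AdjoinRoot.finrank_eq_natDegree {f : E[X]} (hf : f ≠ 0) :
    Module.finrank E (AdjoinRoot f) = f.natDegree := by
  rw [(AdjoinRoot.powerBasis hf).finrank, AdjoinRoot.powerBasis_dim]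

theorem Irreducible.natDegree_le_finrank [FiniteDimensional E L] {f : E[X]} (hf : Irreducible f)
    {x : L} (hx : aeval x f = 0) : f.natDegree ≤ Module.finrank E L := by
  obtain ⟨φ, hφ, -⟩ := hf.exists_algHom_adjoinRoot hx
  rw [← AdjoinRoot.finrank_eq_natDegree hf.ne_zero]
  exact LinearMap.finrank_le_finrank_of_injective (f := φ.toLinearMap) hφ

theorem Irreducible.exists_aeval_eq [FiniteDimensional E L] {f : E[X]} (hf : Irreducible f)
    {x : L} (hx : aeval x f = 0) (hdeg : f.natDegree = Module.finrank E L) (y : L) :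
    ∃ P : E[X], aeval x P = y := by
  obtain ⟨φ, hφ, hmk⟩ := hf.exists_algHom_adjoinRoot hx
  have : FiniteDimensional E (AdjoinRoot f) :=
    (AdjoinRoot.powerBasis hf.ne_zero).finite
  have hs : Function.Surjective φ.toLinearMap :=
    (LinearMap.injective_iff_surjective_of_finrank_eq_finrank
      ((AdjoinRoot.finrank_eq_natDegree hf.ne_zero).trans hdeg)).1 hφ
  obtain ⟨z, rfl⟩ := hs y
  obtain ⟨P, rfl⟩ := AdjoinRoot.mk_surjective z
  exact ⟨P, (hmk P).symm⟩

end Evaluation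

theorem Polynomial.aeval_root_pow_eq_zero_of_dvd {f g : E[X]} {M : ℕ} (h : g ∣ f.comp (X ^ M)) :
    aeval (AdjoinRoot.root g ^ M) f = 0 := by
  have := AdjoinRoot.mk_eq_zero.2 h
  rwa [← AdjoinRoot.aeval_eq, aeval_comp, map_pow, aeval_X] at this

theorem Irreducible.natDegree_le_of_dvd_comp {f g : E[X]} {M : ℕ} (hf : Irreducible f)
    (hg : Irreducible g) (h : g ∣ f.comp (X ^ M)) : f.natDegree ≤ g.natDegree := by
  have := Fact.mk hg
  have : FiniteDimensional E (AdjoinRoot g) := (AdjoinRoot.powerBasis hg.ne_zero).finite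
  rw [← AdjoinRoot.finrank_eq_natDegree hg.ne_zero]
  exact hf.natDegree_le_finrank (aeval_root_pow_eq_zero_of_dvd h)

theorem AdjoinRoot.aeval_inv_root_map_eq_zero_iff (conj : E →+* E) {g : E[X]}
    [Fact (Irreducible g)] (h0 : AdjoinRoot.root g ≠ 0) :
    aeval (AdjoinRoot.root g)⁻¹ (g.map conj) = 0 ↔
      aeval (AdjoinRoot.root g) (g.map conj).reverse = 0 := by
  let := invertibleOfNonzero (inv_ne_zero h0)
  rw [aeval_def, aeval_def, ← eval₂_reverse_eq_zero_iff, invOf_eq_inv, inv_inv]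

/-- A SCIM polynomial does not vanish at zero. -/
theorem Polynomial.IsSCIM.eval_zero_ne_zero {conj : E →+* E} {g : E[X]} (hg : g.IsSCIM conj) :
    g.eval 0 ≠ 0 := by
  intro h
  apply hg.2.1.ne_zero
  rw [← hg.2.2, conjDual, h]
  simp

theorem AdjoinRoot.root_eq_zero_iff {g : E[X]} [Fact (Irreducible g)] :
    AdjoinRoot.root g = 0 ↔ g.eval 0 = 0 := by
  have hroot : aeval (AdjoinRoot.root g) g = 0 := by simp
  constructor
  · intro h
    rw [h, ← map_zero (algebraMap E (AdjoinRoot g)), aeval_algebraMap_apply] at hroot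
    simpa using hroot
  · intro h
    have hX : X ∣ g := by rwa [X_dvd_iff, coeff_zero_eq_eval_zero]
    have hgX : g ∣ X :=
      Irreducible.dvd_symm irreducible_X (Fact.out : Irreducible g) hX
    rw [← AdjoinRoot.mk_X, AdjoinRoot.mk_eq_zero]
    exact hgX

theorem Polynomial.IsSCIM.aeval_inv_root {conj : E →+* E} {g : E[X]} (hg : g.IsSCIM conj)
    [Fact (Irreducible g)] : aeval (AdjoinRoot.root g)⁻¹ (g.map conj) = 0 := by
  rw [AdjoinRoot.aeval_inv_root_map_eq_zero_iff conj
    (mt AdjoinRoot.root_eq_zero_iff.1 hg.eval_zero_ne_zero), AdjoinRoot.aeval_eq,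
    AdjoinRoot.mk_eq_zero]
  have hc : conj (g.eval 0) ≠ 0 := by simpa using hg.eval_zero_ne_zero
  rw [← dvd_C_mul (inv_ne_zero hc)]
  exact dvd_of_eq hg.2.2.symm

theorem Polynomial.isSCIM_of_aeval_inv_root {conj : E →+* E} {g : E[X]} (hm : g.Monic)
    [hg : Fact (Irreducible g)] (h0 : AdjoinRoot.root g ≠ 0)
    (h : aeval (AdjoinRoot.root g)⁻¹ (g.map conj) = 0) : g.IsSCIM conj := by
  refine ⟨hm, hg.out, ?_⟩
  rw [AdjoinRoot.aeval_inv_root_map_eq_zero_iff conj h0, AdjoinRoot.aeval_eq,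
    AdjoinRoot.mk_eq_zero] at h
  have hc : conj (g.eval 0) ≠ 0 := by
    simpa using mt AdjoinRoot.root_eq_zero_iff.2 h0
  have hcoeff : (g.map conj).coeff 0 = conj (g.eval 0) := by
    rw [coeff_map, coeff_zero_eq_eval_zero]
  have htr : (g.map conj).trailingCoeff = conj (g.eval 0) := by
    rw [trailingCoeff, natTrailingDegree_eq_zero.2 (Or.inr (by rwa [hcoeff])), hcoeff]
  have hmonic : (g.conjDual conj).Monic := by
    rw [Monic, conjDual, leadingCoeff_mul, leadingCoeff_C, reverse_leadingCoeff, htr,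
      inv_mul_cancel₀ hc]
  refine eq_of_monic_of_dvd_of_natDegree_le hm hmonic (h.mul_left _) ?_
  calc (g.conjDual conj).natDegree ≤ (g.map conj).reverse.natDegree := natDegree_C_mul_le _ _
    _ ≤ (g.map conj).natDegree := reverse_natDegree_le _
    _ ≤ g.natDegree := natDegree_map_le

/-- The minimal polynomial of a unitary matrix is SCIM as soon as it is irreducible. -/
theorem Matrix.IsUnitaryWrt.isSCIM_minpoly {n : ℕ} [NeZero n] {conj : E →+* E}
    {α : Matrix (Fin n) (Fin n) E} (hα : α.IsUnitaryWrt conj)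
    (hirr : Irreducible (minpoly E α)) : (minpoly E α).IsSCIM conj := by
  have := Fact.mk hirr
  have hrel := AdjoinRoot.aeval_eq_zero_of_aeval_root (minpoly.aeval E α)
  have h0 : AdjoinRoot.root (minpoly E α) ≠ 0 := by
    intro h
    have hα0 : α = 0 := by simpa using hrel X (by simpa using h)
    rw [IsUnitaryWrt, hα0, mul_zero] at hα
    exact zero_ne_one hα
  obtain ⟨r, hr, hr'⟩ := exists_aeval_eq_inv hrel (AdjoinRoot.exists_aeval_root_eq _) h0 hα
  refine isSCIM_of_aeval_inv_root (minpoly.monic (Matrix.isIntegral α)) h0 ?_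
  have h : aeval α (((minpoly E α).map conj).comp r) = 0 := by
    rw [aeval_comp, hr', ← Matrix.transpose_map_aeval, minpoly.aeval]
    simp
  rw [← hr, ← aeval_comp, AdjoinRoot.aeval_eq, AdjoinRoot.mk_eq_zero]
  exact minpoly.dvd E α h

theorem Matrix.IsUnitaryWrt.exists_isSCIM_dvd_comp {n M : ℕ} {conj : E →+* E}
    {α : Matrix (Fin n) (Fin n) E} (hα : α.IsUnitaryWrt conj)
    (hf : Irreducible (α ^ M).charpoly) :
    ∃ g : E[X], g.IsSCIM conj ∧ g ∣ (α ^ M).charpoly.comp (X ^ M) ∧ g.natDegree = n := by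
  have hn : (α ^ M).charpoly.natDegree = n := by simp
  have : NeZero n := ⟨by rw [← hn]; exact hf.natDegree_pos.ne'⟩
  have hm := minpoly.monic (Matrix.isIntegral α)
  have hdvd : minpoly E α ∣ (α ^ M).charpoly.comp (X ^ M) := by
    refine minpoly.dvd E α ?_
    rw [aeval_comp, map_pow, aeval_X, aeval_self_charpoly]
  obtain ⟨h, hhm, hhi, hh⟩ := exists_monic_irreducible_factor (minpoly E α)
    (minpoly.not_isUnit E α)
  have hle := hf.natDegree_le_of_dvd_comp hhi (hh.trans hdvd)
  have hle' : (minpoly E α).natDegree ≤ n := by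
    have := natDegree_le_of_dvd (Matrix.minpoly_dvd_charpoly α) α.charpoly_monic.ne_zero
    simpa using this
  have heq : minpoly E α = h :=
    eq_of_monic_of_dvd_of_natDegree_le hhm hm hh (by omega)
  refine ⟨_, hα.isSCIM_minpoly (heq ▸ hhi), hdvd, le_antisymm hle' ?_⟩
  rw [heq]
  omega

theorem Matrix.IsUnitaryWrt.exists_pow_eq {n M : ℕ} {conj : E →+* E}
    {A : Matrix (Fin n) (Fin n) E} (hA : A.IsUnitaryWrt conj) (hf : Irreducible A.charpoly)
    {g : E[X]} (hg : g.IsSCIM conj) (hdvd : g ∣ A.charpoly.comp (X ^ M)) (hdeg : g.natDegree = n) :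
    ∃ α : Matrix (Fin n) (Fin n) E, α.IsUnitaryWrt conj ∧ α ^ M = A := by
  have := Fact.mk hg.2.1
  have : FiniteDimensional E (AdjoinRoot g) := (AdjoinRoot.powerBasis hg.2.1.ne_zero).finite
  set β := AdjoinRoot.root g
  have hβ0 : β ≠ 0 := mt AdjoinRoot.root_eq_zero_iff.1 hg.eval_zero_ne_zero
  have hx : aeval (β ^ M) A.charpoly = 0 := aeval_root_pow_eq_zero_of_dvd hdvd
  have hrel (P : E[X]) (hP : aeval (β ^ M) P = 0) : aeval A P = 0 := by
    obtain ⟨Q, rfl⟩ := hf.dvd_of_aeval_eq_zero hx hP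
    rw [map_mul, aeval_self_charpoly, zero_mul]
  have hsurj := hf.exists_aeval_eq hx
    (by rw [AdjoinRoot.finrank_eq_natDegree hg.2.1.ne_zero, hdeg]; simp)
  obtain ⟨h, hh⟩ := hsurj β
  obtain ⟨r, hr, hr'⟩ := exists_aeval_eq_inv hrel hsurj (pow_ne_zero M hβ0) hA
  -- The conjugation of `AdjoinRoot g` sending the root to its inverse.
  have hlift : g.eval₂ ((AdjoinRoot.of g).comp conj) β⁻¹ = 0 := by
    rw [← eval₂_map]
    exact hg.aeval_inv_root
  let τ : AdjoinRoot g →+* AdjoinRoot g := AdjoinRoot.lift ((AdjoinRoot.of g).comp conj) β⁻¹ hlift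
  have hτβ : τ β = β⁻¹ := AdjoinRoot.lift_root hlift
  have hτ : aeval (β ^ M)⁻¹ (h.map conj) = β⁻¹ := by
    have hcomp : τ.comp (AdjoinRoot.of g) = (AdjoinRoot.of g).comp conj := by
      ext a
      exact AdjoinRoot.lift_of hlift
    rw [← hτβ]
    conv_rhs => rw [← hh]
    rw [aeval_def, aeval_def, hom_eval₂, map_pow, hτβ, inv_pow, eval₂_map,
      AdjoinRoot.algebraMap_eq, hcomp]
  refine ⟨aeval A h, ?_, ?_⟩
  · have := hrel ((h.map conj).comp r * h - 1) (by
      rw [map_sub, map_mul, aeval_comp, hr, hτ, hh, map_one, inv_mul_cancel₀ hβ0, sub_self])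
    rw [map_sub, map_mul, aeval_comp, hr', map_one, sub_eq_zero] at this
    rw [IsUnitaryWrt, Matrix.transpose_map_aeval, this]
  · have := hrel (h ^ M - X) (by simp [hh])
    simpa [sub_eq_zero] using this

/-- Let `q = p^k` be a prime power, `E` the field with `q²` elements, with
conjugation `x̄ = x^q` (the `k`-fold Frobenius). Let `M ≥ 1` and let `A ∈ U(n, q²)` have
characteristic polynomial `f` which is SCIM (of degree `n`). Then `α ^ M = A` has a solution
`α ∈ U(n, q²)` iff `f(t^M)` has a SCIM factor of degree `n`. -/
theorem power_root_in_U_iff (p k n M : ℕ) [Fact p.Prime] [Fintype E] [CharP E p]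
    (hk : 1 ≤ k) (hM : 1 ≤ M) (hE : Fintype.card E = (p ^ k) ^ 2)
    (A : Matrix (Fin n) (Fin n) E)
    (hA : A.IsUnitaryWrt (iterateFrobenius E p k))
    (hf : (Matrix.charpoly A).IsSCIM (iterateFrobenius E p k)) :
    (∃ α : Matrix (Fin n) (Fin n) E,
        α.IsUnitaryWrt (iterateFrobenius E p k) ∧ α ^ M = A) ↔
      ∃ g : E[X], g.IsSCIM (iterateFrobenius E p k) ∧
        g ∣ (Matrix.charpoly A).comp (X ^ M) ∧ g.natDegree = n := by
  constructor
  · rintro ⟨α, hα, rfl⟩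
    exact hα.exists_isSCIM_dvd_comp hf.2.1
  · rintro ⟨g, hg, hdvd, hdeg⟩
    exact hA.exists_pow_eq hf.2.1 hg hdvd hdeg
end

section
/- Let q be a prime power, M ≥ 1 an integer, and d > 1. Then the number N_M(q, d) of M-power polynomials of degree d over F_q equals (1/d) · Σ_{l | d} μ(l) · gcd(M(q^{d/l} − 1), q^d − 1) / gcd(M, q^d − 1), where μ is the Möbius function and the sum runs over positive divisors l of d. -/
open Polynomial

/-- The number of `M`-power polynomials of degree `d` over the finite field `F`:
monic irreducible polynomials `f` with `f(0) ≠ 0` such that `f(t^M)` has a monic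
irreducible factor of degree `deg f = d`. -/
noncomputable def numMPower (F : Type*) [Field F] [Fintype F] (M d : ℕ) : ℕ :=
  Set.ncard {f : F[X] | f.Monic ∧ Irreducible f ∧ f.eval 0 ≠ 0 ∧ f.natDegree = d ∧
    ∃ g : F[X], g.Monic ∧ Irreducible g ∧ g ∣ f.comp (X ^ M) ∧ g.natDegree = d}

theorem IsCyclic.card_powMonoidHom_ker_inf_range_mul_gcd {G : Type*} [CommGroup G] [IsCyclic G]
    [Finite G] (M k : ℕ) :
    Nat.card ((powMonoidHom k : G →* G).ker ⊓ (powMonoidHom M : G →* G).range : Subgroup G) *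
      Nat.gcd M (Nat.card G) = Nat.gcd (M * k) (Nat.card G) := by
  have hmap : (powMonoidHom (M * k) : G →* G).ker.map (powMonoidHom M : G →* G) =
      (powMonoidHom k : G →* G).ker ⊓ (powMonoidHom M : G →* G).range := by
    ext x
    simp only [Subgroup.mem_map, MonoidHom.mem_ker, powMonoidHom_apply, Subgroup.mem_inf,
      MonoidHom.mem_range]
    constructor
    · rintro ⟨v, hv, rfl⟩
      exact ⟨by rw [← pow_mul, hv], v, rfl⟩
    · rintro ⟨hx, v, rfl⟩
      exact ⟨v, by rw [pow_mul, hx], rfl⟩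
  have hle : (powMonoidHom M : G →* G).ker ≤ (powMonoidHom (M * k) : G →* G).ker := by
    intro x hx
    simp only [MonoidHom.mem_ker, powMonoidHom_apply] at hx ⊢
    rw [pow_mul, hx, one_pow]
  rw [← hmap, ← Subgroup.relIndex_ker, Nat.gcd_comm M, Nat.gcd_comm (M * k),
    ← IsCyclic.card_powMonoidHom_ker, ← IsCyclic.card_powMonoidHom_ker]
  rw [mul_comm, ← Subgroup.relIndex_bot_left, ← Subgroup.relIndex_bot_left]
  exact Subgroup.relIndex_mul_relIndex _ _ _ bot_le hle

section FiniteField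

variable {F K : Type*} [Field F] [Finite F] [Field K] [Finite K] [Algebra F K]

theorem FiniteField.natDegree_minpoly_dvd_iff (u : Kˣ) (n : ℕ) :
    (minpoly F (u : K)).natDegree ∣ n ↔ u ^ (Nat.card F ^ n - 1) = 1 := by
  have : Module.Finite F K := .of_finite
  have hintegral : IsIntegral F (u : K) := .of_finite F _
  have hpos : 0 < Nat.card F ^ n := pow_pos Nat.card_pos n
  rw [(minpoly.irreducible hintegral).natDegree_dvd_iff_dvd_X_pow_card_pow_sub_X, minpoly.dvd_iff,
    map_sub, map_pow, aeval_X, sub_eq_zero, Units.ext_iff, Units.val_pow_eq_pow_val, Units.val_one]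
  conv_lhs => rw [← Nat.sub_add_cancel hpos, pow_succ]
  exact mul_eq_right₀ u.ne_zero

theorem FiniteField.splits_map_of_natDegree_eq_finrank {f : F[X]} (hf : Irreducible f)
    (hd : f.natDegree = Module.finrank F K) : (f.map (algebraMap F K)).Splits := by
  have : Fintype K := .ofFinite K
  have : Module.Finite F K := .of_finite
  have hdvd := hf.natDegree_dvd_iff_dvd_X_pow_card_pow_sub_X.1 hd.dvd
  rw [← Module.natCard_eq_pow_finrank, Nat.card_eq_fintype_card] at hdvd
  refine Splits.of_dvd (FiniteField.isSplittingField_sub K F).splits ?_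
    (Polynomial.map_dvd (algebraMap F K) hdvd)
  exact map_ne_zero (FiniteField.X_pow_card_sub_X_ne_zero _ Fintype.one_lt_card)

/-- For an irreducible `f` whose degree is that of `K / F`, the polynomial `f(t ^ M)` has an
irreducible factor of the same degree exactly when a root of `f` in `K` is an `M`-th power. -/
theorem FiniteField.exists_dvd_minpoly_comp_X_pow_iff (M : ℕ) {a : K}
    (ha : (minpoly F a).natDegree = Module.finrank F K) :
    (∃ g : F[X], g.Monic ∧ Irreducible g ∧ g ∣ (minpoly F a).comp (X ^ M) ∧
      g.natDegree = Module.finrank F K) ↔ ∃ b : K, b ^ M = a := by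
  have : Module.Finite F K := .of_finite
  constructor
  · rintro ⟨g, -, hg, hdvd, hgd⟩
    obtain ⟨b, hb⟩ := (splits_map_of_natDegree_eq_finrank (K := K) hg hgd).exists_eval_eq_zero
      (by rw [degree_map]; exact (degree_pos_of_irreducible hg).ne')
    rw [eval_map_algebraMap] at hb
    have hbM : aeval (b ^ M) (minpoly F a) = 0 := by
      have := aeval_eq_zero_of_dvd_aeval_eq_zero hdvd hb
      rwa [aeval_comp, map_pow, aeval_X] at this
    have hconj : IsConjRoot F a (b ^ M) :=
      minpoly.eq_of_irreducible_of_monic (minpoly.irreducible (.of_finite F a)) hbM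
        (minpoly.monic (.of_finite F a))
    obtain ⟨σ, hσ⟩ := hconj.exists_algEquiv
    exact ⟨σ b, by rw [← map_pow, hσ]⟩
  · rintro ⟨b, rfl⟩
    refine ⟨minpoly F b, minpoly.monic (.of_finite F b), minpoly.irreducible (.of_finite F b),
      minpoly.dvd _ _ (by rw [aeval_comp, map_pow, aeval_X, minpoly.aeval]), ?_⟩
    refine le_antisymm (minpoly.natDegree_le b) ?_
    rw [← ha]
    have hle : IntermediateField.adjoin F {b ^ M} ≤ IntermediateField.adjoin F {b} :=
      IntermediateField.adjoin_simple_le_iff.2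
        (pow_mem (IntermediateField.mem_adjoin_simple_self F b) M)
    rw [← IntermediateField.adjoin.finrank (.of_finite F b),
      ← IntermediateField.adjoin.finrank (.of_finite F (b ^ M))]
    exact IntermediateField.finrank_le_of_le_right hle

end FiniteField

/-- The `M`-th powers in `Kˣ` of degree `c` over `F`. -/
noncomputable def powUnitsOfDegree (F K : Type*) [Field F] [Field K] [Finite K] [Algebra F K]
    (M c : ℕ) : Finset Kˣ :=
  have := Fintype.ofFinite Kˣ
  open Classical in
  {u | (∃ v : Kˣ, v ^ M = u) ∧ (minpoly F (u : K)).natDegree = c}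

section powUnitsOfDegree

variable {F K : Type*} [Field F] [Field K] [Finite K] [Algebra F K]

theorem mem_powUnitsOfDegree {M c : ℕ} {u : Kˣ} :
    u ∈ powUnitsOfDegree F K M c ↔
      (∃ v : Kˣ, v ^ M = u) ∧ (minpoly F (u : K)).natDegree = c := by
  simp [powUnitsOfDegree]

theorem sum_card_powUnitsOfDegree_mul_gcd [Finite F] (M : ℕ) {n : ℕ} (hn : n ≠ 0) :
    (∑ c ∈ n.divisors, (powUnitsOfDegree F K M c).card) * Nat.gcd M (Nat.card Kˣ) =
      Nat.gcd (M * (Nat.card F ^ n - 1)) (Nat.card Kˣ) := by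
  classical
  rw [← IsCyclic.card_powMonoidHom_ker_inf_range_mul_gcd, ← Finset.card_biUnion]
  · congr 1
    rw [← Nat.card_eq_finsetCard]
    refine Nat.card_congr (Equiv.subtypeEquivRight fun u ↦ ?_)
    simp only [Finset.mem_biUnion, Nat.mem_divisors, mem_powUnitsOfDegree, Subgroup.mem_inf,
      MonoidHom.mem_ker, MonoidHom.mem_range, powMonoidHom_apply,
      ← FiniteField.natDegree_minpoly_dvd_iff (F := F)]
    grind
  · intro c _ e _ hce
    rw [Function.onFun, Finset.disjoint_left]
    intro u hu hu'
    exact hce ((mem_powUnitsOfDegree.1 hu).2.symm.trans (mem_powUnitsOfDegree.1 hu').2)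

theorem card_powUnitsOfDegree_finrank {F : Type*} [Field F] [Fintype F] [Algebra F K] {M : ℕ}
    (hM : M ≠ 0) :
    (powUnitsOfDegree F K M (Module.finrank F K)).card =
      numMPower F M (Module.finrank F K) * Module.finrank F K := by
  classical
  have : Module.Finite F K := .of_finite
  set d := Module.finrank F K
  set S := powUnitsOfDegree F K M d
  have himage : {f : F[X] | f.Monic ∧ Irreducible f ∧ f.eval 0 ≠ 0 ∧ f.natDegree = d ∧
      ∃ g : F[X], g.Monic ∧ Irreducible g ∧ g ∣ f.comp (X ^ M) ∧ g.natDegree = d} =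
      ↑(S.image fun u : Kˣ ↦ minpoly F (u : K)) := by
    ext f
    simp only [Set.mem_ofPred_eq, Finset.coe_image, Set.mem_image, Finset.mem_coe, S,
      mem_powUnitsOfDegree]
    constructor
    · rintro ⟨hmonic, hf, hf0, hfd, hg⟩
      obtain ⟨a, ha⟩ := (FiniteField.splits_map_of_natDegree_eq_finrank (K := K) hf
        hfd).exists_eval_eq_zero (by rw [degree_map]; exact (degree_pos_of_irreducible hf).ne')
      rw [eval_map_algebraMap] at ha
      obtain rfl := minpoly.eq_of_irreducible_of_monic hf ha hmonic
      obtain ⟨b, rfl⟩ := (FiniteField.exists_dvd_minpoly_comp_X_pow_iff M hfd).1 hg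
      have hb : b ≠ 0 := by
        rintro rfl
        rw [zero_pow hM, minpoly.zero, eval_X] at hf0
        exact hf0 rfl
      exact ⟨Units.mk0 b hb ^ M, ⟨⟨_, rfl⟩, by simpa using hfd⟩, by simp⟩
    · rintro ⟨u, ⟨⟨v, rfl⟩, hu⟩, rfl⟩
      have hintegral : IsIntegral F ((v ^ M : Kˣ) : K) := .of_finite F _
      refine ⟨minpoly.monic hintegral, minpoly.irreducible hintegral, ?_, hu,
        (FiniteField.exists_dvd_minpoly_comp_X_pow_iff M hu).2 ⟨v, by simp⟩⟩
      rw [← coeff_zero_eq_eval_zero]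
      exact minpoly.coeff_zero_ne_zero hintegral (Units.ne_zero _)
  rw [numMPower, himage, Set.ncard_coe_finset, Finset.card_eq_sum_card_image
    (fun u : Kˣ ↦ minpoly F (u : K)) S]
  refine Finset.sum_const_nat fun f hf ↦ ?_
  have hf' := hf
  rw [← Finset.mem_coe, ← himage] at hf'
  obtain ⟨hmonic, hirr, hf0, hfd, hg⟩ := hf'
  have hroots : Fintype.card (f.rootSet K) = f.natDegree :=
    card_rootSet_eq_natDegree (PerfectField.separable_of_irreducible hirr)
      (FiniteField.splits_map_of_natDegree_eq_finrank hirr hfd)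
  rw [← hfd, ← hroots, ← Nat.card_eq_fintype_card, ← Nat.card_eq_finsetCard]
  have hmin {a : K} (ha : aeval a f = 0) : minpoly F a = f :=
    (minpoly.eq_of_irreducible_of_monic hirr ha hmonic).symm
  refine Nat.card_eq_of_bijective (fun u ↦ ⟨((u : Kˣ) : K), ?_⟩) ⟨?_, ?_⟩
  · rw [mem_rootSet]
    have hu := minpoly.aeval F ((u : Kˣ) : K)
    exact ⟨hirr.ne_zero, by rwa [(Finset.mem_filter.1 u.2).2] at hu⟩
  · intro u v huv
    exact Subtype.ext (Units.ext (congrArg Subtype.val huv))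
  · rintro ⟨a, ha⟩
    have hmina := hmin (mem_rootSet.1 ha).2
    obtain ⟨b, hb⟩ := (FiniteField.exists_dvd_minpoly_comp_X_pow_iff M
      (a := a) (by rw [hmina, hfd])).1 (by rw [hmina]; exact hg)
    have hb0 : b ≠ 0 := by
      rintro rfl
      rw [← hmina, ← hb, zero_pow hM, minpoly.zero, eval_X] at hf0
      exact hf0 rfl
    have hval : ((Units.mk0 b hb0 ^ M : Kˣ) : K) = a := by simpa using hb
    refine ⟨⟨Units.mk0 b hb0 ^ M, Finset.mem_filter.2 ⟨mem_powUnitsOfDegree.2 ⟨⟨_, rfl⟩, ?_⟩, ?_⟩⟩,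
      Subtype.ext hval⟩
    · rw [hval, hmina, hfd]
    · rw [hval, hmina]

end powUnitsOfDegree

/-- For `d > 1`,
`N_M(q,d) = (1/d) ∑_{l ∣ d} μ(l) (M(q^{d/l}-1), q^d-1) / (M, q^d-1)`. -/
theorem numMPower_eq {F : Type*} [Field F] [Fintype F] (M d : ℕ) (hM : 1 ≤ M) (hd : 1 < d) :
    (numMPower F M d : ℚ) =
      (1 / (d : ℚ)) * ∑ l ∈ d.divisors,
        ((ArithmeticFunction.moebius l : ℤ) : ℚ) *
          (Nat.gcd (M * (Fintype.card F ^ (d / l) - 1)) (Fintype.card F ^ d - 1) : ℚ) /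
          (Nat.gcd M (Fintype.card F ^ d - 1) : ℚ) := by
  obtain ⟨p, hp⟩ := CharP.exists F
  have : Fact p.Prime := ⟨CharP.char_is_prime F p⟩
  have : NeZero d := ⟨by omega⟩
  let K := FiniteField.Extension F p d
  have hfin : Module.finrank F K = d := FiniteField.finrank_extension F p d
  have hcard : Nat.card Kˣ = Fintype.card F ^ d - 1 := by
    rw [Nat.card_units, FiniteField.natCard_extension, Nat.card_eq_fintype_card]
  have hgcd : (Nat.gcd M (Fintype.card F ^ d - 1) : ℚ) ≠ 0 :=
    Nat.cast_ne_zero.2 (Nat.gcd_pos_of_pos_left _ hM).ne'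
  have hsum (n : ℕ) (hn : n > 0) :
      ∑ c ∈ n.divisors, ((powUnitsOfDegree F K M c).card : ℚ) =
        (Nat.gcd (M * (Fintype.card F ^ n - 1)) (Fintype.card F ^ d - 1) : ℚ) /
          (Nat.gcd M (Fintype.card F ^ d - 1) : ℚ) := by
    rw [eq_div_iff hgcd]
    have := sum_card_powUnitsOfDegree_mul_gcd (F := F) (K := K) M hn.ne'
    rw [hcard, Nat.card_eq_fintype_card] at this
    exact_mod_cast this
  have hinv := ArithmeticFunction.sum_eq_iff_sum_mul_moebius_eq.1 hsum d (by omega)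
  have hA := card_powUnitsOfDegree_finrank (F := F) (K := K) (M := M) (by omega)
  rw [hfin] at hA
  rw [Nat.sum_divisorsAntidiagonal fun l e ↦ ((ArithmeticFunction.moebius l : ℤ) : ℚ) *
    ((Nat.gcd (M * (Fintype.card F ^ e - 1)) (Fintype.card F ^ d - 1) : ℚ) /
      (Nat.gcd M (Fintype.card F ^ d - 1) : ℚ)), hA, Nat.cast_mul] at hinv
  simp_rw [mul_div_assoc]
  rw [hinv]
  field_simp
end

section
/- Let q be a power of a prime p, and let M ≥ 2 be an integer written as M = t·p^r with p ∤ t. For n ≥ 1 let a_n be the number of elements g ∈ GL(n, F_q) with g^M = 1. Then, as formal power series over ℚ, 1 + Σ_{n ≥ 1} (a_n/|GL(n, F_q)|) z^n = ∏_{d | t} ( 1 + Σ_{m ≥ 1} Σ_{λ ⊢ m, λ₁ ≤ p^r} z^{m·e(d)} / ( q^{e(d)·Σ_i (λ'_i)²} · ∏_{i ≥ 1} ∏_{j=1}^{m_i(λ)} (1 − q^{−e(d)·j}) ) )^{φ(d)/e(d)}, where the outer product runs over positive divisors d of t, e(d) is the multiplicative order of q modulo d, the inner sum runs over partitions λ of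 m with largest part λ₁ at most p^r, λ' denotes the conjugate partition of λ, m_i(λ) is the multiplicity of the part i in λ, and φ is Euler's totient function. -/
open Polynomial

namespace GLRoots
open Module

lemma card_eq_sum_fiber {α β : Type*} [Finite α] [Fintype β] (f : α → β) :
    Nat.card α = ∑ b, Nat.card {a // f a = b} := by
  rw [← Nat.card_sigma, Nat.card_congr (Equiv.sigmaFiberEquiv f)]

/-- The polynomial expression `∏_{l < i} (q ^ n - q ^ l)` counting the injective linear maps from
an `i`-dimensional to an `n`-dimensional space over a field with `q` elements. -/
def injCount (q : ℚ) (i n : ℕ) : ℚ := ∏ l ∈ Finset.range i, (q ^ n - q ^ l)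

lemma injCount_eq_zero (q : ℚ) {i n : ℕ} (h : n < i) : injCount q i n = 0 :=
  Finset.prod_eq_zero (Finset.mem_range.mpr h) (sub_self _)

lemma injCount_pos {q : ℚ} (hq : 1 < q) {i n : ℕ} (h : i ≤ n) : 0 < injCount q i n :=
  Finset.prod_pos fun _ hl => sub_pos.mpr
    (pow_lt_pow_right₀ hq ((Finset.mem_range.mp hl).trans_le h))

lemma injCount_add (q : ℚ) (i j n : ℕ) :
    injCount q (i + j) (i + n) = injCount q i (i + n) * (q ^ (i * j) * injCount q j n) := by
  unfold injCount
  rw [Finset.prod_range_add]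
  congr 1
  have h : q ^ (i * j) = ∏ _l ∈ Finset.range j, q ^ i := by simp [pow_mul]
  rw [h, ← Finset.prod_mul_distrib]
  exact Finset.prod_congr rfl fun l _ => by ring

section
variable {K V W : Type*} [Field K] [Fintype K] [AddCommGroup V] [Module K V]
  [AddCommGroup W] [Module K W] [Module.Finite K V] [Module.Finite K W]

lemma card_linearMap :
    (Nat.card (V →ₗ[K] W) : ℚ) = (Fintype.card K : ℚ) ^ (finrank K V * finrank K W) := by
  have : Finite (V →ₗ[K] W) := Module.finite_of_finite K
  have := Fintype.ofFinite (V →ₗ[K] W)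
  rw [Nat.card_eq_fintype_card, Module.card_eq_pow_finrank (K := K), finrank_linearMap]
  push_cast
  rfl

lemma card_injective :
    (Nat.card {f : V →ₗ[K] W // Function.Injective f} : ℚ) =
      injCount (Fintype.card K) (finrank K V) (finrank K W) := by
  have hW : Finite W := Module.finite_of_finite K
  have := Fintype.ofFinite W
  let b := finBasis K V
  have e : {s : Fin (finrank K V) → W // LinearIndependent K s} ≃
      {f : V →ₗ[K] W // Function.Injective f} :=
    (b.constr K).toEquiv.subtypeEquiv fun v => by
      have h : Finsupp.linearCombination K v = (b.constr K v) ∘ₗ b.repr.symm.toLinearMap := by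
        ext; simp
      rw [LinearIndependent, h]
      exact EquivLike.injective_comp b.repr.symm (b.constr K v)
  rw [← Nat.card_congr e]
  by_cases hk : finrank K V ≤ finrank K W
  · rw [card_linearIndependent hk, injCount, Nat.cast_prod, Finset.prod_range]
    refine Finset.prod_congr rfl fun i _ => ?_
    rw [Nat.cast_sub (Nat.pow_le_pow_right Fintype.card_pos (i.2.le.trans hk))]
    push_cast
    rfl
  · rw [injCount_eq_zero _ (not_le.mp hk)]
    have : IsEmpty {s : Fin (finrank K V) → W // LinearIndependent K s} :=
      ⟨fun s => hk (by simpa using s.2.fintype_card_le_finrank)⟩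
    simp

lemma card_linearEquiv (h : finrank K V = finrank K W) :
    (Nat.card (V ≃ₗ[K] W) : ℚ) =
      injCount (Fintype.card K) (finrank K V) (finrank K V) := by
  conv_rhs => arg 3; rw [h]
  rw [← card_injective]
  have e : (V ≃ₗ[K] W) ≃ {f : V →ₗ[K] W // Function.Injective f} :=
    Equiv.ofBijective (fun e => ⟨e.toLinearMap, e.injective⟩) ⟨fun e e' h => by
      ext x; exact LinearMap.congr_fun (congrArg Subtype.val h) x, fun f =>
      ⟨LinearEquiv.ofInjectiveOfFinrankEq f.1 f.2 h, by ext; rfl⟩⟩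
  rw [Nat.card_congr e]

lemma card_submodule (j : ℕ) :
    (Nat.card {U : Submodule K V // finrank K U = j} : ℚ) *
      injCount (Fintype.card K) j j = injCount (Fintype.card K) j (finrank K V) := by
  have hV : Finite V := Module.finite_of_finite K
  let ρ (f : {f : (Fin j → K) →ₗ[K] V // Function.Injective f}) :
      {U : Submodule K V // finrank K U = j} :=
    ⟨LinearMap.range f.1, by simp [LinearMap.finrank_range_of_inj f.2]⟩
  have e (U : {U : Submodule K V // finrank K U = j}) : ((Fin j → K) ≃ₗ[K] U.1) ≃
      {f // ρ f = U} :=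
    Equiv.ofBijective (fun e => ⟨⟨U.1.subtype ∘ₗ e.toLinearMap, by simpa using e.injective⟩,
      Subtype.ext (by simp [ρ, LinearMap.range_comp])⟩) ⟨fun e e' h => by
        ext x
        exact congrArg Subtype.val (Subtype.ext
          (LinearMap.congr_fun (congrArg (fun y => y.1.1) h) x)), fun ⟨f, hf⟩ =>
        ⟨(LinearEquiv.ofInjective f.1 f.2).trans
          (LinearEquiv.ofEq _ _ (congrArg Subtype.val hf)), by ext; rfl⟩⟩
  have h1 := card_injective (K := K) (V := Fin j → K) (W := V)
  have := Fintype.ofFinite {U : Submodule K V // finrank K U = j}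
  have : Finite {f : (Fin j → K) →ₗ[K] V // Function.Injective f} :=
    have : Finite ((Fin j → K) →ₗ[K] V) := DFunLike.finite _
    inferInstance
  rw [card_eq_sum_fiber ρ, finrank_fin_fun] at h1
  rw [← h1]
  push_cast
  rw [Finset.sum_congr rfl fun U _ => by
    rw [← Nat.card_congr (e U), card_linearEquiv (by simp [U.2]), finrank_fin_fun]]
  simp
end

lemma sum_comp_eq_sum_card_fiber {α : Type*} [Fintype α] (f : α → ℕ) (n : ℕ) (hf : ∀ a, f a < n)
    (g : ℕ → ℚ) :
    ∑ a, g (f a) = ∑ i ∈ Finset.range n, (Nat.card {a // f a = i} : ℚ) * g i := by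
  classical
  rw [← Finset.sum_fiberwise_of_maps_to (s := Finset.univ) (t := Finset.range n) (g := f)
    fun a _ => Finset.mem_range.mpr (hf a)]
  refine Finset.sum_congr rfl fun i _ => ?_
  rw [Finset.sum_congr rfl fun a ha => by rw [(Finset.mem_filter.mp ha).2], Finset.sum_const,
    nsmul_eq_mul, Nat.card_eq_fintype_card, Fintype.card_subtype]

section
variable {K A B V : Type*} [Field K] [AddCommGroup A] [Module K A]
  [AddCommGroup B] [Module K B] [AddCommGroup V] [Module K V]

lemma finite_end [Finite K] [Module.Finite K V] : Finite (Module.End K V) :=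
  have : Finite V := Module.finite_of_finite K
  DFunLike.finite _

lemma card_disjoint_ker [Fintype K] [Module.Finite K A] [Module.Finite K B]
    (S : Submodule K B) {c : ℕ} (hc : finrank K B = finrank K S + c) :
    (Nat.card {h : B →ₗ[K] A // Disjoint S (LinearMap.ker h)} : ℚ) =
      injCount (Fintype.card K) (finrank K S) (finrank K A) *
        (Fintype.card K : ℚ) ^ (finrank K A * c) := by
  obtain ⟨C, hC⟩ := S.exists_isCompl
  have hc' : finrank K C = c := by
    have := Submodule.finrank_add_eq_of_isCompl hC
    omega
  have e : {x : (S →ₗ[K] A) × (C →ₗ[K] A) // Function.Injective x.1} ≃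
      {h : B →ₗ[K] A // Disjoint S (LinearMap.ker h)} :=
    (LinearMap.ofIsComplProdEquiv hC).toEquiv.subtypeEquiv fun x => by
      rw [← LinearMap.ker_eq_bot, Submodule.disjoint_def, LinearMap.ker_eq_bot']
      constructor
      · intro h y hy hy'
        exact congrArg Subtype.val (h ⟨y, hy⟩ ((LinearMap.ofIsCompl_apply_left hC _).symm.trans hy'))
      · intro h y hy
        exact Subtype.ext (h y y.2 ((LinearMap.ofIsCompl_apply_left hC y).trans hy))
  rw [← Nat.card_congr e, Nat.card_congr
    (Equiv.prodSubtypeFstEquivSubtypeProd (p := fun f : S →ₗ[K] A => Function.Injective f)),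
    Nat.card_prod, Nat.cast_mul, card_injective, card_linearMap, hc', mul_comm c]

lemma pow_succ_prod_comp_snd (h : B →ₗ[K] A) (M : Module.End K B) (k : ℕ) :
    ((h.prod M ∘ₗ LinearMap.snd K A B : Module.End K (A × B)) ^ (k + 1)) =
      ((h ∘ₗ (M ^ k : Module.End K B)).prod (M ^ (k + 1))) ∘ₗ LinearMap.snd K A B := by
  induction k with
  | zero => ext <;> simp
  | succ k ih =>
    rw [pow_succ', ih]
    ext x <;> simp [pow_succ', LinearMap.comp_apply]

/-- An endomorphism of `A × B` with kernel `A` is given by its two components on `B`. -/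
lemma card_ker_eq_range_inl (k : ℕ) :
    Nat.card {N : Module.End K (A × B) // N ^ (k + 1) = 0 ∧
      LinearMap.ker N = LinearMap.range (LinearMap.inl K A B)} =
    Nat.card (Σ M : {M : Module.End K B // M ^ k = 0},
      {h : B →ₗ[K] A // Disjoint (LinearMap.ker M.1) (LinearMap.ker h)}) := by
  symm
  have key (h : B →ₗ[K] A) (M : Module.End K B)
      (hd : Disjoint (LinearMap.ker M) (LinearMap.ker h)) :
      (h.prod M ∘ₗ LinearMap.snd K A B : Module.End K (A × B)) ^ (k + 1) = 0 ↔ M ^ k = 0 := by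
    rw [pow_succ_prod_comp_snd]
    constructor
    · intro h0
      ext w
      have h1 := LinearMap.congr_fun h0 (0, w)
      simp only [LinearMap.comp_apply, LinearMap.snd_apply, LinearMap.prod_apply, Function.prod_apply,
        LinearMap.zero_apply, Prod.mk_eq_zero] at h1
      refine Submodule.disjoint_def.mp hd _ ?_ h1.1
      rw [LinearMap.mem_ker, ← Module.End.mul_apply, ← pow_succ']
      exact h1.2
    · intro h0
      rw [pow_succ, h0]
      ext <;> simp
  have keyker (h : B →ₗ[K] A) (M : Module.End K B) :
      Disjoint (LinearMap.ker M) (LinearMap.ker h) ↔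
      LinearMap.ker (h.prod M ∘ₗ LinearMap.snd K A B) =
        LinearMap.range (LinearMap.inl K A B) := by
    rw [LinearMap.ker_comp, LinearMap.ker_prod, LinearMap.range_inl]
    rw [disjoint_comm, disjoint_iff, LinearMap.ker.eq_1 (LinearMap.snd K A B)]
    refine ⟨fun h => by rw [h], fun h => ?_⟩
    exact Submodule.comap_injective_of_surjective LinearMap.snd_surjective h
  refine Nat.card_congr (Equiv.ofBijective (fun x => ⟨x.2.1.prod x.1.1 ∘ₗ LinearMap.snd K A B,
    (key _ _ x.2.2).mpr x.1.2, (keyker _ _).mp x.2.2⟩) ⟨?_, ?_⟩)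
  · rintro ⟨⟨M, hM⟩, ⟨h, hh⟩⟩ ⟨⟨M', hM'⟩, ⟨h', hh'⟩⟩ heq
    have h1 (w : B) := LinearMap.congr_fun (congrArg Subtype.val heq) (0, w)
    simp only [LinearMap.comp_apply, LinearMap.snd_apply, LinearMap.prod_apply, Function.prod_apply,
      Prod.mk.injEq] at h1
    obtain rfl : M = M' := LinearMap.ext fun w => (h1 w).2
    obtain rfl : h = h' := LinearMap.ext fun w => (h1 w).1
    rfl
  · rintro ⟨N, hN, hker⟩
    let M : Module.End K B := LinearMap.snd K A B ∘ₗ N ∘ₗ LinearMap.inr K A B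
    let h : B →ₗ[K] A := LinearMap.fst K A B ∘ₗ N ∘ₗ LinearMap.inr K A B
    have hNe : h.prod M ∘ₗ LinearMap.snd K A B = N := by
      ext x
      · have : N (x, 0) = 0 := LinearMap.mem_ker.mp (hker ▸ ⟨x, rfl⟩)
        simp [this]
      · have : N (x, 0) = 0 := LinearMap.mem_ker.mp (hker ▸ ⟨x, rfl⟩)
        simp [this]
      · simp [h]
      · simp [M]
    have hd := (keyker h M).mpr (hNe ▸ hker)
    exact ⟨⟨⟨M, (key h M hd).mp (hNe ▸ hN)⟩, ⟨h, hd⟩⟩, Subtype.ext hNe⟩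

end

section
variable {K A B V V' : Type*} [Field K] [AddCommGroup A] [Module K A]
  [AddCommGroup B] [Module K B] [AddCommGroup V] [Module K V] [AddCommGroup V'] [Module K V']

lemma ker_conjAlgEquiv (e : V ≃ₗ[K] V') (N : Module.End K V) :
    LinearMap.ker (e.conjAlgEquiv K N) = (LinearMap.ker N).map e.toLinearMap := by
  ext x
  simp [Submodule.mem_map_equiv]

lemma conjAlgEquiv_pow_eq_zero_iff (e : V ≃ₗ[K] V') (N : Module.End K V) (k : ℕ) :
    (e.conjAlgEquiv K N) ^ k = 0 ↔ N ^ k = 0 := by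
  rw [← map_pow, EmbeddingLike.map_eq_zero_iff]

/-- The number of endomorphisms of `K ^ n` with trivial `k`-th power and `j`-dimensional kernel. -/
noncomputable def nilCount (K : Type*) [Field K] (k n j : ℕ) : ℚ :=
  Nat.card {N : Module.End K (Fin n → K) // N ^ k = 0 ∧ finrank K (LinearMap.ker N) = j}

lemma card_pow_eq_zero [Module.Finite K V] (k j : ℕ) :
    (Nat.card {N : Module.End K V // N ^ k = 0 ∧ finrank K (LinearMap.ker N) = j} : ℚ) =
      nilCount K k (finrank K V) j := by
  let e : V ≃ₗ[K] (Fin (finrank K V) → K) := (finBasis K V).equivFun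
  unfold nilCount
  congr 1
  refine Nat.card_congr ((e.conjAlgEquiv K).toEquiv.subtypeEquiv fun N => ?_)
  refine and_congr (conjAlgEquiv_pow_eq_zero_iff e N k).symm ?_
  change _ ↔ finrank K (LinearMap.ker (e.conjAlgEquiv K N)) = j
  rw [ker_conjAlgEquiv, LinearEquiv.finrank_map_eq]

lemma card_pow_eq_zero_ker_inl [Fintype K] [Module.Finite K A] [Module.Finite K B] (k : ℕ) :
    (Nat.card {N : Module.End K (A × B) // N ^ (k + 1) = 0 ∧
      LinearMap.ker N = LinearMap.range (LinearMap.inl K A B)} : ℚ) =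
      ∑ i ∈ Finset.range (finrank K B + 1), nilCount K k (finrank K B) i *
        (injCount (Fintype.card K) i (finrank K A) *
          (Fintype.card K : ℚ) ^ (finrank K A * (finrank K B - i))) := by
  have := finite_end (K := K) (V := B)
  have : Finite (B →ₗ[K] A) := Module.finite_of_finite K
  have := Fintype.ofFinite {M : Module.End K B // M ^ k = 0}
  rw [card_ker_eq_range_inl, Nat.card_sigma]
  push_cast
  have h1 (M : Module.End K B) : finrank K B = finrank K (LinearMap.ker M) +
      (finrank K B - finrank K (LinearMap.ker M)) :=
    (Nat.add_sub_of_le (LinearMap.ker M).finrank_le).symm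
  have h2 := sum_comp_eq_sum_card_fiber (fun M : {M : Module.End K B // M ^ k = 0} =>
    finrank K (LinearMap.ker M.1)) (finrank K B + 1)
    (fun M => Nat.lt_succ_of_le (LinearMap.ker M.1).finrank_le)
    fun i => injCount (Fintype.card K) i (finrank K A) *
      (Fintype.card K : ℚ) ^ (finrank K A * (finrank K B - i))
  have h3 (M : {M : Module.End K B // M ^ k = 0}) :=
    card_disjoint_ker (A := A) (LinearMap.ker M.1) (h1 M.1)
  simp only [h3]
  rw [h2]
  refine Finset.sum_congr rfl fun i _ => ?_
  rw [← card_pow_eq_zero, Nat.card_congr (Equiv.subtypeSubtypeEquivSubtypeInter _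
    (fun M : Module.End K B => finrank K (LinearMap.ker M) = i))]

lemma card_pow_eq_zero_ker [Fintype K] [Module.Finite K V] (k : ℕ) (U : Submodule K V) {a j : ℕ}
    (hU : finrank K U = j) (hV : finrank K V = j + a) :
    (Nat.card {N : Module.End K V // N ^ (k + 1) = 0 ∧ LinearMap.ker N = U} : ℚ) =
      ∑ i ∈ Finset.range (a + 1), nilCount K k a i *
        (injCount (Fintype.card K) i j * (Fintype.card K : ℚ) ^ (j * (a - i))) := by
  obtain ⟨C, hC⟩ := U.exists_isCompl
  have hc : finrank K C = a := by
    have := Submodule.finrank_add_eq_of_isCompl hC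
    omega
  let e := Submodule.prodEquivOfIsCompl U C hC
  have h : (LinearMap.range (LinearMap.inl K U C)).map e.toLinearMap = U := by
    rw [← LinearMap.range_comp]
    have : e.toLinearMap ∘ₗ LinearMap.inl K U C = U.subtype := by ext; simp [e]
    rw [this, U.range_subtype]
  have hsub := card_pow_eq_zero_ker_inl (K := K) (A := U) (B := C) k
  rw [hU, hc] at hsub
  rw [← hsub]
  congr 1
  refine (Nat.card_congr ((e.conjAlgEquiv K).toEquiv.subtypeEquiv fun N => ?_)).symm
  refine and_congr (conjAlgEquiv_pow_eq_zero_iff e N (k + 1)).symm ?_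
  change _ ↔ LinearMap.ker (e.conjAlgEquiv K N) = U
  rw [ker_conjAlgEquiv]
  exact ⟨fun h1 => by rw [h1, h], fun h1 =>
    Submodule.map_injective_of_injective e.injective (h1.trans h.symm)⟩

lemma nilCount_succ [Fintype K] (k a j : ℕ) :
    nilCount K (k + 1) (j + a) j * injCount (Fintype.card K) j j =
      injCount (Fintype.card K) j (j + a) * ∑ i ∈ Finset.range (a + 1), nilCount K k a i *
        (injCount (Fintype.card K) i j * (Fintype.card K : ℚ) ^ (j * (a - i))) := by
  let V := Fin (j + a) → K
  have hV : finrank K V = j + a := finrank_fin_fun K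
  rw [← congrArg (injCount _ j) hV, ← card_submodule, mul_right_comm]
  congr 1
  have := finite_end (K := K) (V := V)
  let U := {U : Submodule K V // finrank K U = j}
  have := Fintype.ofFinite U
  rw [nilCount, card_eq_sum_fiber (β := U) fun N => ⟨LinearMap.ker N.1, N.2.2⟩]
  push_cast
  have h (S : U) : (Nat.card {N : {N : Module.End K V // N ^ (k + 1) = 0 ∧
      finrank K (LinearMap.ker N) = j} // (⟨LinearMap.ker N.1, N.2.2⟩ : U) = S} : ℚ) =
      ∑ i ∈ Finset.range (a + 1), nilCount K k a i *
        (injCount (Fintype.card K) i j * (Fintype.card K : ℚ) ^ (j * (a - i))) := by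
    rw [← card_pow_eq_zero_ker k S.1 S.2 hV]
    congr 1
    refine Nat.card_congr ⟨fun N => ⟨N.1.1, N.1.2.1, congrArg Subtype.val N.2⟩,
      fun N => ⟨⟨N.1, N.2.1, by rw [N.2.2, S.2]⟩, Subtype.ext N.2.2⟩, fun _ => rfl, fun _ => rfl⟩
  rw [Finset.sum_congr rfl fun S _ => h S, Finset.sum_const, Finset.card_univ, nsmul_eq_mul,
    Nat.card_eq_fintype_card]

lemma nilCount_of_lt {k n j : ℕ} (h : n < j) : nilCount K k n j = 0 := by
  have : IsEmpty {N : Module.End K (Fin n → K) //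
      N ^ k = 0 ∧ finrank K (LinearMap.ker N) = j} :=
    ⟨fun N => by
      have := (LinearMap.ker N.1).finrank_le
      rw [N.2.2, finrank_fin_fun] at this
      omega⟩
  simp [nilCount]

lemma nilCount_zero_zero_zero : nilCount K 0 0 0 = 1 := by
  have : Unique {N : Module.End K (Fin 0 → K) //
      N ^ 0 = 0 ∧ finrank K (LinearMap.ker N) = 0} :=
    { default := ⟨0, Subsingleton.elim _ _, finrank_zero_of_subsingleton⟩
      uniq := fun _ => Subsingleton.elim _ _ }
  rw [nilCount, Nat.card_unique, Nat.cast_one]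

lemma nilCount_zero_of_pos {n j : ℕ} (hn : n ≠ 0) : nilCount K 0 n j = 0 := by
  have : Nonempty (Fin n) := ⟨⟨0, by omega⟩⟩
  simp [nilCount]

/-- `nilCount` divided by the order of the general linear group. -/
noncomputable def nilMass (K : Type*) [Field K] [Fintype K] (k n j : ℕ) : ℚ :=
  nilCount K k n j / injCount (Fintype.card K) n n

/-- The contribution `q ^ (-j²) / ∏_{l ≤ j - i} (1 - q ^ (-l))` of two consecutive columns
`j ≥ i` of a partition to the inverse order of a centralizer. -/
noncomputable def columnWeight (q : ℚ) (j i : ℕ) : ℚ :=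
  1 / (q ^ (j ^ 2) * ∏ l ∈ Finset.Icc 1 (j - i), (1 - 1 / q ^ l))

lemma injCount_self_eq {q : ℚ} (hq : 1 < q) (d : ℕ) :
    injCount q d d = q ^ (d ^ 2) * ∏ l ∈ Finset.Icc 1 d, (1 - 1 / q ^ l) := by
  have h0 : q ≠ 0 := by positivity
  have h1 : Finset.Icc 1 d = Finset.Ico 1 (d + 1) := by ext; simp
  have h2 : q ^ (d ^ 2) = ∏ _l ∈ Finset.range d, q ^ d := by simp [← pow_mul, sq]
  rw [injCount, ← Finset.prod_range_reflect, h1, Finset.prod_Ico_eq_prod_range,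
    Nat.add_sub_cancel, h2, ← Finset.prod_mul_distrib]
  refine Finset.prod_congr rfl fun l hl => ?_
  obtain ⟨c, rfl⟩ := Nat.exists_eq_add_of_lt (Finset.mem_range.mp hl)
  rw [show l + c + 1 - 1 - l = c by omega]
  field_simp
  ring

lemma nilMass_succ [Fintype K] (k a j : ℕ) :
    nilMass K (k + 1) (j + a) j = ∑ i ∈ Finset.range (a + 1),
      if i ≤ j then nilMass K k a i * columnWeight (Fintype.card K) j i else 0 := by
  have hq : (1 : ℚ) < Fintype.card K := by exact_mod_cast Fintype.one_lt_card
  simp only [nilMass, eq_div_of_mul_eq (injCount_pos hq (le_refl j)).ne' (nilCount_succ k a j)]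
  generalize (Fintype.card K : ℚ) = q at *
  have h0 : q ≠ 0 := by positivity
  have h1 := (injCount_pos hq (le_refl j)).ne'
  have h2 := (injCount_pos hq (le_refl a)).ne'
  have h3 := (injCount_pos hq (Nat.le_add_right j a)).ne'
  rw [injCount_add, Finset.mul_sum, Finset.sum_div, Finset.sum_div]
  refine Finset.sum_congr rfl fun i hi => ?_
  split_ifs with hij
  · obtain ⟨d, rfl⟩ := Nat.exists_eq_add_of_le hij
    obtain ⟨b, rfl⟩ := Nat.exists_eq_add_of_le (Nat.lt_succ_iff.mp (Finset.mem_range.mp hi))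
    have h4 := (injCount_pos hq (Nat.le_add_right i d)).ne'
    have h5 := (injCount_pos hq (le_refl d)).ne'
    rw [columnWeight, Nat.add_sub_cancel_left, Nat.add_sub_cancel_left,
      injCount_add q i d d]
    have h6 : ∏ l ∈ Finset.Icc 1 d, (1 - 1 / q ^ l) = injCount q d d / q ^ (d ^ 2) := by
      rw [injCount_self_eq hq]; field_simp
    rw [h6]
    field_simp
    ring
  · rw [injCount_eq_zero q (not_le.mp hij)]
    simp

end

/-- The weight of a partition, given as a multiset of parts at most `k`: the inverse of the order
of the centralizer of a nilpotent matrix of this Jordan type over a field with `q` elements. -/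
noncomputable def partWeight (q : ℚ) (k : ℕ) (s : Multiset ℕ) : ℚ :=
  1 / (q ^ (∑ l ∈ Finset.range k, (Multiset.card (s.filter (fun x => l + 1 ≤ x))) ^ 2) *
    ∏ l ∈ Finset.range k, ∏ j ∈ Finset.Icc 1 (s.count (l + 1)), (1 - 1 / q ^ j))

/-- Add a first column to a partition, so that it has `d` more parts. -/
def addColumn (d : ℕ) (s : Multiset ℕ) : Multiset ℕ :=
  s.map Nat.succ + Multiset.replicate d 1

lemma card_addColumn (d : ℕ) (s : Multiset ℕ) :
    Multiset.card (addColumn d s) = Multiset.card s + d := by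
  simp [addColumn]

lemma sum_addColumn (d : ℕ) (s : Multiset ℕ) :
    (addColumn d s).sum = s.sum + Multiset.card s + d := by
  simp [addColumn, Nat.succ_eq_add_one, Multiset.sum_map_add]

lemma count_one_addColumn (d : ℕ) {s : Multiset ℕ} (hs : 0 ∉ s) :
    (addColumn d s).count 1 = d := by
  rw [addColumn, Multiset.count_add, Multiset.count_replicate_self,
    show (1 : ℕ) = Nat.succ 0 from rfl, Multiset.count_map_eq_count' _ _ Nat.succ_injective,
    Multiset.count_eq_zero_of_notMem hs, zero_add]

lemma count_succ_addColumn (d l : ℕ) (s : Multiset ℕ) :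
    (addColumn d s).count (l + 2) = s.count (l + 1) := by
  rw [addColumn, Multiset.count_add, Multiset.count_replicate, if_neg (by omega), add_zero]
  exact Multiset.count_map_eq_count' _ _ Nat.succ_injective _

lemma filter_addColumn (d l : ℕ) (s : Multiset ℕ) :
    (addColumn d s).filter (fun x => l + 2 ≤ x) =
      (s.filter (fun x => l + 1 ≤ x)).map Nat.succ := by
  rw [addColumn, Multiset.filter_add, Multiset.filter_map]
  have h : (Multiset.replicate d 1).filter (fun x => l + 2 ≤ x) = 0 :=
    Multiset.filter_eq_nil.mpr fun x hx => by
      rw [Multiset.eq_of_mem_replicate hx]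
      omega
  rw [h, add_zero]
  congr 1
  exact Multiset.filter_congr fun x _ => by simp

lemma addColumn_injective {s s' : Multiset ℕ} {d d' : ℕ} (hs : 0 ∉ s) (hs' : 0 ∉ s')
    (h : addColumn d s = addColumn d' s') : s = s' := by
  ext l
  cases l with
  | zero => rw [Multiset.count_eq_zero_of_notMem hs, Multiset.count_eq_zero_of_notMem hs']
  | succ l => rw [← count_succ_addColumn d, h, count_succ_addColumn]

lemma exists_eq_addColumn (s : Multiset ℕ) (hs : 0 ∉ s) :
    ∃ (d : ℕ) (t : Multiset ℕ), 0 ∉ t ∧ s = addColumn d t := by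
  refine ⟨s.count 1, (s.filter (fun x => 2 ≤ x)).map Nat.pred, ?_, ?_⟩
  · intro h
    obtain ⟨x, hx, hx0⟩ := Multiset.mem_map.mp h
    have := (Multiset.mem_filter.mp hx).2
    rw [Nat.pred_eq_sub_one] at hx0
    omega
  · rw [addColumn, Multiset.map_map, ← Multiset.filter_eq' s 1]
    have h1 : (s.filter (fun x => 2 ≤ x)).map (Nat.succ ∘ Nat.pred) =
        s.filter (fun x => 2 ≤ x) := by
      conv_rhs => rw [← Multiset.map_id (s.filter (fun x => 2 ≤ x))]
      refine Multiset.map_congr rfl fun x hx => ?_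
      have := (Multiset.mem_filter.mp hx).2
      simp only [Function.comp, Nat.pred_eq_sub_one, id]
      omega
    rw [h1]
    conv_lhs => rw [← Multiset.filter_add_not (fun x => 2 ≤ x) s]
    congr 1
    refine Multiset.filter_congr fun x hx => ?_
    have : x ≠ 0 := fun h => hs (h ▸ hx)
    omega

lemma partWeight_addColumn (q : ℚ) (k d : ℕ) {s : Multiset ℕ} (hs : 0 ∉ s) :
    partWeight q (k + 1) (addColumn d s) =
      partWeight q k s * columnWeight q (Multiset.card s + d) (Multiset.card s) := by
  unfold partWeight columnWeight
  rw [Finset.sum_range_succ', Finset.prod_range_succ']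
  have h0 : (addColumn d s).filter (fun x => 0 + 1 ≤ x) = addColumn d s := by
    refine Multiset.filter_eq_self.mpr fun x hx => ?_
    rcases Multiset.mem_add.mp hx with h | h
    · obtain ⟨y, -, rfl⟩ := Multiset.mem_map.mp h
      omega
    · rw [Multiset.eq_of_mem_replicate h]
  simp only [h0, filter_addColumn, Multiset.card_map, count_succ_addColumn, card_addColumn,
    count_one_addColumn d hs, Nat.add_sub_cancel_left, zero_add]
  rw [one_div_mul_one_div, pow_add]
  congr 1
  ring

/-- The partitions of `n` into `j` parts of size at most `k`. -/
def boundedPartitions (k n j : ℕ) : Finset (Nat.Partition n) :=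
  Finset.univ.filter fun lam => (∀ i ∈ lam.parts, i ≤ k) ∧ Multiset.card lam.parts = j

lemma mem_boundedPartitions {k n j : ℕ} {lam : Nat.Partition n} :
    lam ∈ boundedPartitions k n j ↔
      (∀ i ∈ lam.parts, i ≤ k) ∧ Multiset.card lam.parts = j := by
  simp [boundedPartitions]

lemma zero_notMem_parts {n : ℕ} (lam : Nat.Partition n) : 0 ∉ lam.parts :=
  fun h => (lam.parts_pos h).ne' rfl

lemma card_parts_le {n : ℕ} (lam : Nat.Partition n) : Multiset.card lam.parts ≤ n := by
  have h := Multiset.card_nsmul_le_sum (s := lam.parts) (a := 1) fun x hx => lam.parts_pos hx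
  rw [lam.parts_sum] at h
  simpa using h

lemma sum_boundedPartitions_succ (q : ℚ) (k a j : ℕ) :
    ∑ lam ∈ boundedPartitions (k + 1) (j + a) j, partWeight q (k + 1) lam.parts =
      ∑ i ∈ Finset.range (a + 1), if i ≤ j then
        (∑ mu ∈ boundedPartitions k a i, partWeight q k mu.parts) * columnWeight q j i else 0 := by
  rw [← Finset.sum_filter]
  simp only [Finset.sum_mul]
  rw [Finset.sum_sigma']
  symm
  have hle (x : Σ _ : ℕ, Nat.Partition a) (hx : x ∈ Finset.sigma
      (Finset.filter (fun i => i ≤ j) (Finset.range (a + 1))) fun i => boundedPartitions k a i) :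
      x.1 ≤ j ∧ Multiset.card x.2.parts = x.1 ∧ ∀ i ∈ x.2.parts, i ≤ k := by
    rw [Finset.mem_sigma, Finset.mem_filter, mem_boundedPartitions] at hx
    exact ⟨hx.1.2, hx.2.2, hx.2.1⟩
  refine Finset.sum_bij (fun x hx => ⟨addColumn (j - x.1) x.2.parts, ?_, ?_⟩) ?_ ?_ ?_ ?_
  · intro i hi
    rcases Multiset.mem_add.mp hi with h | h
    · obtain ⟨y, -, rfl⟩ := Multiset.mem_map.mp h
      omega
    · rw [Multiset.eq_of_mem_replicate h]
      omega
  · have := hle x hx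
    rw [sum_addColumn, x.2.parts_sum]
    omega
  · intro x hx
    have := hle x hx
    rw [mem_boundedPartitions, card_addColumn]
    refine ⟨fun i hi => ?_, by omega⟩
    rcases Multiset.mem_add.mp hi with h | h
    · obtain ⟨y, hy, rfl⟩ := Multiset.mem_map.mp h
      have := this.2.2 y hy
      omega
    · rw [Multiset.eq_of_mem_replicate h]
      omega
  · intro x hx y hy hxy
    have h := addColumn_injective (zero_notMem_parts x.2) (zero_notMem_parts y.2)
      (congrArg Nat.Partition.parts hxy)
    have h1 := (hle x hx).2.1
    have h2 := (hle y hy).2.1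
    obtain ⟨i, x⟩ := x
    obtain ⟨i', y⟩ := y
    obtain rfl : x = y := Nat.Partition.ext h
    obtain rfl : i = i' := h1.symm.trans h2
    rfl
  · intro lam hlam
    rw [mem_boundedPartitions] at hlam
    obtain ⟨d, t, ht, hlt⟩ := exists_eq_addColumn lam.parts (zero_notMem_parts lam)
    have hs := lam.parts_sum
    rw [hlt, sum_addColumn] at hs
    rw [hlt, card_addColumn] at hlam
    let mu : Nat.Partition a := ⟨t, fun {i} hi => Nat.pos_of_ne_zero fun h => ht (h ▸ hi), by omega⟩
    have hmu := card_parts_le mu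
    refine ⟨⟨Multiset.card t, mu⟩, ?_, ?_⟩
    · rw [Finset.mem_sigma, Finset.mem_filter, mem_boundedPartitions, Finset.mem_range]
      refine ⟨⟨Nat.lt_succ_of_le hmu, (Nat.le_add_right _ d).trans hlam.2.le⟩, fun i hi => ?_, rfl⟩
      have := hlam.1 (i + 1) (Multiset.mem_add.mpr (Or.inl (Multiset.mem_map_of_mem _ hi)))
      omega
    · refine Nat.Partition.ext ?_
      change addColumn (j - Multiset.card t) t = _
      rw [hlt, show j - Multiset.card t = d by omega]
  · intro x hx
    have := hle x hx
    change _ = partWeight q (k + 1) (addColumn (j - x.1) x.2.parts)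
    rw [partWeight_addColumn _ _ _ (zero_notMem_parts x.2), this.2.1, Nat.add_sub_of_le this.1]

lemma nilMass_eq_sum {K : Type*} [Field K] [Fintype K] (k n j : ℕ) :
    nilMass K k n j = ∑ lam ∈ boundedPartitions k n j,
      partWeight (Fintype.card K) k lam.parts := by
  induction k generalizing n j with
  | zero =>
    rcases Nat.eq_zero_or_pos n with rfl | hn
    · rcases Nat.eq_zero_or_pos j with rfl | hj
      · have : boundedPartitions 0 0 0 = {default} := by
          ext lam
          simp [mem_boundedPartitions, Subsingleton.elim lam default]
        simp [this, nilMass, nilCount_zero_zero_zero, injCount, partWeight]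
      · have : boundedPartitions 0 0 j = ∅ := by
          ext lam
          have := card_parts_le lam
          simp [mem_boundedPartitions]
          omega
        simp [this, nilMass, nilCount_of_lt hj]
    · have : boundedPartitions 0 n j = ∅ := by
        refine Finset.eq_empty_of_forall_notMem fun lam hlam => ?_
        rw [mem_boundedPartitions] at hlam
        have h := lam.parts_sum
        rw [Multiset.sum_eq_zero fun x hx => Nat.le_zero.mp (hlam.1 x hx)] at h
        omega
      rw [this, nilMass, nilCount_zero_of_pos hn.ne']
      simp
  | succ k ih =>
    rcases lt_or_ge n j with h | h
    · have : boundedPartitions (k + 1) n j = ∅ := by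
        refine Finset.eq_empty_of_forall_notMem fun lam hlam => ?_
        rw [mem_boundedPartitions] at hlam
        have := card_parts_le lam
        omega
      rw [this, nilMass, nilCount_of_lt h]
      simp
    · obtain ⟨a, rfl⟩ := Nat.exists_eq_add_of_le h
      rw [nilMass_succ, sum_boundedPartitions_succ]
      simp only [ih]

/-- The number of endomorphisms of an `n`-dimensional space with trivial `k`-th power, relative to
the order of the general linear group. -/
lemma card_pow_eq_zero_div {K : Type*} [Field K] [Fintype K] (k n : ℕ) :
    (Nat.card {N : Module.End K (Fin n → K) // N ^ k = 0} : ℚ) /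
      injCount (Fintype.card K) n n =
    ∑ lam ∈ Finset.univ.filter (fun lam : Nat.Partition n => ∀ i ∈ lam.parts, i ≤ k),
      partWeight (Fintype.card K) k lam.parts := by
  have := finite_end (K := K) (V := Fin n → K)
  have := Fintype.ofFinite {N : Module.End K (Fin n → K) // N ^ k = 0}
  have h := sum_comp_eq_sum_card_fiber (fun N : {N : Module.End K (Fin n → K) // N ^ k = 0} =>
    finrank K (LinearMap.ker N.1)) (n + 1) (fun N => by
      have := (LinearMap.ker N.1).finrank_le
      rw [finrank_fin_fun] at this
      omega) fun _ => 1
  simp only [Finset.sum_const, Finset.card_univ, nsmul_eq_mul, mul_one] at h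
  rw [Nat.card_eq_fintype_card, h, Finset.sum_div]
  rw [← Finset.sum_fiberwise_of_maps_to (t := Finset.range (n + 1))
    (g := fun lam : Nat.Partition n => Multiset.card lam.parts)
    fun lam _ => Finset.mem_range.mpr (Nat.lt_succ_of_le (card_parts_le lam))]
  refine Finset.sum_congr rfl fun j _ => ?_
  rw [Finset.filter_filter]
  refine Eq.trans ?_ (nilMass_eq_sum (K := K) k n j)
  rw [nilMass, nilCount, Nat.card_congr (Equiv.subtypeSubtypeEquivSubtypeInter _
    (fun M : Module.End K (Fin n → K) => finrank K (LinearMap.ker M) = j))]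

section
variable {F A B V : Type*} [Field F] [AddCommGroup A] [Module F A]
  [AddCommGroup B] [Module F B] [AddCommGroup V] [Module F V]

lemma comp_aeval_of_comp_eq {ι : A →ₗ[F] V} {M : Module.End F A} {N : Module.End F V}
    (h : ι ∘ₗ M = N ∘ₗ ι) (f : F[X]) : ι ∘ₗ aeval M f = aeval N f ∘ₗ ι := by
  induction f using Polynomial.induction_on' with
  | add p q hp hq => rw [map_add, map_add, LinearMap.comp_add, LinearMap.add_comp, hp, hq]
  | monomial n a =>
    have hn : ι ∘ₗ (M ^ n : Module.End F A) = (N ^ n : Module.End F V) ∘ₗ ι := by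
      induction n with
      | zero => ext; simp
      | succ n ih =>
        rw [pow_succ', pow_succ', Module.End.mul_eq_comp, Module.End.mul_eq_comp,
          ← LinearMap.comp_assoc, h, LinearMap.comp_assoc, ih, LinearMap.comp_assoc]
    ext x
    have := LinearMap.congr_fun hn x
    simp only [LinearMap.comp_apply] at this
    simp [aeval_monomial, this]

lemma isCompl_ker_aeval {f g : F[X]} (hfg : IsCoprime f g) {N : Module.End F V}
    (hN : aeval N (f * g) = 0) :
    IsCompl (LinearMap.ker (aeval N f)) (LinearMap.ker (aeval N g)) :=
  ⟨disjoint_ker_aeval_of_isCoprime N hfg, codisjoint_iff.mpr (by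
    rw [sup_ker_aeval_eq_ker_aeval_mul_of_coprime N hfg, hN, LinearMap.ker_zero])⟩

lemma exists_conj_ker_aeval {N : Module.End F V} {f : F[X]}
    (e : A ≃ₗ[F] LinearMap.ker (aeval N f)) :
    ∃ M : Module.End F A, aeval M f = 0 ∧
      ((LinearMap.ker (aeval N f)).subtype ∘ₗ e.toLinearMap) ∘ₗ M =
        N ∘ₗ ((LinearMap.ker (aeval N f)).subtype ∘ₗ e.toLinearMap) := by
  have hU : ∀ x ∈ LinearMap.ker (aeval N f), N x ∈ LinearMap.ker (aeval N f) := fun x hx => by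
    rw [LinearMap.mem_ker] at hx ⊢
    have h2 : aeval N f * N = N * aeval N f := by
      conv_lhs => arg 2; rw [← aeval_X (R := F) N]
      rw [← map_mul, mul_comm, map_mul, aeval_X]
    rw [← Module.End.mul_apply, h2, Module.End.mul_apply, hx, map_zero]
  have hc : ((LinearMap.ker (aeval N f)).subtype ∘ₗ e.toLinearMap) ∘ₗ
      (e.symm.toLinearMap ∘ₗ N.restrict hU ∘ₗ e.toLinearMap) =
      N ∘ₗ ((LinearMap.ker (aeval N f)).subtype ∘ₗ e.toLinearMap) := by
    ext x; simp
  refine ⟨e.symm.toLinearMap ∘ₗ N.restrict hU ∘ₗ e.toLinearMap, ?_, hc⟩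
  have h := comp_aeval_of_comp_eq hc f
  ext x
  have h1 := LinearMap.congr_fun h x
  have h2 : aeval N f (e x) = 0 := LinearMap.mem_ker.mp (e x).2
  simp only [LinearMap.comp_apply, LinearEquiv.coe_coe, Submodule.coe_subtype, h2,
    ZeroMemClass.coe_eq_zero, EmbeddingLike.map_eq_zero_iff] at h1
  simpa using h1

lemma card_aeval_mul_fiber [Fintype F] [Module.Finite F A] [Module.Finite F B] [Module.Finite F V]
    (hV : finrank F V = finrank F A + finrank F B)
    {f g : F[X]} (hfg : IsCoprime f g) :
    (Nat.card {N : Module.End F V // aeval N (f * g) = 0 ∧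
        finrank F (LinearMap.ker (aeval N f)) = finrank F A} : ℚ) *
      (injCount (Fintype.card F) (finrank F A) (finrank F A) *
        injCount (Fintype.card F) (finrank F B) (finrank F B)) =
    ((Nat.card {N : Module.End F A // aeval N f = 0} : ℚ) *
      (Nat.card {N : Module.End F B // aeval N g = 0} : ℚ)) *
      injCount (Fintype.card F) (finrank F V) (finrank F V) := by
  have hfV : Finite (Module.End F V) := finite_end
  have hfA : Finite (Module.End F A) := finite_end
  have hfB : Finite (Module.End F B) := finite_end
  have hf1 : Finite ((A × B) ≃ₗ[F] V) :=
    have : Finite (A × B →ₗ[F] V) := Module.finite_of_finite F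
    Finite.of_injective _ LinearEquiv.toLinearMap_injective
  let X := {N : Module.End F V // aeval N (f * g) = 0 ∧
        finrank F (LinearMap.ker (aeval N f)) = finrank F A}
  have hX (N : Module.End F V) (M : Module.End F A) (M' : Module.End F B) (hM : aeval M f = 0)
      (hM' : aeval M' g = 0) (e : (A × B) ≃ₗ[F] V)
      (he : (e.toLinearMap ∘ₗ LinearMap.inl F A B) ∘ₗ M =
        N ∘ₗ (e.toLinearMap ∘ₗ LinearMap.inl F A B))
      (he' : (e.toLinearMap ∘ₗ LinearMap.inr F A B) ∘ₗ M' =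
        N ∘ₗ (e.toLinearMap ∘ₗ LinearMap.inr F A B)) :
      (∀ x, e (x, 0) ∈ LinearMap.ker (aeval N f)) ∧ (∀ x, e (0, x) ∈ LinearMap.ker (aeval N g)) ∧
      aeval N (f * g) = 0 ∧ finrank F (LinearMap.ker (aeval N f)) = finrank F A := by
    have h1 (x) : e (x, 0) ∈ LinearMap.ker (aeval N f) := by
      have := LinearMap.congr_fun (comp_aeval_of_comp_eq he f) x
      simpa [hM] using this.symm
    have h2 (x) : e (0, x) ∈ LinearMap.ker (aeval N g) := by
      have := LinearMap.congr_fun (comp_aeval_of_comp_eq he' g) x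
      simpa [hM'] using this.symm
    have h3 : aeval N (f * g) = 0 := by
      ext v
      obtain ⟨⟨x, y⟩, rfl⟩ := e.surjective v
      have : e (x, y) = e (x, 0) + e (0, y) := by rw [← map_add]; simp
      rw [this, map_add]
      nth_rw 1 [mul_comm f g]
      rw [map_mul, map_mul, Module.End.mul_apply, Module.End.mul_apply,
        LinearMap.mem_ker.mp (h1 x), LinearMap.mem_ker.mp (h2 y)]
      simp
    refine ⟨h1, h2, h3, ?_⟩
    have h4 := Submodule.finrank_add_eq_of_isCompl (isCompl_ker_aeval hfg h3)
    have h5 : finrank F A ≤ finrank F (LinearMap.ker (aeval N f)) :=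
      LinearMap.finrank_le_finrank_of_injective
        (f := (e.toLinearMap ∘ₗ LinearMap.inl F A B).codRestrict _ h1) fun x y hxy => by
          have h : e (x, 0) = e (y, 0) := congrArg Subtype.val hxy
          simpa using h
    have h6 : finrank F B ≤ finrank F (LinearMap.ker (aeval N g)) :=
      LinearMap.finrank_le_finrank_of_injective
        (f := (e.toLinearMap ∘ₗ LinearMap.inr F A B).codRestrict _ h2) fun x y hxy => by
          have h : e (0, x) = e (0, y) := congrArg Subtype.val hxy
          simpa using h
    omega
  let Y := ({N : Module.End F A // aeval N f = 0} × {N : Module.End F B // aeval N g = 0}) ×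
    ((A × B) ≃ₗ[F] V)
  have hconj (y : Y) : (y.2.toLinearMap ∘ₗ LinearMap.inl F A B) ∘ₗ y.1.1.1 =
        (y.2.conj (y.1.1.1.prodMap y.1.2.1)) ∘ₗ (y.2.toLinearMap ∘ₗ LinearMap.inl F A B) ∧
      (y.2.toLinearMap ∘ₗ LinearMap.inr F A B) ∘ₗ y.1.2.1 =
        (y.2.conj (y.1.1.1.prodMap y.1.2.1)) ∘ₗ (y.2.toLinearMap ∘ₗ LinearMap.inr F A B) := by
    constructor <;> ext x <;> simp [LinearEquiv.conj_apply_apply]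
  let ρ (y : Y) : X := ⟨y.2.conj (y.1.1.1.prodMap y.1.2.1),
    (hX _ _ _ y.1.1.2 y.1.2.2 _ (hconj y).1 (hconj y).2).2.2⟩
  have hfX : Finite X := inferInstance
  have := Fintype.ofFinite X
  have hcard (N : X) : (Nat.card {y // ρ y = N} : ℚ) =
      injCount (Fintype.card F) (finrank F A) (finrank F A) *
        injCount (Fintype.card F) (finrank F B) (finrank F B) := by
    have hc := isCompl_ker_aeval hfg N.2.1
    have hW : finrank F B = finrank F (LinearMap.ker (aeval N.1 g)) := by
      have h4 := Submodule.finrank_add_eq_of_isCompl hc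
      have := N.2.2
      omega
    rw [← card_linearEquiv (W := LinearMap.ker (aeval N.1 f)) N.2.2.symm,
      ← card_linearEquiv (W := LinearMap.ker (aeval N.1 g)) hW, ← Nat.cast_mul, ← Nat.card_prod]
    congr 1
    symm
    choose φ hφ hφ' using fun e : A ≃ₗ[F] LinearMap.ker (aeval N.1 f) => exists_conj_ker_aeval e
    choose ψ hψ hψ' using fun e : B ≃ₗ[F] LinearMap.ker (aeval N.1 g) => exists_conj_ker_aeval e
    refine Nat.card_congr (Equiv.ofBijective (fun e => ⟨((⟨φ e.1, hφ e.1⟩, ⟨ψ e.2, hψ e.2⟩),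
      (e.1.prodCongr e.2).trans (Submodule.prodEquivOfIsCompl _ _ hc)), Subtype.ext ?_⟩) ⟨?_, ?_⟩)
    · refine LinearMap.ext fun v => ?_
      obtain ⟨⟨x, y⟩, rfl⟩ := ((e.1.prodCongr e.2).trans
        (Submodule.prodEquivOfIsCompl _ _ hc)).surjective v
      have h1 := LinearMap.congr_fun (hφ' e.1) x
      have h2 := LinearMap.congr_fun (hψ' e.2) y
      simp only [LinearMap.comp_apply, LinearEquiv.coe_coe, Submodule.coe_subtype] at h1 h2
      simp [ρ, LinearEquiv.conj_apply_apply, h1, h2]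
    · rintro ⟨e1, e2⟩ ⟨e1', e2'⟩ h
      have h1 := congrArg (fun y => y.1.2) h
      simp only at h1
      have hx (x : A) := LinearEquiv.congr_fun h1 (x, 0)
      have hy (y : B) := LinearEquiv.congr_fun h1 (0, y)
      simp at hx hy
      exact Prod.ext (LinearEquiv.ext hx) (LinearEquiv.ext hy)
    · rintro ⟨y, hy⟩
      obtain rfl := hy
      have h := hX _ _ _ y.1.1.2 y.1.2.2 _ (hconj y).1 (hconj y).2
      let e1 : A ≃ₗ[F] LinearMap.ker (aeval (ρ y).1 f) := LinearEquiv.ofInjectiveOfFinrankEq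
        ((y.2.toLinearMap ∘ₗ LinearMap.inl F A B).codRestrict _ h.1) (fun a b hab => by
          have h : y.2 (a, 0) = y.2 (b, 0) := congrArg Subtype.val hab
          simpa using h) (ρ y).2.2.symm
      let e2 : B ≃ₗ[F] LinearMap.ker (aeval (ρ y).1 g) := LinearEquiv.ofInjectiveOfFinrankEq
        ((y.2.toLinearMap ∘ₗ LinearMap.inr F A B).codRestrict _ h.2.1) (fun a b hab => by
          have h : y.2 (0, a) = y.2 (0, b) := congrArg Subtype.val hab
          simpa using h) hW
      have he1 (x : A) : (e1 x : V) = y.2 (x, 0) := rfl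
      have he2 (x : B) : (e2 x : V) = y.2 (0, x) := rfl
      refine ⟨(e1, e2), Subtype.ext (Prod.ext (Prod.ext (Subtype.ext ?_) (Subtype.ext ?_)) ?_)⟩
      · ext x
        have h1 := LinearMap.congr_fun (hφ' e1) x
        have h2 := LinearMap.congr_fun (hconj y).1 x
        have h3 := h1.trans h2.symm
        simp only [LinearMap.comp_apply, LinearEquiv.coe_coe, Submodule.coe_subtype, he1] at h3
        simpa using h3
      · ext x
        have h1 := LinearMap.congr_fun (hψ' e2) x
        have h2 := LinearMap.congr_fun (hconj y).2 x
        have h3 := h1.trans h2.symm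
        simp only [LinearMap.comp_apply, LinearEquiv.coe_coe, Submodule.coe_subtype, he2] at h3
        simpa using h3
      · ext ⟨x, z⟩
        simp [he1, he2, ← map_add]
  have hY : (Nat.card Y : ℚ) = ((Nat.card {N : Module.End F A // aeval N f = 0} : ℚ) *
      (Nat.card {N : Module.End F B // aeval N g = 0} : ℚ)) *
      injCount (Fintype.card F) (finrank F V) (finrank F V) := by
    rw [Nat.card_prod, Nat.card_prod, Nat.cast_mul, Nat.cast_mul,
      card_linearEquiv (by rw [finrank_prod, hV]), finrank_prod, hV]
  rw [← hY, card_eq_sum_fiber ρ, Nat.cast_sum]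
  simp only [hcard, Finset.sum_const, nsmul_eq_mul, Finset.card_univ, X, Nat.card_eq_fintype_card]
end

section
variable {F : Type*} [Field F] [Fintype F]

/-- The proportion of endomorphisms of `F ^ n` killed by `f`, relative to the order of `GL`. -/
noncomputable def rootMass (f : F[X]) (n : ℕ) : ℚ :=
  (Nat.card {N : Module.End F (Fin n → F) // aeval N f = 0} : ℚ) /
    injCount (Fintype.card F) n n

noncomputable def rootSeries (f : F[X]) : PowerSeries ℚ := PowerSeries.mk (rootMass f)

lemma injCount_card_pos (n : ℕ) : 0 < injCount (Fintype.card F) n n :=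
  injCount_pos (by exact_mod_cast Fintype.one_lt_card) le_rfl

lemma rootSeries_mul {f g : F[X]} (hfg : IsCoprime f g) :
    rootSeries (f * g) = rootSeries f * rootSeries g := by
  ext n
  rw [PowerSeries.coeff_mul, Finset.Nat.sum_antidiagonal_eq_sum_range_succ_mk]
  simp only [rootSeries, PowerSeries.coeff_mk]
  have hfV : Finite (Module.End F (Fin n → F)) := finite_end
  have := Fintype.ofFinite {N : Module.End F (Fin n → F) // aeval N (f * g) = 0}
  have h1 := sum_comp_eq_sum_card_fiber
    (fun N : {N : Module.End F (Fin n → F) // aeval N (f * g) = 0} =>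
      finrank F (LinearMap.ker (aeval N.1 f))) (n + 1)
    (fun N => Nat.lt_succ_of_le (by simpa using Submodule.finrank_le (LinearMap.ker (aeval N.1 f))))
    (fun _ => 1)
  simp only [Finset.sum_const, nsmul_eq_mul, mul_one, Finset.card_univ,
    ← Nat.card_eq_fintype_card] at h1
  rw [rootMass, h1, Finset.sum_div]
  refine Finset.sum_congr rfl fun i hi => ?_
  have hi' : i + (n - i) = n := by have := Finset.mem_range.mp hi; omega
  have h2 := card_aeval_mul_fiber (F := F) (A := Fin i → F) (B := Fin (n - i) → F)
    (V := Fin n → F) (by simp [hi']) hfg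
  simp only [finrank_fin_fun] at h2
  rw [Nat.card_congr (Equiv.subtypeSubtypeEquivSubtypeInter _
    (fun N : Module.End F (Fin n → F) => finrank F (LinearMap.ker (aeval N f)) = i))]
  have p1 := injCount_card_pos (F := F) i
  have p2 := injCount_card_pos (F := F) (n - i)
  have p3 := injCount_card_pos (F := F) n
  rw [rootMass, rootMass, div_mul_div_comm, div_eq_div_iff p3.ne' (mul_pos p1 p2).ne']
  exact h2

lemma rootMass_zero (f : F[X]) : rootMass f 0 = 1 := by
  have : Nat.card {N : Module.End F (Fin 0 → F) // aeval N f = 0} = 1 :=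
    Nat.card_eq_one_iff_unique.mpr ⟨⟨fun a b => Subtype.ext (Subsingleton.elim _ _)⟩,
      ⟨0, Subsingleton.elim _ _⟩⟩
  rw [rootMass, this]
  simp [injCount]

lemma rootSeries_one : rootSeries (1 : F[X]) = 1 := by
  ext n
  rw [rootSeries, PowerSeries.coeff_mk, PowerSeries.coeff_one]
  split_ifs with h
  · rw [h, rootMass_zero]
  · have : NeZero n := ⟨h⟩
    simp [rootMass]

lemma rootSeries_prod {ι : Type*} (s : Finset ι) (f : ι → F[X])
    (h : (s : Set ι).Pairwise fun i j => IsCoprime (f i) (f j)) :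
    rootSeries (∏ i ∈ s, f i) = ∏ i ∈ s, rootSeries (f i) := by
  classical
  induction s using Finset.induction_on with
  | empty => simpa using rootSeries_one
  | insert a s ha ih =>
    rw [Finset.prod_insert ha, Finset.prod_insert ha, rootSeries_mul, ih]
    · exact h.mono (by simp)
    · exact IsCoprime.prod_right fun i hi => h (by simp) (by simp [hi])
        (fun hai => ha (hai ▸ hi))
end

section
variable {F : Type*} [Field F]

lemma isUnit_aeval_derivative {S : Type*} [CommRing S] [Algebra F S] {f : F[X]} (hf : f.Separable)
    {a : S} (ha : IsNilpotent (aeval a f)) : IsUnit (aeval a (derivative f)) := by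
  obtain ⟨u, v, h⟩ := hf
  have h1 : aeval a v * aeval a (derivative f) = 1 - aeval a u * aeval a f := by
    rw [← map_mul, ← map_mul, ← map_one (aeval (R := F) a), ← map_sub, ← h]
    ring_nf
  have h2 : IsUnit (aeval a v * aeval a (derivative f)) := by
    rw [h1]
    exact (Commute.isNilpotent_mul_left (Commute.all _ _) ha).isUnit_one_sub
  exact isUnit_of_mul_isUnit_right h2

/-- A polynomial computing the semisimple part of every root of `f ^ k`. -/
lemma exists_semisimplePart {f : F[X]} (hf : f.Separable) (hi : Irreducible f) {k : ℕ}
    (hk : k ≠ 0) :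
    ∃ P : F[X], f ^ k ∣ f.comp P ∧ f ^ k ∣ (X - P) ^ k := by
  let π := Ideal.Quotient.mkₐ F (Ideal.span {f ^ k})
  have hπ (p : F[X]) : π p = 0 ↔ f ^ k ∣ p := by
    simp only [π, Ideal.Quotient.mkₐ_eq_mk]
    rw [Ideal.Quotient.eq_zero_iff_mem, Ideal.mem_span_singleton]
  have hae (p q : F[X]) : aeval (π q) p = π (p.comp q) := by
    rw [aeval_algHom_apply, ← comp_eq_aeval]
  have hnil : IsNilpotent (aeval (π X) f) := ⟨k, by
    rw [hae, comp_X, ← map_pow, hπ]⟩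
  obtain ⟨r, ⟨⟨j, hj⟩, hr⟩, -⟩ := existsUnique_nilpotent_sub_and_aeval_eq_zero hnil
    (isUnit_aeval_derivative hf hnil)
  obtain ⟨P, rfl⟩ := Ideal.Quotient.mkₐ_surjective F _ r
  change aeval (π P) f = 0 at hr
  change (π X - π P) ^ j = 0 at hj
  rw [hae, hπ] at hr
  rw [← map_sub, ← map_pow, hπ] at hj
  refine ⟨P, hr, pow_dvd_pow_of_dvd ?_ k⟩
  exact hi.prime.dvd_of_dvd_pow ((dvd_pow_self f hk).trans hj)

variable {K C : Type*} [Field K] [Algebra F K] [Ring C] [Algebra F C] [Algebra K C]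
  [IsScalarTower F K C]

lemma aeval_add_nilpotent {f P : F[X]} (hf : f.Separable) {k : ℕ}
    (hP : f ^ k ∣ f.comp P) (hP' : f ^ k ∣ (X - P) ^ k) {α : K} (hα : aeval α f = 0)
    {N : C} (hN : N ^ k = 0) :
    aeval (algebraMap K C α + N) (f ^ k) = 0 ∧
      aeval (algebraMap K C α + N) P = algebraMap K C α := by
  have h1 (p : F[X]) : aeval (algebraMap K C α + N) p =
      aeval N (aeval (Polynomial.C α + X : K[X]) p) := by
    have := aeval_algHom_apply ((aeval (R := K) N).restrictScalars F) (Polynomial.C α + X) p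
    simpa using this
  have h2 (p : K[X]) (hp : X ^ k ∣ p) : aeval N p = 0 := by
    obtain ⟨c, rfl⟩ := hp
    simp [hN]
  have h3 : (X : K[X]) ^ k ∣ aeval (Polynomial.C α + X : K[X]) (f ^ k) := by
    rw [map_pow]
    refine pow_dvd_pow_of_dvd ?_ k
    rw [X_dvd_iff, coeff_zero_eq_eval_zero, ← coe_evalRingHom]
    have := aeval_algHom_apply ((aeval (R := K) (0 : K)).restrictScalars F) (Polynomial.C α + X) f
    simp only [AlgHom.coe_restrictScalars', map_add, aeval_C, aeval_X, add_zero,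
      Algebra.algebraMap_self, RingHom.id_apply, hα] at this
    simpa [coe_aeval_eq_eval] using this.symm
  refine ⟨by rw [h1, h2 _ h3], ?_⟩
  suffices h4 : X ^ k ∣ aeval (Polynomial.C α + X : K[X]) P - Polynomial.C α by
    rw [h1, ← sub_eq_zero, ← aeval_C (R := K) N, ← map_sub]
    exact h2 _ h4
  let π := Ideal.Quotient.mkₐ F (Ideal.span {(X : K[X]) ^ k})
  have hπ (p : K[X]) : π p = 0 ↔ X ^ k ∣ p := by
    simp only [π, Ideal.Quotient.mkₐ_eq_mk]
    rw [Ideal.Quotient.eq_zero_iff_mem, Ideal.mem_span_singleton]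
  rw [← hπ, map_sub, sub_eq_zero, ← aeval_algHom_apply]
  set a := π (Polynomial.C α + X)
  have h5 : aeval a (f ^ k) = 0 := by rw [aeval_algHom_apply, hπ]; exact h3
  have h6 (p : F[X]) (hp : f ^ k ∣ p) : aeval a p = 0 := by
    obtain ⟨c, rfl⟩ := hp
    rw [map_mul, h5, zero_mul]
  have hnil : IsNilpotent (aeval a f) := ⟨k, by rw [← map_pow, h5]⟩
  refine (existsUnique_nilpotent_sub_and_aeval_eq_zero hnil
    (isUnit_aeval_derivative hf hnil)).unique ⟨⟨k, ?_⟩, ?_⟩ ⟨⟨k, ?_⟩, ?_⟩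
  · rw [← h6 _ hP']
    simp
  · rw [← h6 _ hP, comp_eq_aeval, ← aeval_algHom_apply]
  · rw [← map_sub, ← map_pow, hπ]
    simp
  · rw [aeval_algHom_apply, ← algebraMap_eq, aeval_algebraMap_apply, hα]
    simp
end

section
variable {F : Type*} [Field F] {f : F[X]} [Fact (Irreducible f)] {V W : Type*}
  [AddCommGroup V] [Module F V] [AddCommGroup W] [Module F W] [Module (AdjoinRoot f) W]
  [IsScalarTower F (AdjoinRoot f) W]

lemma map_mk_smul {s : Module.End F V} {Φ : W →ₗ[F] V}
    (h : ∀ w, Φ (AdjoinRoot.root f • w) = s (Φ w)) (p : F[X]) (w : W) :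
    Φ (AdjoinRoot.mk f p • w) = aeval s p (Φ w) := by
  have h1 := comp_aeval_of_comp_eq (ι := Φ) (M := Algebra.lsmul F F W (AdjoinRoot.root f)) (N := s)
    (LinearMap.ext h) p
  have h2 := LinearMap.congr_fun h1 w
  rw [aeval_algHom_apply, AdjoinRoot.aeval_eq] at h2
  simpa using h2

/-- The action of `AdjoinRoot f` on a space carrying an endomorphism killed by `f`. -/
noncomputable def adjoinRootHom {s : Module.End F V} (hs : aeval s f = 0) :
    AdjoinRoot f →+* Module.End F V :=
  Ideal.Quotient.lift (Ideal.span {f}) (aeval s : F[X] →ₐ[F] Module.End F V).toRingHom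
    fun a ha => by
      obtain ⟨c, rfl⟩ := Ideal.mem_span_singleton.mp ha
      simp [hs]

lemma card_intertwining [Fintype (AdjoinRoot f)] [Module.Finite F V] [Module.Finite F W]
    (hf : f.natDegree ≠ 0)
    {s : Module.End F V} (hs : aeval s f = 0) :
    f.natDegree ∣ finrank F V ∧ (finrank F W = finrank F V →
      (Nat.card {Φ : W ≃ₗ[F] V // ∀ w, Φ (AdjoinRoot.root f • w) = s (Φ w)} : ℚ) =
      injCount (Fintype.card (AdjoinRoot f)) (finrank (AdjoinRoot f) W)
        (finrank (AdjoinRoot f) W)) := by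
  let _ : Module (AdjoinRoot f) V := Module.compHom V (adjoinRootHom hs)
  have hsmul (p : F[X]) (v : V) : AdjoinRoot.mk f p • v = aeval s p v := rfl
  have : IsScalarTower F (AdjoinRoot f) V := IsScalarTower.of_algebraMap_smul fun c v => by
    have := hsmul (Polynomial.C c) v
    rw [AdjoinRoot.algebraMap_eq, ← AdjoinRoot.mk_C, this]
    simp
  have hd : finrank F (AdjoinRoot f) = f.natDegree := finrank_quotient_span_eq_natDegree
  have h1 := finrank_mul_finrank F (AdjoinRoot f) V
  have h2 := finrank_mul_finrank F (AdjoinRoot f) W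
  rw [hd] at h1 h2
  refine ⟨⟨_, h1.symm⟩, fun hWV => ?_⟩
  have : Module.Finite (AdjoinRoot f) V := Module.Finite.right F _ V
  have : Module.Finite (AdjoinRoot f) W := Module.Finite.right F _ W
  rw [← card_linearEquiv (W := V)
    (Nat.eq_of_mul_eq_mul_left (Nat.pos_of_ne_zero hf) (h2.trans (hWV.trans h1.symm)))]
  congr 1
  refine Nat.card_congr ⟨fun Φ => ⟨⟨⟨Φ.1, Φ.1.map_add⟩, fun c w => ?_⟩, Φ.1.symm, Φ.1.left_inv,
    Φ.1.right_inv⟩, fun Φ => ⟨Φ.restrictScalars F, fun w => ?_⟩, fun Φ => rfl, fun Φ => rfl⟩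
  · obtain ⟨p, rfl⟩ := AdjoinRoot.mk_surjective c
    exact map_mk_smul (Φ := Φ.1.toLinearMap) Φ.2 p w
  · have h3 := Φ.map_smul (AdjoinRoot.root f) w
    refine h3.trans ?_
    have h4 := hsmul X (Φ w)
    rw [aeval_X] at h4
    exact h4

variable (F) in
/-- Restriction of scalars for endomorphism algebras. -/
def endRestrictScalars (K W : Type*) [Field K] [Algebra F K] [AddCommGroup W] [Module F W]
    [Module K W] [IsScalarTower F K W] : Module.End K W →ₐ[F] Module.End F W where
  toFun := LinearMap.restrictScalars F
  map_one' := rfl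
  map_mul' _ _ := rfl
  map_zero' := rfl
  map_add' _ _ := rfl
  commutes' _ := rfl

lemma card_aeval_pow [Fintype F] [Fintype (AdjoinRoot f)] [Module.Finite F V] [Module.Finite F W]
    (hf : f.Separable) {k : ℕ} (hk : k ≠ 0) (hWV : finrank F W = finrank F V) :
    (Nat.card {N : Module.End F V // aeval N (f ^ k) = 0} : ℚ) *
        injCount (Fintype.card (AdjoinRoot f)) (finrank (AdjoinRoot f) W)
          (finrank (AdjoinRoot f) W) =
      injCount (Fintype.card F) (finrank F V) (finrank F V) *
        (Nat.card {N : Module.End (AdjoinRoot f) W // N ^ k = 0} : ℚ) := by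
  have hi : Irreducible f := Fact.out
  obtain ⟨P, hP, hP'⟩ := exists_semisimplePart hf hi hk
  have : Module.Finite (AdjoinRoot f) W := Module.Finite.right F _ W
  have hfV : Finite (Module.End F V) := finite_end
  have hfW : Finite (Module.End (AdjoinRoot f) W) := finite_end
  have hf1 : Finite (W ≃ₗ[F] V) :=
    have : Finite (W →ₗ[F] V) := Module.finite_of_finite F
    Finite.of_injective _ LinearEquiv.toLinearMap_injective
  let Y := (W ≃ₗ[F] V) × {N : Module.End (AdjoinRoot f) W // N ^ k = 0}
  let T (N : Module.End (AdjoinRoot f) W) : Module.End F W :=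
    endRestrictScalars F (AdjoinRoot f) W (algebraMap _ _ (AdjoinRoot.root f) + N)
  have hT {N : Module.End (AdjoinRoot f) W} (hN : N ^ k = 0) : aeval (T N) (f ^ k) = 0 ∧
      aeval (T N) P = Algebra.lsmul F F W (AdjoinRoot.root f) := by
    have h := aeval_add_nilpotent (C := Module.End (AdjoinRoot f) W) hf hP hP'
      (AdjoinRoot.aeval_eq f ▸ AdjoinRoot.mk_self : aeval (AdjoinRoot.root f) f = 0) hN
    simp only [T, aeval_algHom_apply, h.1, h.2, map_zero, true_and]
    rfl
  let ρ (y : Y) : {N : Module.End F V // aeval N (f ^ k) = 0} :=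
    ⟨y.1.conjAlgEquiv F (T y.2.1), by rw [aeval_algHom_apply, (hT y.2.2).1, map_zero]⟩
  have hcard (g : {N : Module.End F V // aeval N (f ^ k) = 0}) :
      (Nat.card {y // ρ y = g} : ℚ) =
        injCount (Fintype.card (AdjoinRoot f)) (finrank (AdjoinRoot f) W)
          (finrank (AdjoinRoot f) W) := by
    have h6 (p : F[X]) (hp : f ^ k ∣ p) : aeval g.1 p = 0 := by
      obtain ⟨c, rfl⟩ := hp
      rw [map_mul, g.2, zero_mul]
    have hs : aeval (aeval g.1 P) f = 0 := by
      rw [aeval_algHom_apply, ← comp_eq_aeval, h6 _ hP]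
    rw [← (card_intertwining hi.natDegree_pos.ne' hs).2 hWV]
    congr 1
    refine Nat.card_congr (Equiv.ofBijective (fun y => ⟨y.1.1, fun w => ?_⟩) ⟨?_, ?_⟩)
    · rw [← congrArg Subtype.val y.2]
      simp only [ρ]
      rw [aeval_algHom_apply, (hT y.1.2.2).2]
      simp
    · rintro ⟨⟨Φ, N, hN⟩, hy⟩ ⟨⟨Φ', N', hN'⟩, hy'⟩ h
      obtain rfl : Φ = Φ' := congrArg Subtype.val h
      have h1 := (Φ.conjAlgEquiv F).injective (congrArg Subtype.val (hy.trans hy'.symm))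
      obtain rfl : N = N' := by
        ext w
        have h2 : AdjoinRoot.root f • w + N w = AdjoinRoot.root f • w + N' w :=
          LinearMap.congr_fun h1 w
        exact add_left_cancel h2
      rfl
    · rintro ⟨Φ, hΦ⟩
      let N₀ : Module.End F W := Φ.symm.conjAlgEquiv F (g.1 - aeval g.1 P)
      have hN₀ (w : W) : Φ (N₀ w) = g.1 (Φ w) - Φ (AdjoinRoot.root f • w) := by
        simp [N₀, hΦ]
      have hcomm (w : W) : N₀ (AdjoinRoot.root f • w) = AdjoinRoot.root f • N₀ w := by
        have hc : Commute g.1 (aeval g.1 P) := by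
          have := (Commute.all X P).map (aeval (R := F) g.1)
          rwa [aeval_X] at this
        have hc' := LinearMap.congr_fun hc.eq (Φ w)
        simp only [Module.End.mul_apply] at hc'
        apply Φ.injective
        rw [hN₀, hΦ, hΦ, hΦ (N₀ w), hΦ, hN₀, hΦ, map_sub, hc']
      let N : Module.End (AdjoinRoot f) W :=
        { N₀ with
          map_smul' := fun c w => by
            obtain ⟨p, rfl⟩ := AdjoinRoot.mk_surjective c
            have h1 := map_mk_smul (Φ := N₀)
              (s := Algebra.lsmul F F W (AdjoinRoot.root f)) hcomm p w
            rw [aeval_algHom_apply, AdjoinRoot.aeval_eq] at h1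
            exact h1 }
      have hNN : endRestrictScalars F (AdjoinRoot f) W N = N₀ := rfl
      have hN : N ^ k = 0 := by
        have h1 : endRestrictScalars F (AdjoinRoot f) W (N ^ k) = 0 := by
          rw [map_pow, hNN]
          simp only [N₀]
          rw [← map_pow]
          have := h6 _ hP'
          rw [map_pow, map_sub, aeval_X] at this
          rw [this, map_zero]
        ext w
        exact LinearMap.congr_fun h1 w
      refine ⟨⟨(Φ, ⟨N, hN⟩), Subtype.ext ?_⟩, rfl⟩
      ext v
      obtain ⟨w, rfl⟩ := Φ.surjective v
      have h1 : T N w = AdjoinRoot.root f • w + N₀ w := rfl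
      simp [ρ, h1, hN₀]
  have := Fintype.ofFinite {N : Module.End F V // aeval N (f ^ k) = 0}
  have hY : (Nat.card Y : ℚ) = injCount (Fintype.card F) (finrank F V) (finrank F V) *
        (Nat.card {N : Module.End (AdjoinRoot f) W // N ^ k = 0} : ℚ) := by
    rw [Nat.card_prod, Nat.cast_mul, card_linearEquiv hWV, hWV]
  rw [← hY, card_eq_sum_fiber ρ, Nat.cast_sum]
  simp only [hcard, Finset.sum_const, nsmul_eq_mul, Finset.card_univ, Nat.card_eq_fintype_card]

lemma rootMass_pow [Fintype F] (hf : f.Separable) {k : ℕ} (hk : k ≠ 0) (n : ℕ) :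
    rootMass (f ^ k) n = if f.natDegree ∣ n then
      ∑ lam ∈ Finset.univ.filter
        (fun lam : Nat.Partition (n / f.natDegree) => ∀ i ∈ lam.parts, i ≤ k),
        partWeight ((Fintype.card F : ℚ) ^ f.natDegree) k lam.parts else 0 := by
  have hi : Irreducible f := Fact.out
  have : Module.Finite F (AdjoinRoot f) := (AdjoinRoot.powerBasis hi.ne_zero).finite
  have : Finite (AdjoinRoot f) := Module.finite_of_finite F
  have := Fintype.ofFinite (AdjoinRoot f)
  have hd : finrank F (AdjoinRoot f) = f.natDegree := finrank_quotient_span_eq_natDegree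
  have hc : (Fintype.card (AdjoinRoot f) : ℚ) = (Fintype.card F : ℚ) ^ f.natDegree := by
    rw [Module.card_eq_pow_finrank (K := F), hd]
    push_cast
    rfl
  split_ifs with h
  · obtain ⟨m, rfl⟩ := h
    rw [Nat.mul_div_cancel_left _ hi.natDegree_pos, ← hc, ← card_pow_eq_zero_div, rootMass]
    have hm : finrank F (Fin m → AdjoinRoot f) = f.natDegree * m := by
      rw [← finrank_mul_finrank F (AdjoinRoot f), hd, finrank_fin_fun]
    have h1 := card_aeval_pow (f := f) (V := Fin (f.natDegree * m) → F)
      (W := Fin m → AdjoinRoot f) hf hk (by rw [hm, finrank_fin_fun])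
    rw [finrank_fin_fun, finrank_fin_fun] at h1
    rw [div_eq_div_iff (injCount_card_pos _).ne' (injCount_card_pos _).ne', h1, mul_comm]
  · have : IsEmpty {N : Module.End F (Fin n → F) // aeval N (f ^ k) = 0} := ⟨fun g => h ?_⟩
    · rw [rootMass, Nat.card_of_isEmpty, Nat.cast_zero, zero_div]
    · obtain ⟨P, ⟨c, hc⟩, -⟩ := exists_semisimplePart hf hi hk
      have hs : aeval (aeval g.1 P) f = 0 := by
        have : aeval g.1 (f.comp P) = 0 := by rw [hc, map_mul, g.2, zero_mul]
        rw [aeval_algHom_apply, ← comp_eq_aeval, this]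
      simpa using (card_intertwining (W := AdjoinRoot f) hi.natDegree_pos.ne' hs).1
end

lemma sum_Icc_eq_of_parts_le {s : Multiset ℕ} {a b : ℕ} (hab : a ≤ b) (ha : ∀ i ∈ s, i ≤ a) :
    ∑ i ∈ Finset.Icc 1 a, (Multiset.card (s.filter (fun j => i ≤ j))) ^ 2 =
      ∑ i ∈ Finset.Icc 1 b, (Multiset.card (s.filter (fun j => i ≤ j))) ^ 2 := by
  refine Finset.sum_subset (Finset.Icc_subset_Icc_right hab) fun i hi hi' => ?_
  have h : s.filter (fun j => i ≤ j) = 0 := Multiset.filter_eq_nil.mpr fun j hj hij => by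
    have := ha j hj
    simp only [Finset.mem_Icc] at hi hi'
    omega
  simp [h]

lemma prod_Icc_eq_of_parts_le {s : Multiset ℕ} {a b : ℕ} (hab : a ≤ b) (ha : ∀ i ∈ s, i ≤ a)
    (g : ℕ → ℚ) :
    ∏ i ∈ Finset.Icc 1 a, ∏ j ∈ Finset.Icc 1 (s.count i), g j =
      ∏ i ∈ Finset.Icc 1 b, ∏ j ∈ Finset.Icc 1 (s.count i), g j := by
  refine Finset.prod_subset (Finset.Icc_subset_Icc_right hab) fun i hi hi' => ?_
  have h : s.count i = 0 := Multiset.count_eq_zero_of_notMem fun hj => by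
    have := ha i hj
    simp only [Finset.mem_Icc] at hi hi'
    omega
  simp [h]

lemma partWeight_pow_eq (q : ℚ) (e k : ℕ) {m : ℕ} (lam : Nat.Partition m)
    (h : ∀ i ∈ lam.parts, i ≤ k) :
    partWeight (q ^ e) k lam.parts = 1 / (q ^ (e * ∑ i ∈ Finset.Icc 1 m,
        (Multiset.card (lam.parts.filter (fun j => i ≤ j))) ^ 2) *
      ∏ i ∈ Finset.Icc 1 m, ∏ j ∈ Finset.Icc 1 (lam.parts.count i), (1 - 1 / q ^ (e * j))) := by
  have hm : ∀ i ∈ lam.parts, i ≤ m := fun i hi => by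
    simpa [lam.parts_sum] using Multiset.le_sum_of_mem hi
  have e1 : ∀ (f : ℕ → ℕ), ∑ l ∈ Finset.range k, f (l + 1) = ∑ i ∈ Finset.Icc 1 k, f i :=
    fun f => by
      rw [Finset.range_eq_Ico, Finset.sum_Ico_add' f 0 k 1]
      rfl
  have e2 : ∀ (f : ℕ → ℚ), ∏ l ∈ Finset.range k, f (l + 1) = ∏ i ∈ Finset.Icc 1 k, f i :=
    fun f => by
      rw [Finset.range_eq_Ico, Finset.prod_Ico_add' f 0 k 1]
      rfl
  simp only [partWeight, pow_mul]
  rw [e1 fun i => (Multiset.card (lam.parts.filter (fun j => i ≤ j))) ^ 2,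
    e2 fun i => ∏ j ∈ Finset.Icc 1 (lam.parts.count i), (1 - 1 / (q ^ e) ^ j),
    sum_Icc_eq_of_parts_le (Nat.le_add_right k m) h,
    sum_Icc_eq_of_parts_le (Nat.le_add_left m k) hm,
    prod_Icc_eq_of_parts_le (Nat.le_add_right k m) h,
    prod_Icc_eq_of_parts_le (Nat.le_add_left m k) hm]

lemma card_pow_eq_one {F : Type*} [Field F] {M : ℕ} (hM : M ≠ 0) (n : ℕ) :
    Nat.card {g : GL (Fin n) F // g ^ M = 1} =
      Nat.card {N : Module.End F (Fin n → F) // aeval N (X ^ M - 1 : F[X]) = 0} := by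
  let E := Matrix.toLinAlgEquiv' (R := F) (n := Fin n)
  have hE (A : Matrix (Fin n) (Fin n) F) : aeval (E A) (X ^ M - 1 : F[X]) = 0 ↔ A ^ M = 1 := by
    rw [map_sub, map_pow, map_one, aeval_X, sub_eq_zero, ← map_pow, ← map_one E,
      E.injective.eq_iff]
  refine Nat.card_congr (Equiv.ofBijective (fun g => ⟨E g.1.1, (hE _).mpr ?_⟩) ⟨?_, ?_⟩)
  · exact congrArg Units.val g.2
  · intro g g' h
    exact Subtype.ext (Units.ext (E.injective (congrArg Subtype.val h)))
  · rintro ⟨N, hN⟩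
    obtain ⟨A, rfl⟩ := E.surjective N
    exact ⟨⟨Units.ofPowEqOne A M ((hE A).mp hN) hM, Units.pow_ofPowEqOne _ _⟩, rfl⟩

section
variable {F : Type*} [Field F] [Fintype F]

lemma card_generalLinearGroup (n : ℕ) :
    (Nat.card (GL (Fin n) F) : ℚ) = injCount (Fintype.card F) n n := by
  classical
  rw [Matrix.card_GL_field, injCount, Nat.cast_prod, Finset.prod_range]
  refine Finset.prod_congr rfl fun i _ => ?_
  rw [Nat.cast_sub (Nat.pow_le_pow_right Fintype.card_pos i.2.le)]
  push_cast
  rfl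

lemma rootSeries_X_pow_sub_one {M : ℕ} (hM : M ≠ 0) :
    rootSeries (X ^ M - 1 : F[X]) = 1 + PowerSeries.mk (fun n =>
      if n = 0 then 0 else (Nat.card {g : GL (Fin n) F // g ^ M = 1} : ℚ) /
        (Nat.card (GL (Fin n) F) : ℚ)) := by
  ext n
  rw [map_add, PowerSeries.coeff_one, rootSeries, PowerSeries.coeff_mk, PowerSeries.coeff_mk]
  split_ifs with h
  · rw [h, rootMass_zero, add_zero]
  · rw [card_pow_eq_one hM, card_generalLinearGroup, zero_add, rootMass]

lemma rootSeries_cyclotomic_pow {p : ℕ} [Fact p.Prime] [CharP F p] {d k : ℕ} (hd : ¬ p ∣ d)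
    (hk : k ≠ 0) :
    rootSeries (cyclotomic d F ^ k) = (PowerSeries.mk (fun N =>
      if orderOf ((Fintype.card F : ℕ) : ZMod d) ∣ N then
        ∑ lam ∈ Finset.univ.filter
          (fun lam : Nat.Partition (N / orderOf ((Fintype.card F : ℕ) : ZMod d)) =>
            ∀ i ∈ lam.parts, i ≤ k),
          partWeight ((Fintype.card F : ℚ) ^ orderOf ((Fintype.card F : ℕ) : ZMod d)) k lam.parts
      else 0)) ^ (Nat.totient d / orderOf ((Fintype.card F : ℕ) : ZMod d)) := by
  classical
  have hp : p.Prime := Fact.out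
  obtain ⟨a, -, ha⟩ := FiniteField.card F p
  have hcop : p.Coprime d := (Nat.Prime.coprime_iff_not_dvd hp).mpr hd
  have hord : orderOf ((Fintype.card F : ℕ) : ZMod d) =
      orderOf (ZMod.unitOfCoprime _ (hcop.pow_left a)) := by
    rw [← orderOf_units, ZMod.coe_unitOfCoprime, ha]
  have : NeZero (d : F) := ⟨fun h => hd ((CharP.cast_eq_zero_iff F p d).mp h)⟩
  have h0 : cyclotomic d F ≠ 0 := cyclotomic_ne_zero d F
  have hsep : (cyclotomic d F).Separable := separable_cyclotomic d F
  set S := UniqueFactorizationMonoid.normalizedFactors (cyclotomic d F) with hS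
  have hnd : S.Nodup :=
    (UniqueFactorizationMonoid.squarefree_iff_nodup_normalizedFactors h0).mp hsep.squarefree
  have hprod : cyclotomic d F = ∏ P ∈ S.toFinset, P := by
    rw [Finset.prod_eq_multiset_prod, Multiset.toFinset_val, hnd.dedup, Multiset.map_id',
      UniqueFactorizationMonoid.prod_normalizedFactors_eq h0,
      (cyclotomic.monic d F).normalize_eq_self]
  have hpair : ((S.toFinset : Finset F[X]) : Set F[X]).Pairwise fun P Q =>
      IsCoprime (P ^ k) (Q ^ k) := fun P hP Q hQ hPQ => by
    refine IsCoprime.pow (Separable.isCoprime (hsep.of_dvd ?_))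
    rw [hprod, ← Finset.prod_pair (f := fun P : F[X] => P) hPQ]
    refine Finset.prod_dvd_prod_of_subset _ _ _ fun x hx => ?_
    rcases Finset.mem_insert.mp hx with rfl | hx
    · exact hP
    · rw [Finset.mem_singleton.mp hx]
      exact hQ
  rw [hord, ← normalizedFactors_cyclotomic_card ha hcop]
  conv_lhs => rw [hprod]
  rw [← Finset.prod_pow, rootSeries_prod _ _ hpair, ← hS]
  refine Finset.prod_eq_pow_card fun P hP => ?_
  have hP' : P ∈ S := Multiset.mem_toFinset.mp hP
  have : Fact (Irreducible P) :=
    ⟨UniqueFactorizationMonoid.irreducible_of_normalized_factor P hP'⟩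
  have hdeg := natDegree_of_mem_normalizedFactors_cyclotomic ha hcop hP'
  rw [← hdeg]
  ext n
  rw [rootSeries, PowerSeries.coeff_mk, PowerSeries.coeff_mk, rootMass_pow (hsep.of_dvd
    (UniqueFactorizationMonoid.dvd_of_mem_normalizedFactors hP')) hk]

lemma rootSeries_X_pow_sub_one_eq_prod {p : ℕ} [Fact p.Prime] [CharP F p] {t : ℕ} (r : ℕ)
    (ht : ¬ p ∣ t) :
    rootSeries (X ^ (t * p ^ r) - 1 : F[X]) =
      ∏ d ∈ t.divisors, rootSeries (cyclotomic d F ^ p ^ r) := by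
  have ht0 : 0 < t := Nat.pos_of_ne_zero fun h => ht (h ▸ dvd_zero p)
  have hsep : (X ^ t - 1 : F[X]).Separable :=
    X_pow_sub_one_separable_iff.mpr fun h => ht ((CharP.cast_eq_zero_iff F p t).mp h)
  have h : (X ^ (t * p ^ r) - 1 : F[X]) = (X ^ t - 1) ^ p ^ r := by
    have : CharP F[X] p := inferInstance
    rw [sub_pow_char_pow, one_pow, pow_mul]
  rw [h, ← prod_cyclotomic_eq_X_pow_sub_one ht0, ← Finset.prod_pow]
  refine rootSeries_prod _ _ fun d hd d' hd' hdd' => ?_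
  refine IsCoprime.pow (Separable.isCoprime (hsep.of_dvd ?_))
  rw [← prod_cyclotomic_eq_X_pow_sub_one ht0,
    ← Finset.prod_pair (f := fun i => cyclotomic i F) hdd']
  refine Finset.prod_dvd_prod_of_subset _ _ _ fun x hx => ?_
  rcases Finset.mem_insert.mp hx with rfl | hx
  · exact hd
  · rw [Finset.mem_singleton.mp hx]
    exact hd'
end

end GLRoots

/-- Let `F = F_q` be a finite field of characteristic `p`, and `M = t⬝p^r ≥ 2`
with `p ∤ t`. Let `aₙ` be the number of `M`-th roots of identity in `GL(n, F_q)`. Then, as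
formal power series over `ℚ`,
`1 + ∑_{n ≥ 1} (aₙ/|GL(n,q)|) zⁿ = ∏_{d ∣ t} (1 + ∑_{m ≥ 1} ∑_{λ ⊢ m, λ₁ ≤ p^r}
  z^{m⬝e(d)} / (q^{e(d)⬝∑ᵢ(λ'ᵢ)²} ∏ᵢ ∏_{j=1}^{mᵢ(λ)} (1 - q^{-e(d)j})))^{φ(d)/e(d)}`,
where `e(d)` is the multiplicative order of `q` mod `d`, `λ'` is the conjugate partition
and `mᵢ(λ)` the multiplicity of the part `i` in `λ`. -/
theorem GL_Mth_roots_of_identity_generating_function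
    {F : Type*} [Field F] [Fintype F] (p : ℕ) [Fact p.Prime] [CharP F p]
    (M t r : ℕ) (hM : 2 ≤ M) (ht : ¬ p ∣ t) (hMtr : M = t * p ^ r) :
    (1 : PowerSeries ℚ) + PowerSeries.mk (fun n =>
        if n = 0 then 0
        else (Nat.card {g : GL (Fin n) F // g ^ M = 1} : ℚ) /
          (Nat.card (GL (Fin n) F) : ℚ)) =
      ∏ d ∈ t.divisors,
        (PowerSeries.mk (fun N =>
          if N = 0 then (1 : ℚ)
          else if orderOf ((Fintype.card F : ℕ) : ZMod d) ∣ N then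
            letI e := orderOf ((Fintype.card F : ℕ) : ZMod d)
            letI m := N / e
            ∑ lam ∈ Finset.univ.filter
                (fun lam : Nat.Partition m => ∀ i ∈ lam.parts, i ≤ p ^ r),
              1 / ((Fintype.card F : ℚ) ^
                    (e * ∑ i ∈ Finset.Icc 1 m,
                      (Multiset.card (lam.parts.filter (fun j => i ≤ j))) ^ 2) *
                  ∏ i ∈ Finset.Icc 1 m, ∏ j ∈ Finset.Icc 1 (lam.parts.count i),
                    (1 - 1 / (Fintype.card F : ℚ) ^ (e * j)))
          else 0)) ^
        (Nat.totient d / orderOf ((Fintype.card F : ℕ) : ZMod d)) := by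
  have ht0 : t ≠ 0 := fun h => ht (h ▸ dvd_zero p)
  rw [← GLRoots.rootSeries_X_pow_sub_one (F := F) (by omega), hMtr,
    GLRoots.rootSeries_X_pow_sub_one_eq_prod r ht]
  refine Finset.prod_congr rfl fun d hd => ?_
  have hp : p.Prime := Fact.out
  rw [GLRoots.rootSeries_cyclotomic_pow
    (fun h => ht (h.trans (Nat.dvd_of_mem_divisors hd))) (pow_pos hp.pos r).ne']
  congr 1
  ext N
  rw [PowerSeries.coeff_mk, PowerSeries.coeff_mk]
  by_cases hN : N = 0
  · subst hN
    rw [if_pos (dvd_zero _), if_pos rfl, Nat.zero_div]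
    simp [GLRoots.partWeight]
  · rw [if_neg hN]
    refine if_congr Iff.rfl (Finset.sum_congr rfl fun lam hlam => ?_) rfl
    exact GLRoots.partWeight_pow_eq _ _ _ lam (Finset.mem_filter.mp hlam).2
end

section
/- For n ≥ 0 let f(n) denote the number of permutations in the symmetric group S_n that are squares (i.e., of the form τ² for some τ ∈ S_n), with f(0) = 1. Then for every real x with |x| < 1, Σ_{n=0}^∞ (f(n)/n!) x^n = ((1+x)/(1−x))^{1/2} · ∏_{k=1}^∞ cosh(x^{2k}/(2k)), where both the series and the infinite product converge. -/
/-- The number of permutations in `S_n` that are squares. -/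
noncomputable def numSquarePerms (n : ℕ) : ℕ :=
  Nat.card {σ : Equiv.Perm (Fin n) // ∃ τ : Equiv.Perm (Fin n), τ ^ 2 = σ}

/-- The cycle type of the square of a cycle of length `l`. -/
def sqCycleParts (l : ℕ) : Multiset ℕ :=
  if Odd l then {l} else if l = 2 then 0 else {l / 2, l / 2}

namespace Equiv.Perm

variable {α : Type*} [Fintype α] [DecidableEq α]

lemma IsCycle.eq_orderOf_of_mem_cycleType_pow {σ : Equiv.Perm α} (hσ : σ.IsCycle) {n m : ℕ}
    (hm : m ∈ (σ ^ n).cycleType) : m = orderOf (σ ^ n) := by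
  refine Nat.dvd_antisymm (dvd_of_mem_cycleType hm) (orderOf_dvd_of_pow_eq_one ?_)
  obtain ⟨c, τ, hcτ, hdisj, hc, rfl⟩ := mem_cycleType_iff.mp hm
  obtain ⟨x, hx, -⟩ := id hc
  have hτx : τ x = x := (hdisj x).resolve_left hx
  have hfix : (σ ^ n) ^ c.support.card = τ ^ c.support.card := by
    rw [hcτ, hdisj.commute.mul_pow, ← hc.orderOf, pow_orderOf_eq_one, one_mul]
  have hx' : ((σ ^ n) ^ c.support.card) x = x := by
    rw [hfix]
    exact pow_apply_eq_self_of_apply_eq_self hτx _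
  have hσx : σ x ≠ x := by
    intro h
    have h1 : (σ ^ n) x = x := pow_apply_eq_self_of_apply_eq_self h _
    rw [hcτ, mul_apply, hτx] at h1
    exact hx h1
  rw [← pow_mul] at hx' ⊢
  exact (hσ.pow_eq_one_iff' hσx).mpr hx'

lemma IsCycle.cycleType_sq {σ : Equiv.Perm α} (hσ : σ.IsCycle) :
    (σ ^ 2).cycleType = sqCycleParts σ.support.card := by
  have ho := hσ.orderOf
  have h2 := hσ.two_le_card_support
  unfold sqCycleParts
  split_ifs with hodd heq
  · have hcop : Nat.Coprime 2 (orderOf σ) := by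
      rw [ho]; exact (Nat.coprime_two_left).mpr hodd
    rw [(hσ.pow_iff.mpr hcop).cycleType, support_pow_coprime hcop]
  · rw [cycleType_eq_zero, ← heq, ← ho, pow_orderOf_eq_one]
  · obtain ⟨k, hk⟩ := even_iff_two_dvd.mp (Nat.not_odd_iff_even.mp hodd)
    have hok : orderOf (σ ^ 2) = k := by
      rw [orderOf_pow, ho, hk, Nat.gcd_eq_right (Dvd.intro _ rfl)]
      omega
    have hrep := Multiset.eq_replicate_of_mem fun b hb ↦
      (hσ.eq_orderOf_of_mem_cycleType_pow (n := 2) hb).trans hok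
    have hsum := sum_cycleType (σ ^ 2)
    have hndvd : ¬ orderOf σ ∣ 2 := fun h ↦
      heq (le_antisymm (Nat.le_of_dvd two_pos (ho ▸ h)) h2)
    rw [hσ.support_pow_eq_iff.mpr hndvd, hrep, Multiset.sum_replicate, hk,
      smul_eq_mul] at hsum
    have hcard := Nat.eq_of_mul_eq_mul_right (by omega) hsum
    rw [hrep, hcard, hk, Nat.mul_div_cancel_left _ two_pos]
    rfl

lemma cycleType_sq (σ : Equiv.Perm α) : (σ ^ 2).cycleType = σ.cycleType.bind sqCycleParts := by
  induction σ using cycle_induction_on with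
  | base_one => simp
  | base_cycles σ hσ => simp [hσ.cycleType_sq, hσ.cycleType]
  | induction_disjoint σ τ hd _ hσ hτ =>
    rw [hd.commute.mul_pow, (hd.pow_disjoint_pow 2 2).cycleType_mul, hd.cycleType_mul, hσ, hτ,
      Multiset.add_bind]

lemma even_count_sqCycleParts {i : ℕ} (hi : Even i) (l : ℕ) :
    Even ((sqCycleParts l).count i) := by
  unfold sqCycleParts
  split_ifs with hodd
  · rw [Multiset.count_eq_zero_of_notMem]
    · simp
    · rw [Multiset.mem_singleton]
      rintro rfl
      exact Nat.not_even_iff_odd.mpr hodd hi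
  · simp
  · simp only [Multiset.insert_eq_cons, Multiset.count_cons, Multiset.count_singleton]
    split_ifs <;> decide

lemma exists_sq_eq_iff (σ : Equiv.Perm α) :
    (∃ τ : Equiv.Perm α, τ ^ 2 = σ) ↔ ∀ i, Even i → Even (σ.cycleType.count i) := by
  constructor
  · rintro ⟨τ, rfl⟩ i hi
    rw [cycleType_sq, Multiset.count_bind]
    refine Multiset.sum_induction Even _ (fun _ _ ↦ Even.add) (by simp) fun a ha ↦ ?_
    obtain ⟨l, -, rfl⟩ := Multiset.mem_map.mp ha
    exact even_count_sqCycleParts hi l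
  · intro h
    set m := σ.cycleType with hm
    obtain ⟨e, he⟩ : ∃ e : Multiset ℕ, m.filter (fun i ↦ ¬ Odd i) = e + e := by
      refine ⟨Finsupp.toMultiset ((m.filter (fun i ↦ ¬ Odd i)).toFinsupp.mapRange (· / 2) rfl), ?_⟩
      ext i
      rw [Multiset.count_add, Finsupp.count_toMultiset, Finsupp.mapRange_apply,
        Multiset.toFinsupp_apply, Multiset.count_filter]
      split_ifs with hi
      · rfl
      · have := even_iff_two_dvd.mp (h i (Nat.not_odd_iff_even.mp hi))
        omega
    have hsplit : m = m.filter Odd + (e + e) := by rw [← he, Multiset.filter_add_not]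
    have he2 : ∀ i ∈ e, 2 ≤ i := fun i hi ↦
      two_le_of_mem_cycleType (σ := σ) (by rw [← hm, hsplit]; simp [hi])
    obtain ⟨τ, hτ⟩ := (exists_with_cycleType_iff α (m := m.filter Odd + e.map (2 * ·))).mpr <| by
      constructor
      · have : m.sum = (m.filter Odd + e.map (2 * ·)).sum := by
          conv_lhs => rw [hsplit]
          rw [Multiset.sum_add, Multiset.sum_add, Multiset.sum_add, Multiset.sum_map_mul_left,
            Multiset.map_id', two_mul]
        rw [← this]
        exact sum_cycleType_le σ
      · intro a ha
        rcases Multiset.mem_add.mp ha with ha | ha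
        · exact two_le_of_mem_cycleType (Multiset.mem_of_mem_filter ha)
        · obtain ⟨b, hb, rfl⟩ := Multiset.mem_map.mp ha
          have := he2 b hb
          omega
    have hτσ : (τ ^ 2).cycleType = σ.cycleType := by
      rw [cycleType_sq, hτ, ← hm, Multiset.add_bind, Multiset.bind_map]
      conv_rhs => rw [hsplit]
      congr 1
      · rw [Multiset.bind_congr (g := fun a ↦ {a}) (fun a ha ↦ by
          simp [sqCycleParts, (Multiset.mem_filter.mp ha).2]), Multiset.bind_singleton,
          Multiset.map_id']
      · rw [Multiset.bind_congr (g := fun a ↦ {a} + {a}) (fun a ha ↦ by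
          have := he2 a ha
          rw [sqCycleParts, if_neg (by simp), if_neg (by omega),
            Nat.mul_div_cancel_left _ two_pos]
          rfl), Multiset.bind_add, Multiset.bind_singleton, Multiset.map_id']
    obtain ⟨c, hc⟩ := isConj_iff.mp (isConj_iff_cycleType_eq.mpr hτσ)
    exact ⟨c * τ * c⁻¹, by rw [conj_pow, hc]⟩

lemma card_filter_partition_mul_eq (p : (Fintype.card α).Partition) :
    (Finset.univ.filter fun σ : Equiv.Perm α ↦ σ.partition = p).card *
      ∏ i ∈ p.parts.toFinset, (i ^ p.parts.count i * (p.parts.count i).factorial) =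
      (Fintype.card α).factorial := by
  set m := p.parts.filter (2 ≤ ·) with hm
  have hsplit : p.parts = m + Multiset.replicate (p.parts.count 1) 1 := by
    conv_lhs => rw [← Multiset.filter_add_not (2 ≤ ·) p.parts]
    rw [← Multiset.filter_eq']
    congr 1
    refine Multiset.filter_congr fun x hx ↦ ?_
    have := p.parts_pos hx
    omega
  have hsum : Fintype.card α = m.sum + p.parts.count 1 := by
    conv_lhs => rw [← p.parts_sum, hsplit]
    simp
  have hfilter : (Finset.univ.filter fun σ : Equiv.Perm α ↦ σ.partition = p) =
      Finset.univ.filter fun σ : Equiv.Perm α ↦ σ.cycleType = m := by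
    ext σ
    simp only [Finset.mem_filter, Finset.mem_univ, true_and]
    constructor
    · rintro rfl
      exact filter_parts_partition_eq_cycleType.symm
    · intro h
      rw [Nat.Partition.ext_iff, parts_partition, ← sum_cycleType, h, hsplit]
      congr 2
      omega
  have hcard := card_of_cycleType_mul_eq α m
  rw [if_pos ⟨by omega, fun a ha ↦ (Multiset.mem_filter.mp ha).2⟩] at hcard
  rw [hfilter, ← hcard, Finset.prod_mul_distrib, ← Finset.prod_multiset_count]
  have hprod : p.parts.prod = m.prod := by
    conv_lhs => rw [hsplit]
    simp
  have hfact : ∏ i ∈ p.parts.toFinset, (p.parts.count i).factorial =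
      (p.parts.count 1).factorial * ∏ i ∈ m.toFinset, (m.count i).factorial := by
    have h1 : 1 ∉ m.toFinset := by simp [hm]
    have hsub : p.parts.toFinset ⊆ insert 1 m.toFinset := by
      intro i hi
      have := p.parts_pos (Multiset.mem_toFinset.mp hi)
      simp only [Finset.mem_insert, Multiset.mem_toFinset, hm, Multiset.mem_filter] at hi ⊢
      exact or_iff_not_imp_left.mpr fun h ↦ ⟨hi, by omega⟩
    rw [Finset.prod_subset hsub, Finset.prod_insert h1]
    · congr 1
      refine Finset.prod_congr rfl fun i hi ↦ ?_
      rw [hm, Multiset.count_filter_of_pos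
        (Multiset.mem_filter.mp (Multiset.mem_toFinset.mp hi)).2]
    · intro i _ hi
      rw [Multiset.count_eq_zero_of_notMem (by simpa using hi), Nat.factorial_zero]
  rw [hprod, hfact, show Fintype.card α - m.sum = p.parts.count 1 by omega]
  ring

end Equiv.Perm

/-- The contribution of `c` cycles of length `i` to the exponential generating function of square
permutations. -/
noncomputable def sqWeight (i c : ℕ) : ℝ :=
  if Even i ∧ Odd c then 0 else 1 / (i ^ c * c.factorial)

lemma sqWeight_nonneg (i c : ℕ) : 0 ≤ sqWeight i c := by
  unfold sqWeight
  split_ifs <;> positivity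

lemma sqWeight_zero_right (i : ℕ) : sqWeight i 0 = 1 := by
  simp [sqWeight]

namespace Equiv.Perm

variable {α : Type*} [Fintype α] [DecidableEq α]

lemma exists_sq_eq_iff_partition (σ : Equiv.Perm α) :
    (∃ τ : Equiv.Perm α, τ ^ 2 = σ) ↔ ∀ i, Even i → Even (σ.partition.parts.count i) := by
  rw [exists_sq_eq_iff]
  refine forall₂_congr fun i hi ↦ ?_
  have h1 : i ≠ 1 := by rintro rfl; exact Nat.not_even_one hi
  rw [parts_partition, Multiset.count_add, Multiset.count_replicate, if_neg h1.symm, add_zero]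

lemma card_sq_filter_partition (p : (Fintype.card α).Partition)
    [DecidablePred fun σ : Equiv.Perm α ↦ ∃ τ : Equiv.Perm α, τ ^ 2 = σ] :
    (((Finset.univ.filter fun σ : Equiv.Perm α ↦ ∃ τ : Equiv.Perm α, τ ^ 2 = σ).filter
      fun σ ↦ σ.partition = p).card : ℝ) / (Fintype.card α).factorial =
      p.parts.toFinsupp.prod sqWeight := by
  simp only [Finsupp.prod, Multiset.toFinsupp_support, Multiset.toFinsupp_apply]
  by_cases hp : ∀ i, Even i → Even (p.parts.count i)
  · have hfilter : ((Finset.univ.filter fun σ : Equiv.Perm α ↦ ∃ τ : Equiv.Perm α, τ ^ 2 = σ).filter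
        fun σ ↦ σ.partition = p) = Finset.univ.filter fun σ : Equiv.Perm α ↦ σ.partition = p := by
      rw [Finset.filter_filter]
      refine Finset.filter_congr fun σ _ ↦ and_iff_right_of_imp ?_
      rintro rfl
      exact (exists_sq_eq_iff_partition σ).mpr hp
    have hweight : ∀ i ∈ p.parts.toFinset, sqWeight i (p.parts.count i) =
        1 / ((i ^ p.parts.count i * (p.parts.count i).factorial : ℕ) : ℝ) := fun i _ ↦ by
      rw [sqWeight, if_neg fun h ↦ Nat.not_even_iff_odd.mpr h.2 (hp i h.1)]
      push_cast
      rfl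
    rw [hfilter, Finset.prod_congr rfl hweight, Finset.prod_div_distrib, Finset.prod_const_one,
      ← Nat.cast_prod, div_eq_div_iff (by positivity)]
    · rw [one_mul]
      exact_mod_cast card_filter_partition_mul_eq p
    · refine Nat.cast_ne_zero.mpr fun h ↦ ?_
      have := card_filter_partition_mul_eq p
      rw [h, mul_zero] at this
      exact Nat.factorial_ne_zero _ this.symm
  · rw [Finset.filter_filter, Finset.filter_false_of_mem, Finset.card_empty, Nat.cast_zero,
      zero_div]
    · push Not at hp
      obtain ⟨i, hi, hc⟩ := hp
      have hodd := Nat.not_even_iff_odd.mp hc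
      refine (Finset.prod_eq_zero (i := i) ?_ ?_).symm
      · exact Multiset.mem_toFinset.mpr (Multiset.count_pos.mp hodd.pos)
      · rw [sqWeight, if_pos ⟨hi, hodd⟩]
    · rintro σ - ⟨hσ, rfl⟩
      exact hp ((exists_sq_eq_iff_partition σ).mp hσ)

lemma card_sq_div_factorial :
    (Nat.card {σ : Equiv.Perm α // ∃ τ : Equiv.Perm α, τ ^ 2 = σ} : ℝ) /
      (Fintype.card α).factorial =
      (Nat.Partition.genFun sqWeight).coeff (Fintype.card α) := by
  classical
  rw [Nat.Partition.coeff_genFun, Nat.card_eq_fintype_card, Fintype.card_subtype,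
    Finset.card_eq_sum_card_fiberwise (f := partition) (t := Finset.univ) fun _ _ ↦ by simp,
    Nat.cast_sum, Finset.sum_div]
  exact Finset.sum_congr rfl fun p _ ↦ card_sq_filter_partition p

end Equiv.Perm

lemma numSquarePerms_div_factorial (n : ℕ) :
    (numSquarePerms n : ℝ) / n.factorial = (Nat.Partition.genFun sqWeight).coeff n := by
  simpa only [Fintype.card_fin, numSquarePerms] using Equiv.Perm.card_sq_div_factorial (α := Fin n)

lemma numSquarePerms_le_factorial (n : ℕ) : numSquarePerms n ≤ n.factorial := by
  calc numSquarePerms n ≤ Nat.card (Equiv.Perm (Fin n)) := Finite.card_subtype_le _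
    _ = n.factorial := by rw [Nat.card_perm, Nat.card_eq_fintype_card, Fintype.card_fin]

namespace Nat.Partition

/-- The character `f` restricted to parts of size at most `N`. -/
def truncChar {R : Type*} [Zero R] (f : ℕ → ℕ → R) (N i c : ℕ) : R :=
  if i ≤ N then f i c else 0

lemma coeff_genFun_truncChar {R : Type*} [CommSemiring R] (f : ℕ → ℕ → R) {n N : ℕ} (h : n ≤ N) :
    (genFun (truncChar f N)).coeff n = (genFun f).coeff n := by
  rw [coeff_genFun, coeff_genFun]
  refine Finset.sum_congr rfl fun p _ ↦ Finset.prod_congr rfl fun i hi ↦ ?_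
  rw [Multiset.toFinsupp_support, Multiset.mem_toFinset] at hi
  exact if_pos ((p.le_of_mem_parts hi).trans h)

lemma coeff_genFun_nonneg {f : ℕ → ℕ → ℝ} (hf : ∀ i c, 0 ≤ f i c) (n : ℕ) :
    0 ≤ (genFun f).coeff n := by
  rw [coeff_genFun]
  exact Finset.sum_nonneg fun p _ ↦ Finset.prod_nonneg fun i _ ↦ hf _ _

lemma coeff_genFun_mono {f g : ℕ → ℕ → ℝ} (hf : ∀ i c, 0 ≤ f i c) (hfg : ∀ i c, f i c ≤ g i c)
    (n : ℕ) : (genFun f).coeff n ≤ (genFun g).coeff n := by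
  rw [coeff_genFun, coeff_genFun]
  exact Finset.sum_le_sum fun p _ ↦ Finset.prod_le_prod (fun i _ ↦ hf _ _) fun i _ ↦ hfg _ _

open PowerSeries in
/-- The factor of `genFun f` which accounts for the parts of size `i`. -/
def genFunFactor {R : Type*} [CommSemiring R] (f : ℕ → ℕ → R) (i : ℕ) : R⟦X⟧ :=
  PowerSeries.mk fun m ↦ if i ∣ m then f i (m / i) else 0

open PowerSeries PowerSeries.WithPiTopology in
lemma one_add_tsum_eq_genFunFactor {R : Type*} [CommSemiring R] [TopologicalSpace R] [T2Space R]
    {f : ℕ → ℕ → R} {i : ℕ} (hi : i ≠ 0) (hf : f i 0 = 1) :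
    (1 + ∑' j, f i (j + 1) • X ^ (i * (j + 1)) : R⟦X⟧) = genFunFactor f i := by
  ext m
  rw [map_add, (summable_genFun_term' f hi).map_tsum _ (WithPiTopology.continuous_coeff _ _),
    genFunFactor, coeff_mk, coeff_one]
  simp only [coeff_smul, coeff_X_pow, smul_eq_mul, mul_ite, mul_one, mul_zero]
  split_ifs with hm hdvd hdvd
  · subst hm
    simp [hi, hf]
  · simp [hm] at hdvd
  · obtain ⟨c, rfl⟩ := hdvd
    obtain ⟨c, rfl⟩ := Nat.exists_eq_add_one_of_ne_zero (right_ne_zero_of_mul hm)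
    rw [zero_add, tsum_eq_single c, if_pos rfl, Nat.mul_div_cancel_left _ (Nat.pos_of_ne_zero hi)]
    intro b hb
    rw [if_neg]
    intro h
    exact hb (Nat.succ_injective (Nat.eq_of_mul_eq_mul_left (Nat.pos_of_ne_zero hi) h)).symm
  · rw [zero_add]
    refine (tsum_congr fun j ↦ if_neg ?_).trans tsum_zero
    rintro rfl
    exact hdvd (Dvd.intro _ rfl)

open PowerSeries PowerSeries.WithPiTopology in
lemma genFun_truncChar {R : Type*} [CommSemiring R] {f : ℕ → ℕ → R} (hf : ∀ i, f i 0 = 1) (N : ℕ) :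
    genFun (truncChar f N) = ∏ i ∈ Finset.range N, genFunFactor f (i + 1) := by
  let _ : TopologicalSpace R := ⊥
  have _ : DiscreteTopology R := ⟨rfl⟩
  refine (hasProd_genFun (truncChar f N)).unique ?_
  rw [Finset.prod_congr rfl fun i _ ↦
    (one_add_tsum_eq_genFunFactor i.succ_ne_zero (hf (i + 1))).symm]
  convert hasProd_prod_of_ne_finset_one (L := .unconditional ℕ) (s := Finset.range N) ?_ using 1
  · refine Finset.prod_congr rfl fun i hi ↦ ?_
    simp only [truncChar, if_pos (Nat.succ_le_of_lt (Finset.mem_range.mp hi))]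
  · intro i hi
    have : ¬ i + 1 ≤ N := by simpa using hi
    simp [truncChar, this]

end Nat.Partition

namespace PowerSeries

/-- The real power series `φ` converges absolutely at `x`, with sum `s`. -/
def HasAbsSumAt (φ : ℝ⟦X⟧) (x s : ℝ) : Prop :=
  (Summable fun n ↦ ‖φ.coeff n * x ^ n‖) ∧ ∑' n, φ.coeff n * x ^ n = s

lemma HasAbsSumAt.one (x : ℝ) : HasAbsSumAt 1 x 1 := by
  have h : ∀ n ≠ 0, (1 : ℝ⟦X⟧).coeff n * x ^ n = 0 := fun n hn ↦ by simp [coeff_one, hn]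
  refine ⟨summable_of_ne_finset_zero (s := {0}) fun n hn ↦ ?_, ?_⟩
  · rw [h n (by simpa using hn), norm_zero]
  · rw [tsum_eq_single 0 h]
    simp

lemma HasAbsSumAt.mul {φ ψ : ℝ⟦X⟧} {x s t : ℝ} (hφ : HasAbsSumAt φ x s) (hψ : HasAbsSumAt ψ x t) :
    HasAbsSumAt (φ * ψ) x (s * t) := by
  have hcoeff : ∀ n, (φ * ψ).coeff n * x ^ n = ∑ kl ∈ Finset.HasAntidiagonal.antidiagonal n,
      (φ.coeff kl.1 * x ^ kl.1) * (ψ.coeff kl.2 * x ^ kl.2) := fun n ↦ by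
    rw [coeff_mul, Finset.sum_mul]
    refine Finset.sum_congr rfl fun kl hkl ↦ ?_
    rw [← Finset.HasAntidiagonal.mem_antidiagonal.mp hkl, pow_add]
    ring
  constructor
  · simpa only [hcoeff] using summable_norm_sum_mul_antidiagonal_of_summable_norm hφ.1 hψ.1
  · simp only [hcoeff]
    rw [← tsum_mul_tsum_eq_tsum_sum_antidiagonal_of_summable_norm hφ.1 hψ.1, hφ.2, hψ.2]

lemma HasAbsSumAt.prod {ι : Type*} {φ : ι → ℝ⟦X⟧} {x : ℝ} {s : ι → ℝ}
    (h : ∀ i, HasAbsSumAt (φ i) x (s i)) (t : Finset ι) :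
    HasAbsSumAt (∏ i ∈ t, φ i) x (∏ i ∈ t, s i) := by
  classical
  induction t using Finset.induction_on with
  | empty => simpa using HasAbsSumAt.one x
  | insert a t ha ih =>
    rw [Finset.prod_insert ha, Finset.prod_insert ha]
    exact (h a).mul ih

lemma hasAbsSumAt_genFunFactor {f : ℕ → ℕ → ℝ} {i : ℕ} (hi : i ≠ 0) {x s : ℝ}
    (h : HasSum (fun c ↦ f i c * x ^ (i * c)) s) :
    HasAbsSumAt (Nat.Partition.genFunFactor f i) x s := by
  have hinj : Function.Injective (i * ·) := mul_right_injective₀ hi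
  have hsum : HasSum (fun n ↦ (Nat.Partition.genFunFactor f i).coeff n * x ^ n) s := by
    refine (hinj.hasSum_iff fun n hn ↦ ?_).mp ?_
    · rw [Nat.Partition.genFunFactor, coeff_mk, if_neg, zero_mul]
      rintro ⟨c, rfl⟩
      exact hn ⟨c, rfl⟩
    · refine h.congr_fun fun c ↦ ?_
      simp [Nat.Partition.genFunFactor, Nat.mul_div_cancel_left _ (Nat.pos_of_ne_zero hi)]
  exact ⟨hsum.summable.norm, hsum.tsum_eq⟩

end PowerSeries

lemma sqWeight_mul_pow_of_odd {i : ℕ} (hi : Odd i) (x : ℝ) (c : ℕ) :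
    sqWeight i c * x ^ (i * c) = (x ^ i / i) ^ c / c.factorial := by
  rw [sqWeight, if_neg fun h ↦ Nat.not_even_iff_odd.mpr hi h.1, div_pow, ← pow_mul]
  field_simp

lemma hasSum_sqWeight_of_odd {i : ℕ} (hi : Odd i) (x : ℝ) :
    HasSum (fun c ↦ sqWeight i c * x ^ (i * c)) (Real.exp (x ^ i / i)) := by
  simp only [sqWeight_mul_pow_of_odd hi, Real.exp_eq_exp_ℝ]
  exact NormedSpace.expSeries_div_hasSum_exp _

lemma hasSum_sqWeight_of_even {i : ℕ} (hi : Even i) (x : ℝ) :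
    HasSum (fun c ↦ sqWeight i c * x ^ (i * c)) (Real.cosh (x ^ i / i)) := by
  have hinj : Function.Injective (2 * · : ℕ → ℕ) := mul_right_injective₀ two_ne_zero
  refine (hinj.hasSum_iff fun c hc ↦ ?_).mp ?_
  · have hodd : Odd c := by
      refine Nat.not_even_iff_odd.mp fun h ↦ hc ?_
      obtain ⟨k, rfl⟩ := even_iff_two_dvd.mp h
      exact ⟨k, rfl⟩
    rw [sqWeight, if_pos ⟨hi, hodd⟩, zero_mul]
  · refine (Real.hasSum_cosh (x ^ i / i)).congr_fun fun c ↦ ?_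
    simp only [Function.comp_apply]
    rw [sqWeight, if_neg fun h ↦ Nat.not_even_iff_odd.mpr h.2 (even_two_mul c), div_pow, ← pow_mul]
    field_simp

lemma hasAbsSumAt_genFun_truncChar_sqWeight (x : ℝ) (M : ℕ) :
    (Nat.Partition.genFun (Nat.Partition.truncChar sqWeight (2 * M))).HasAbsSumAt x
      (Real.exp (∑ k ∈ Finset.range M, x ^ (2 * k + 1) / (2 * k + 1)) *
        ∏ k ∈ Finset.range M, Real.cosh (x ^ (2 * (k + 1)) / (2 * (k + 1)))) := by
  rw [Nat.Partition.genFun_truncChar sqWeight_zero_right, Real.exp_sum, ← Finset.prod_mul_distrib,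
    show ∏ i ∈ Finset.range (2 * M), Nat.Partition.genFunFactor sqWeight (i + 1) =
      ∏ k ∈ Finset.range M, (Nat.Partition.genFunFactor sqWeight (2 * k + 1) *
        Nat.Partition.genFunFactor sqWeight (2 * (k + 1))) by
      induction M with
      | zero => simp
      | succ M ih =>
        rw [mul_add_one, Finset.prod_range_succ, Finset.prod_range_succ, ih,
          Finset.prod_range_succ, mul_assoc]
        rfl]
  refine PowerSeries.HasAbsSumAt.prod (fun k ↦ ?_) _
  refine (PowerSeries.hasAbsSumAt_genFunFactor (by omega) ?_).mul
    (PowerSeries.hasAbsSumAt_genFunFactor (by omega) ?_)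
  · exact_mod_cast hasSum_sqWeight_of_odd (odd_two_mul_add_one k) x
  · exact_mod_cast hasSum_sqWeight_of_even (even_two_mul (k + 1)) x

lemma summable_pow_two_mul_succ {x : ℝ} (hx : |x| < 1) :
    Summable fun k : ℕ ↦ x ^ (2 * (k + 1)) := by
  simp only [pow_mul]
  exact (summable_nat_add_iff 1).mpr
    (summable_geometric_of_lt_one (sq_nonneg x) ((sq_lt_one_iff_abs_lt_one x).mpr hx))

lemma multipliable_cosh_pow_div {x : ℝ} (hx : |x| < 1) :
    Multipliable fun k : ℕ ↦ Real.cosh (x ^ (2 * (k + 1)) / (2 * (k + 1))) := by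
  refine Real.multipliable_of_summable_log (fun k ↦ Real.cosh_pos _) ?_
  refine (summable_pow_two_mul_succ hx).of_nonneg_of_le
    (fun k ↦ Real.log_nonneg (Real.one_le_cosh _)) fun k ↦ ?_
  set y := x ^ (2 * (k + 1)) with hy
  have hy0 : 0 ≤ y := (even_two_mul (k + 1)).pow_nonneg x
  have hy1 : y ≤ 1 := by
    rw [hy, ← (even_two_mul (k + 1)).pow_abs]
    exact pow_le_one₀ (abs_nonneg x) hx.le
  set z := y / (2 * ((k : ℝ) + 1)) with hz
  have hz0 : 0 ≤ z := by positivity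
  have hzy : z ≤ y := div_le_self hy0 (by linarith [Nat.cast_nonneg (α := ℝ) k])
  calc Real.log (Real.cosh z) ≤ z ^ 2 / 2 :=
        (Real.log_le_iff_le_exp (Real.cosh_pos _)).mpr (Real.cosh_le_exp_half_sq z)
    _ ≤ y := by nlinarith

lemma tendsto_exp_sum_odd {x : ℝ} (hx : |x| < 1) :
    Filter.Tendsto (fun M ↦ Real.exp (∑ k ∈ Finset.range M, x ^ (2 * k + 1) / (2 * k + 1)))
      Filter.atTop (nhds (Real.sqrt ((1 + x) / (1 - x)))) := by
  obtain ⟨h1, h2⟩ := abs_lt.mp hx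
  have hsum : HasSum (fun k : ℕ ↦ x ^ (2 * k + 1) / (2 * k + 1))
      (1 / 2 * (Real.log (1 + x) - Real.log (1 - x))) :=
    ((Real.hasSum_log_sub_log_of_abs_lt_one hx).mul_left (1 / 2)).congr_fun fun k ↦ by ring
  rw [Real.sqrt_eq_rpow, Real.rpow_def_of_pos (div_pos (by linarith) (by linarith)), mul_comm,
    Real.log_div (by linarith) (by linarith)]
  exact (Real.continuous_exp.tendsto _).comp hsum.tendsto_sum_nat

/-- Blum. For `|x| < 1`,
`∑_{n≥0} f(n)/n! xⁿ = ((1+x)/(1-x))^{1/2} ∏_{k=1}^∞ cosh(x^{2k}/(2k))`, where `f(n)` is the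
number of square permutations in `S_n`; both the series and the infinite product converge. -/
theorem square_perm_generating_function (x : ℝ) (hx : |x| < 1) :
    Summable (fun n : ℕ => (numSquarePerms n : ℝ) / n.factorial * x ^ n) ∧
    Multipliable (fun k : ℕ =>
      Real.cosh (x ^ (2 * (k + 1)) / (2 * (k + 1)))) ∧
    ∑' n : ℕ, (numSquarePerms n : ℝ) / n.factorial * x ^ n =
      Real.sqrt ((1 + x) / (1 - x)) *
        ∏' k : ℕ, Real.cosh (x ^ (2 * (k + 1)) / (2 * (k + 1))) := by
  have hgeom : Summable fun n : ℕ ↦ |x| ^ n := summable_geometric_of_lt_one (abs_nonneg x) hx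
  have hle : ∀ n, (Nat.Partition.genFun sqWeight).coeff n ≤ 1 := fun n ↦ by
    rw [← numSquarePerms_div_factorial]
    exact div_le_one_of_le₀ (by exact_mod_cast numSquarePerms_le_factorial n) (by positivity)
  have hbound : ∀ {a : ℝ} (n : ℕ), 0 ≤ a → a ≤ 1 → ‖a * x ^ n‖ ≤ |x| ^ n := fun n h0 h1 ↦ by
    rw [norm_mul, norm_pow, Real.norm_eq_abs, Real.norm_eq_abs, abs_of_nonneg h0]
    exact mul_le_of_le_one_left (by positivity) h1
  have hmult := multipliable_cosh_pow_div hx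
  simp only [numSquarePerms_div_factorial]
  refine ⟨hgeom.of_norm_bounded fun n ↦
    hbound n (Nat.Partition.coeff_genFun_nonneg sqWeight_nonneg n) (hle n), hmult, ?_⟩
  have htrunc0 : ∀ N i c, 0 ≤ Nat.Partition.truncChar sqWeight N i c := fun N i c ↦ by
    unfold Nat.Partition.truncChar
    split_ifs
    exacts [sqWeight_nonneg i c, le_rfl]
  have htrunc1 : ∀ N i c, Nat.Partition.truncChar sqWeight N i c ≤ sqWeight i c := fun N i c ↦ by
    unfold Nat.Partition.truncChar
    split_ifs
    exacts [le_rfl, sqWeight_nonneg i c]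
  have hlim : Filter.Tendsto (fun M ↦ ∑' n,
      (Nat.Partition.genFun (Nat.Partition.truncChar sqWeight (2 * M))).coeff n * x ^ n)
      Filter.atTop (nhds (∑' n, (Nat.Partition.genFun sqWeight).coeff n * x ^ n)) := by
    refine tendsto_tsum_of_dominated_convergence hgeom (fun n ↦ ?_) (.of_forall fun M n ↦ ?_)
    · refine tendsto_const_nhds.congr' ?_
      filter_upwards [Filter.eventually_ge_atTop n] with M hM
      rw [Nat.Partition.coeff_genFun_truncChar sqWeight (by omega)]
    · exact hbound n (Nat.Partition.coeff_genFun_nonneg (htrunc0 _) n)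
        ((Nat.Partition.coeff_genFun_mono (htrunc0 _) (htrunc1 _) n).trans (hle n))
  refine tendsto_nhds_unique hlim ?_
  simp only [(hasAbsSumAt_genFun_truncChar_sqWeight x _).2]
  exact (tendsto_exp_sum_odd hx).mul hmult.hasProd.tendsto_prod_nat
end

section
/- For n ≥ 0 let f(n) denote the number of permutations in the symmetric group S_n that are squares (i.e., of the form τ² for some τ ∈ S_n), with f(0) = 1. Then for every integer k ≥ 0, f(2k+1) = (2k+1)·f(2k). -/
open Equiv Function Finset

theorem minimalPeriod_eq_of_iterate_comm {α β : Type*} {f : α → α} {g : β → β} {φ : α → β}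
    (hφ : Injective φ) {x : α} (h : ∀ n, g^[n] (φ x) = φ (f^[n] x)) :
    minimalPeriod g (φ x) = minimalPeriod f x :=
  minimalPeriod_eq_minimalPeriod_iff.2 fun n => by
    simp [IsPeriodicPt, IsFixedPt, h, hφ.eq_iff]

theorem minimalPeriod_eq_of_semiconj {α β : Type*} {f : α → α} {g : β → β} {φ : α → β}
    (hφ : Injective φ) (h : Semiconj φ f g) (x : α) :
    minimalPeriod g (φ x) = minimalPeriod f x :=
  minimalPeriod_eq_of_iterate_comm hφ fun n => ((h.iterate_right n).eq x).symm

namespace Equiv.Perm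

theorem mem_periodicPts {α : Type*} [Finite α] (σ : Perm α) (x : α) : x ∈ periodicPts σ :=
  σ.injective.mem_periodicPts x

theorem SameCycle.minimalPeriod_eq {α : Type*} [Finite α] {σ : Perm α} {x y : α}
    (h : σ.SameCycle x y) : minimalPeriod σ y = minimalPeriod σ x := by
  obtain ⟨n, rfl⟩ := h.exists_nat_pow_eq
  rw [coe_pow, minimalPeriod_apply_iterate (σ.mem_periodicPts x)]

/-- All cycles of `σ`, fixed points included, have odd length. -/
def AllCyclesOdd {α : Type*} (σ : Perm α) : Prop :=
  ∀ x, Odd (minimalPeriod σ x)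

/-- All cycles of `σ`, fixed points included, have even length. -/
def AllCyclesEven {α : Type*} (σ : Perm α) : Prop :=
  ∀ x, Even (minimalPeriod σ x)

/-- All cycles of `σ` other than the one through `a` have odd length. -/
def OtherCyclesOdd {α : Type*} (σ : Perm α) (a : α) : Prop :=
  ∀ x, ¬ σ.SameCycle a x → Odd (minimalPeriod σ x)

theorem allCyclesOdd_iff {α : Type*} [Finite α] {σ : Perm α} (a : α) :
    σ.AllCyclesOdd ↔ Odd (minimalPeriod σ a) ∧ σ.OtherCyclesOdd a := by
  refine ⟨fun h => ⟨h a, fun x _ => h x⟩, fun ⟨ha, h⟩ x => ?_⟩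
  by_cases hx : σ.SameCycle a x
  · rwa [hx.minimalPeriod_eq]
  · exact h x hx

section Transport

variable {α β : Type*} (e : α ≃ β) (σ : Perm α)

theorem semiconj_permCongr : Semiconj e σ (e.permCongr σ) := fun x => by simp

theorem minimalPeriod_permCongr (x : α) :
    minimalPeriod (e.permCongr σ) (e x) = minimalPeriod σ x :=
  minimalPeriod_eq_of_semiconj e.injective (semiconj_permCongr e σ) x

theorem sameCycle_permCongr (x y : α) :
    (e.permCongr σ).SameCycle (e x) (e y) ↔ σ.SameCycle x y := by
  have h (n : ℤ) : (e.permCongr σ) ^ n = e.permCongr (σ ^ n) :=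
    (map_zpow e.permCongrHom σ n).symm
  simp [SameCycle, h]

theorem allCyclesOdd_permCongr : (e.permCongr σ).AllCyclesOdd ↔ σ.AllCyclesOdd := by
  simp [AllCyclesOdd, e.surjective.forall, minimalPeriod_permCongr]

theorem allCyclesEven_permCongr : (e.permCongr σ).AllCyclesEven ↔ σ.AllCyclesEven := by
  simp [AllCyclesEven, e.surjective.forall, minimalPeriod_permCongr]

theorem otherCyclesOdd_permCongr (a : α) :
    (e.permCongr σ).OtherCyclesOdd (e a) ↔ σ.OtherCyclesOdd a := by
  simp [OtherCyclesOdd, e.surjective.forall, minimalPeriod_permCongr, sameCycle_permCongr]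

theorem exists_sq_eq_permCongr :
    (∃ τ, τ ^ 2 = e.permCongr σ) ↔ ∃ τ, τ ^ 2 = σ := by
  rw [e.permCongrHom.surjective.exists]
  exact exists_congr fun τ => by
    rw [← map_pow]; exact e.permCongrHom.injective.eq_iff

end Transport

section InsertNone

variable {α : Type*} [DecidableEq α] (τ : Perm α) (y : α)

/-- Insert `none` right before `y` in the cycle of `τ` through `y`. -/
def insertNone : Perm (Option α) := swap none (some y) * optionCongr τ

theorem insertNone_none : insertNone τ y none = some y := by simp [insertNone]

theorem insertNone_some_of_eq {x : α} (h : τ x = y) : insertNone τ y (some x) = none := by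
  simp [insertNone, h]

theorem insertNone_some_of_ne {x : α} (h : τ x ≠ y) :
    insertNone τ y (some x) = some (τ x) := by
  simp [insertNone, swap_apply_of_ne_of_ne, h]

theorem iterate_insertNone_none {n : ℕ} (hn : n < minimalPeriod τ y) :
    (insertNone τ y)^[n + 1] none = some (τ^[n] y) := by
  induction n with
  | zero => simp [insertNone_none]
  | succ n ih =>
    rw [iterate_succ_apply', ih (by omega), insertNone_some_of_ne, iterate_succ_apply']
    rw [← iterate_succ_apply' τ]
    exact not_isPeriodicPt_of_pos_of_lt_minimalPeriod (by omega) hn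

theorem minimalPeriod_insertNone_some {x : α} (hx : ¬ τ.SameCycle y x) :
    minimalPeriod (insertNone τ y) (some x) = minimalPeriod τ x := by
  refine minimalPeriod_eq_of_iterate_comm (Option.some_injective α) fun n => ?_
  induction n with
  | zero => rfl
  | succ n ih =>
    rw [iterate_succ_apply', ih, insertNone_some_of_ne, iterate_succ_apply']
    rw [← iterate_succ_apply' τ, ← coe_pow]
    intro h
    exact hx (h ▸ (sameCycle_pow_left.2 (SameCycle.refl _ _)))

variable [Finite α]

theorem minimalPeriod_insertNone_none :
    minimalPeriod (insertNone τ y) none = minimalPeriod τ y + 1 := by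
  have hpos := minimalPeriod_pos_of_mem_periodicPts (τ.mem_periodicPts y)
  obtain ⟨q, hq⟩ := Nat.exists_eq_add_of_lt hpos
  have hper : IsPeriodicPt (insertNone τ y) (minimalPeriod τ y + 1) none := by
    rw [IsPeriodicPt, IsFixedPt, iterate_succ_apply', hq, zero_add,
      iterate_insertNone_none τ y (by omega), insertNone_some_of_eq]
    rw [← iterate_succ_apply' τ]
    simpa [hq] using iterate_minimalPeriod (f := τ) (x := y)
  refine le_antisymm (hper.minimalPeriod_le (by omega)) ?_
  by_contra! hlt
  have h := iterate_minimalPeriod (f := insertNone τ y) (x := none)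
  obtain ⟨m, hm⟩ := Nat.exists_eq_add_of_lt (hper.minimalPeriod_pos (by omega))
  rw [hm, zero_add, iterate_insertNone_none τ y (by omega)] at h
  simp at h

theorem sameCycle_insertNone_iff (x : α) :
    (insertNone τ y).SameCycle none (some x) ↔ τ.SameCycle y x := by
  constructor
  · intro h
    obtain ⟨n, hn⟩ := h.exists_nat_pow_eq
    have key (n : ℕ) : ∀ z, ((insertNone τ y) ^ n) none = some z → τ.SameCycle y z := by
      induction n with
      | zero => simp
      | succ n ih =>
        intro z hz
        rw [pow_succ', mul_apply] at hz
        cases hw : ((insertNone τ y) ^ n) none with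
        | none =>
          rw [hw, insertNone_none] at hz
          exact Option.some.inj hz ▸ SameCycle.refl _ _
        | some w =>
          rw [hw] at hz
          by_cases hy : τ w = y
          · simp [insertNone_some_of_eq τ y hy] at hz
          · rw [insertNone_some_of_ne τ y hy] at hz
            exact Option.some.inj hz ▸ (ih w hw).apply_right
    exact key n x hn
  · intro h
    have hy : (insertNone τ y).SameCycle none (some y) :=
      insertNone_none τ y ▸ (SameCycle.refl _ _).apply_right
    obtain ⟨n, rfl⟩ := h.exists_nat_pow_eq
    induction n with
    | zero => simpa using hy
    | succ n ih =>
      rw [pow_succ', mul_apply]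
      by_cases hw : τ ((τ ^ n) y) = y
      · rwa [hw]
      · rw [← insertNone_some_of_ne τ y hw]
        exact (ih (sameCycle_pow_right.2 (SameCycle.refl _ _))).apply_right

theorem otherCyclesOdd_insertNone_iff :
    (insertNone τ y).OtherCyclesOdd none ↔ τ.OtherCyclesOdd y := by
  rw [OtherCyclesOdd, Option.forall, OtherCyclesOdd]
  simp only [SameCycle.refl, not_true_eq_false, false_imp_iff, true_and,
    sameCycle_insertNone_iff]
  exact forall₂_congr fun x hx => by rw [minimalPeriod_insertNone_some τ y hx]

end InsertNone

theorem minimalPeriod_optionCongr_none {α : Type*} (τ : Perm α) :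
    minimalPeriod (optionCongr τ) none = 1 :=
  minimalPeriod_eq_one_iff_isFixedPt.2 (by simp [IsFixedPt])

theorem allCyclesOdd_optionCongr {α : Type*} (τ : Perm α) :
    AllCyclesOdd (optionCongr τ) ↔ τ.AllCyclesOdd := by
  have h (x : α) : minimalPeriod (optionCongr τ) (some x) = minimalPeriod τ x :=
    minimalPeriod_eq_of_semiconj (Option.some_injective α) (fun x => by simp) x
  simp [AllCyclesOdd, Option.forall, minimalPeriod_optionCongr_none, h]

theorem card_perm_option {α : Type*} [Fintype α] [DecidableEq α] (P : Perm (Option α) → Prop) :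
    Nat.card {σ // P σ} = Nat.card {τ : Perm α // P (optionCongr τ)} +
      ∑ y, Nat.card {τ : Perm α // P (insertNone τ y)} := by
  rw [Nat.card_congr ((decomposeOption.symm.subtypeEquivOfSubtype (p := P)).symm.trans
    (subtypeProdEquivSigmaSubtype fun a τ => P (decomposeOption.symm (a, τ)))),
    Nat.card_sigma, Fintype.sum_option]
  simp only [decomposeOption_symm_apply, swap_self]
  rfl

theorem card_allCyclesOdd_option (α : Type*) [Fintype α] [DecidableEq α] :
    Nat.card {σ : Perm (Option α) // σ.AllCyclesOdd} =
      Nat.card {σ : Perm α // σ.AllCyclesOdd} +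
        ∑ y, Nat.card {σ : Perm α // Even (minimalPeriod σ y) ∧ σ.OtherCyclesOdd y} := by
  rw [card_perm_option]
  simp only [allCyclesOdd_optionCongr]
  congr 1
  simp only [allCyclesOdd_iff (none : Option α),
    minimalPeriod_insertNone_none, otherCyclesOdd_insertNone_iff, Nat.odd_add_one,
    Nat.not_odd_iff_even]

theorem card_even_otherCyclesOdd_option (α : Type*) [Fintype α] [DecidableEq α] :
    Nat.card {σ : Perm (Option α) // Even (minimalPeriod σ none) ∧ σ.OtherCyclesOdd none} =
      Fintype.card α * Nat.card {σ : Perm α // σ.AllCyclesOdd} := by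
  rw [card_perm_option]
  simp [minimalPeriod_optionCongr_none, minimalPeriod_insertNone_none,
    otherCyclesOdd_insertNone_iff, Nat.even_add_one, ← allCyclesOdd_iff]

/-- The number of permutations of `n` letters all of whose cycles have odd length. -/
noncomputable def numOddCycles (n : ℕ) : ℕ :=
  Nat.card {σ : Perm (Fin n) // σ.AllCyclesOdd}

theorem card_allCyclesOdd (α : Type*) [Fintype α] :
    Nat.card {σ : Perm α // σ.AllCyclesOdd} = numOddCycles (Fintype.card α) :=
  Nat.card_congr <| (Fintype.equivFin α).permCongr.subtypeEquiv fun σ =>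
    (allCyclesOdd_permCongr _ σ).symm

theorem card_even_otherCyclesOdd {α : Type*} [Fintype α] {n : ℕ} (hα : Fintype.card α = n + 1)
    (y : α) :
    Nat.card {σ : Perm α // Even (minimalPeriod σ y) ∧ σ.OtherCyclesOdd y} =
      n * numOddCycles n := by
  classical
  let e : α ≃ Option {x // x ≠ y} := (optionSubtypeNe y).symm
  have hy : e y = none := by simp [e]
  have hcard : Fintype.card {x // x ≠ y} = n := by
    simp [Fintype.card_subtype_compl, hα]
  have h := card_even_otherCyclesOdd_option {x // x ≠ y}
  rw [card_allCyclesOdd, hcard] at h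
  rw [← h, ← hy]
  exact Nat.card_congr <| e.permCongr.subtypeEquiv fun σ => by
    rw [minimalPeriod_permCongr, otherCyclesOdd_permCongr]

theorem numOddCycles_add_two (n : ℕ) :
    numOddCycles (n + 2) = numOddCycles (n + 1) + (n + 1) * (n * numOddCycles n) := by
  have h := card_allCyclesOdd_option (Fin (n + 1))
  simpa [card_allCyclesOdd, card_even_otherCyclesOdd] using h

theorem numOddCycles_one : numOddCycles 1 = numOddCycles 0 := by
  have h := card_allCyclesOdd_option (Fin 0)
  simpa [card_allCyclesOdd] using h

theorem numOddCycles_two_mul_add_one (m : ℕ) :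
    numOddCycles (2 * m + 1) = (2 * m + 1) * numOddCycles (2 * m) := by
  induction m with
  | zero => simp [numOddCycles_one]
  | succ m ih =>
    have h : numOddCycles (2 * m + 2) = (2 * m + 1) * numOddCycles (2 * m + 1) := by
      rw [numOddCycles_add_two, ih]; ring
    rw [show 2 * (m + 1) + 1 = 2 * m + 1 + 2 by ring, numOddCycles_add_two,
      show 2 * (m + 1) = 2 * m + 2 by ring, show 2 * m + 1 + 1 = 2 * m + 2 by ring, h]
    ring

theorem exists_odd_pow_pow_two_pow_eq_one {α : Type*} [Finite α] (σ : Perm α) :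
    ∃ m k, Odd m ∧ (σ ^ m) ^ 2 ^ k = 1 := by
  obtain ⟨k, m, hm, h⟩ := Nat.exists_eq_two_pow_mul_odd (orderOf_pos σ).ne'
  exact ⟨m, k, hm, by rw [← pow_mul, mul_comm, ← h, pow_orderOf_eq_one]⟩

theorem AllCyclesOdd.exists_sq_eq {α : Type*} [Finite α] {σ : Perm α} (h : σ.AllCyclesOdd) :
    ∃ τ, τ ^ 2 = σ := by
  obtain ⟨m, k, ⟨c, hc⟩, hk⟩ := σ.exists_odd_pow_pow_two_pow_eq_one
  have hσ : σ ^ m = 1 := by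
    ext x
    have hdvd : minimalPeriod σ x ∣ m * 2 ^ k := by
      refine IsPeriodicPt.minimalPeriod_dvd ?_
      rw [IsPeriodicPt, IsFixedPt, ← coe_pow, pow_mul, hk, one_apply]
    have := isPeriodicPt_iff_minimalPeriod_dvd.2
      (((h x).coprime_two_right.pow_right k).dvd_of_dvd_mul_right hdvd)
    rwa [coe_pow]
  refine ⟨σ ^ (c + 1), ?_⟩
  rw [← pow_mul, show (c + 1) * 2 = m + 1 by omega, pow_succ, hσ, one_mul]

theorem AllCyclesEven.even_card {α : Type*} [Fintype α] {σ : Perm α} (h : σ.AllCyclesEven) :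
    Even (Fintype.card α) := by
  by_contra hα
  obtain ⟨m, k, hm, hk⟩ := σ.exists_odd_pow_pow_two_pow_eq_one
  obtain ⟨x, hx⟩ := exists_fixed_point_of_prime (p := 2) (by rwa [← even_iff_two_dvd]) hk
  rw [coe_pow] at hx
  exact Nat.not_even_iff_odd.2 (hm.of_dvd_nat (IsPeriodicPt.minimalPeriod_dvd hx)) (h x)

section SubtypeCongr

variable {α : Type*} {p : α → Prop} [DecidablePred p]
  (σ : Perm {x // p x}) (ρ : Perm {x // ¬ p x})

theorem minimalPeriod_subtypeCongr_left (x : {x // p x}) :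
    minimalPeriod (σ.subtypeCongr ρ) x = minimalPeriod σ x :=
  minimalPeriod_eq_of_semiconj Subtype.val_injective (fun x => by simp) x

theorem minimalPeriod_subtypeCongr_right (x : {x // ¬ p x}) :
    minimalPeriod (σ.subtypeCongr ρ) x = minimalPeriod ρ x :=
  minimalPeriod_eq_of_semiconj Subtype.val_injective (fun x => by simp) x

theorem forall_iff_odd_minimalPeriod_subtypeCongr :
    (∀ x, p x ↔ Odd (minimalPeriod (σ.subtypeCongr ρ) x)) ↔
      σ.AllCyclesOdd ∧ ρ.AllCyclesEven := by
  constructor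
  · intro h
    refine ⟨fun x => ?_, fun x => ?_⟩
    · rw [← minimalPeriod_subtypeCongr_left σ ρ]
      exact (h x).1 x.2
    · rw [← minimalPeriod_subtypeCongr_right σ ρ, ← Nat.not_odd_iff_even]
      exact mt (h x).2 x.2
  · rintro ⟨hσ, hρ⟩ x
    by_cases hx : p x
    · simpa [hx] using (minimalPeriod_subtypeCongr_left σ ρ ⟨x, hx⟩).symm ▸ hσ ⟨x, hx⟩
    · simpa [hx] using (minimalPeriod_subtypeCongr_right σ ρ ⟨x, hx⟩).symm ▸ hρ ⟨x, hx⟩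

theorem exists_sq_eq_subtypeCongr_iff [Finite α]
    (h : ∀ x, p x ↔ Odd (minimalPeriod (σ.subtypeCongr ρ) x)) :
    (∃ τ, τ ^ 2 = σ.subtypeCongr ρ) ↔ ∃ τ, τ ^ 2 = ρ := by
  constructor
  · rintro ⟨τ, hτ⟩
    have hp (x : α) : ¬ p (τ x) ↔ ¬ p x := by
      rw [h, h, minimalPeriod_eq_of_semiconj (f := σ.subtypeCongr ρ) τ.injective]
      intro x
      simp [← hτ, sq]
    refine ⟨τ.subtypePerm hp, Equiv.ext fun x => Subtype.ext ?_⟩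
    rw [← subtypeCongr.right_apply_subtype σ ρ x, ← hτ]
    rfl
  · rintro ⟨τ, rfl⟩
    obtain ⟨τ', rfl⟩ := ((forall_iff_odd_minimalPeriod_subtypeCongr _ _).1 h).1.exists_sq_eq
    exact ⟨τ'.subtypeCongr τ, (map_pow (subtypeCongrHom p) (τ', τ) 2).symm⟩

end SubtypeCongr

theorem card_sq_of_oddPoints {α : Type*} [Finite α] (p : α → Prop) [DecidablePred p] :
    Nat.card {σ : Perm α // (∃ τ, τ ^ 2 = σ) ∧ ∀ x, p x ↔ Odd (minimalPeriod σ x)} =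
      Nat.card {σ : Perm {x // p x} // σ.AllCyclesOdd} *
        Nat.card {ρ : Perm {x // ¬ p x} // ρ.AllCyclesEven ∧ ∃ τ, τ ^ 2 = ρ} := by
  rw [← Nat.card_prod]
  have hmem (q : {σ : Perm {x // p x} // σ.AllCyclesOdd} ×
      {ρ : Perm {x // ¬ p x} // ρ.AllCyclesEven ∧ ∃ τ, τ ^ 2 = ρ}) :
      (∃ τ, τ ^ 2 = q.1.1.subtypeCongr q.2.1) ∧
        ∀ x, p x ↔ Odd (minimalPeriod (q.1.1.subtypeCongr q.2.1) x) := by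
    have h := (forall_iff_odd_minimalPeriod_subtypeCongr _ _).2 ⟨q.1.2, q.2.2.1⟩
    exact ⟨(exists_sq_eq_subtypeCongr_iff _ _ h).2 q.2.2.2, h⟩
  refine (Nat.card_eq_of_bijective (fun q => ⟨_, hmem q⟩) ⟨?_, ?_⟩).symm
  · rintro ⟨⟨σ, _⟩, ⟨ρ, _⟩⟩ ⟨⟨σ', _⟩, ⟨ρ', _⟩⟩ h
    have := @subtypeCongrHom_injective _ p _ (σ, ρ) (σ', ρ') (Subtype.ext_iff.1 h)
    simpa using this
  · rintro ⟨σ, hsq, h⟩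
    have hp (x : α) : p (σ x) ↔ p x := by
      rw [h, h, minimalPeriod_apply (σ.mem_periodicPts x)]
    obtain ⟨a, b, rfl⟩ : ∃ (a : Perm {x // p x}) (b : Perm {x // ¬ p x}),
        a.subtypeCongr b = σ :=
      ⟨σ.subtypePerm hp, σ.subtypePerm fun x => not_congr (hp x), Equiv.ext fun x => by
        by_cases hx : p x <;> simp [hx]⟩
    have hab := (forall_iff_odd_minimalPeriod_subtypeCongr a b).1 h
    exact ⟨(⟨a, hab.1⟩, ⟨b, hab.2, (exists_sq_eq_subtypeCongr_iff a b h).1 hsq⟩), rfl⟩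

/-- The number of square permutations of `n` letters all of whose cycles have even length. -/
noncomputable def numEvenCyclesSquares (n : ℕ) : ℕ :=
  Nat.card {σ : Perm (Fin n) // σ.AllCyclesEven ∧ ∃ τ, τ ^ 2 = σ}

theorem card_allCyclesEven_sq (α : Type*) [Fintype α] :
    Nat.card {σ : Perm α // σ.AllCyclesEven ∧ ∃ τ, τ ^ 2 = σ} =
      numEvenCyclesSquares (Fintype.card α) :=
  Nat.card_congr <| (Fintype.equivFin α).permCongr.subtypeEquiv fun σ =>
    and_congr (allCyclesEven_permCongr _ σ).symm (exists_sq_eq_permCongr _ σ).symm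

theorem numEvenCyclesSquares_of_odd {n : ℕ} (hn : Odd n) : numEvenCyclesSquares n = 0 := by
  refine Nat.card_eq_zero.2 (Or.inl ⟨fun ⟨σ, hσ, _⟩ => ?_⟩)
  exact Nat.not_even_iff_odd.2 hn (by simpa using hσ.even_card)

end Equiv.Perm

open Equiv.Perm

theorem numSquarePerms_eq_sum (n : ℕ) :
    numSquarePerms n =
      ∑ m ∈ range (n + 1), n.choose m * (numOddCycles m * numEvenCyclesSquares (n - m)) := by
  classical
  let oddPoints (σ : {σ : Perm (Fin n) // ∃ τ, τ ^ 2 = σ}) : Finset (Fin n) :=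
    {x | Odd (minimalPeriod σ.1 x)}
  have hfiber (A : Finset (Fin n)) : Nat.card {σ // oddPoints σ = A} =
      numOddCycles #A * numEvenCyclesSquares (n - #A) := by
    have h := card_sq_of_oddPoints (· ∈ A)
    rw [card_allCyclesOdd, card_allCyclesEven_sq, Fintype.card_subtype_compl] at h
    simp only [Fintype.card_coe, Fintype.card_fin] at h
    rw [← h]
    refine Nat.card_congr ((Equiv.subtypeSubtypeEquivSubtypeInter _ _).symm.trans
      (Equiv.subtypeEquivRight fun σ => ?_)).symm
    simp [oddPoints, Finset.ext_iff, iff_comm]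
  rw [numSquarePerms, ← Nat.card_congr (Equiv.sigmaFiberEquiv oddPoints), Nat.card_sigma]
  simp only [hfiber]
  rw [← Finset.powerset_univ,
    sum_powerset_apply_card fun m => numOddCycles m * numEvenCyclesSquares (n - m)]
  simp

/-- Blum. `f(2k+1) = (2k+1) ⬝ f(2k)`, where `f(n)` is the number of
square permutations in `S_n`. -/
theorem numSquarePerms_odd (k : ℕ) :
    numSquarePerms (2 * k + 1) = (2 * k + 1) * numSquarePerms (2 * k) := by
  rw [numSquarePerms_eq_sum, numSquarePerms_eq_sum, sum_range_succ', mul_sum,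
    numEvenCyclesSquares_of_odd (n := 2 * k + 1 - 0) (by simp)]
  simp only [mul_zero, add_zero]
  refine sum_congr rfl fun m hm => ?_
  rw [Nat.add_sub_add_right]
  rcases Nat.even_or_odd' m with ⟨j, rfl | rfl⟩
  · rw [numOddCycles_two_mul_add_one]
    linear_combination (numOddCycles (2 * j) * numEvenCyclesSquares (2 * k - 2 * j)) *
      (Nat.add_one_mul_choose_eq (2 * k) (2 * j)).symm
  · have hj : Odd (2 * k - (2 * j + 1)) := by
      rw [mem_range] at hm
      exact ⟨k - j - 1, by omega⟩
    simp [numEvenCyclesSquares_of_odd hj]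
end
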